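/- arXiv:1704.05771 — 9 statements merged into one kernel-verified Lean document; each statement's English description precedes it below -/
import Mathlib

section
/- Let n ≥ 1 and let P be a positive definite self-adjoint linear operator on ℝ^{n+1} having at most two distinct eigenvalues. Then the projective map T : Sⁿ → Sⁿ, T(q) = P(q)/‖P(q)‖, is the optimal transportation map between vol and T_#(vol) for the cost c(p,q) = d(p,q)²/2; that is, for every Borel map F : Sⁿ → Sⁿ with F_#(vol) = T_#(vol) one has ∫ c(p,T(p)) dvol(p) ≤ ∫ c(p,F(p)) dvol(p). -/
/- Polar factorization of projective maps of the sphere (Godoy–Salvai, Theorem 2,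
sufficiency): if `P` is a positive definite self-adjoint operator of `ℝ^{n+1}` with at
most two distinct eigenvalues, then the projective map `T(q) = P(q)/‖P(q)‖` of `Sⁿ` is
the optimal transport map (for the cost `d²/2`) between `vol` and `T₃(vol)`. -/

open MeasureTheory Metric
open scoped InnerProductSpace

noncomputable section

/-- The map induced on the unit sphere by a linear isometry of the ambient space. -/
def rotSphere {E : Type*} [NormedAddCommGroup E] [InnerProductSpace ℝ E]
    (R : E ≃ₗᵢ[ℝ] E) (p : sphere (0 : E) 1) : sphere (0 : E) 1 :=
  ⟨R p, by
    have hp := mem_sphere_zero_iff_norm.mp p.2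
    simp [mem_sphere_zero_iff_norm, hp]⟩

/-- A measure on the unit sphere is rotation invariant if it is preserved by every
linear isometry of the ambient space. -/
def IsRotationInvariant {E : Type*} [NormedAddCommGroup E] [InnerProductSpace ℝ E]
    [MeasurableSpace E] [BorelSpace E] (vol : Measure (sphere (0 : E) 1)) : Prop :=
  ∀ R : E ≃ₗᵢ[ℝ] E, Measure.map (rotSphere R) vol = vol

/-- The quadratic transport cost `c(p,q) = d(p,q)²/2` on the sphere, where
`d(p,q) = arccos ⟪p,q⟫` is the geodesic distance. -/
def sphereCost {E : Type*} [NormedAddCommGroup E] [InnerProductSpace ℝ E]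
    (p q : sphere (0 : E) 1) : ℝ :=
  Real.arccos ⟪(p : E), (q : E)⟫_ℝ ^ 2 / 2

/-- The angle whose tangent is `(b / a) * tan t`, for `t ∈ [0, π / 2]`. -/
def angleMap (a b t : ℝ) : ℝ :=
  Real.arcsin (b * Real.sin t / √(a ^ 2 * Real.cos t ^ 2 + b ^ 2 * Real.sin t ^ 2))

section AngleMap

variable {a b s t : ℝ}

lemma angleMap_radicand_pos (ha : 0 < a) (hb : 0 < b) (t : ℝ) :
    0 < a ^ 2 * Real.cos t ^ 2 + b ^ 2 * Real.sin t ^ 2 := by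
  by_cases h : Real.sin t = 0
  · have : Real.cos t ^ 2 = 1 := by nlinarith [Real.sin_sq_add_cos_sq t]
    rw [h, this]
    positivity
  · positivity

lemma continuous_angleMap (ha : 0 < a) (hb : 0 < b) : Continuous (angleMap a b) := by
  unfold angleMap
  refine Real.continuous_arcsin.comp (Continuous.div (by fun_prop) (by fun_prop) fun t => ?_)
  exact (Real.sqrt_pos.2 (angleMap_radicand_pos ha hb t)).ne'

lemma sin_angleMap (ha : 0 < a) (hb : 0 < b) (t : ℝ) :
    Real.sin (angleMap a b t) =
      b * Real.sin t / √(a ^ 2 * Real.cos t ^ 2 + b ^ 2 * Real.sin t ^ 2) := by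
  have hD := Real.sqrt_pos.2 (angleMap_radicand_pos ha hb t)
  have h : |b * Real.sin t| ≤ √(a ^ 2 * Real.cos t ^ 2 + b ^ 2 * Real.sin t ^ 2) :=
    Real.abs_le_sqrt (by nlinarith [sq_nonneg (a * Real.cos t)])
  obtain ⟨h₁, h₂⟩ := abs_le.mp h
  refine Real.sin_arcsin ?_ ?_
  · rw [le_div_iff₀ hD]; linarith
  · rw [div_le_iff₀ hD]; linarith

lemma cos_angleMap (ha : 0 < a) (hb : 0 < b) (ht : 0 ≤ Real.cos t) :
    Real.cos (angleMap a b t) =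
      a * Real.cos t / √(a ^ 2 * Real.cos t ^ 2 + b ^ 2 * Real.sin t ^ 2) := by
  have hR := angleMap_radicand_pos ha hb t
  have hD := Real.sqrt_pos.2 hR
  have hsq : 1 - (b * Real.sin t / √(a ^ 2 * Real.cos t ^ 2 + b ^ 2 * Real.sin t ^ 2)) ^ 2 =
      (a * Real.cos t / √(a ^ 2 * Real.cos t ^ 2 + b ^ 2 * Real.sin t ^ 2)) ^ 2 := by
    rw [div_pow, div_pow, Real.sq_sqrt hR.le]
    field_simp
    ring
  rw [angleMap, Real.cos_arcsin, hsq, Real.sqrt_sq (by positivity)]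

lemma angleMap_mem_Icc (hb : 0 < b) (ht : t ∈ Set.Icc 0 (Real.pi / 2)) :
    angleMap a b t ∈ Set.Icc 0 (Real.pi / 2) := by
  have := Real.sin_nonneg_of_nonneg_of_le_pi ht.1 (by linarith [ht.2, Real.pi_pos])
  exact ⟨Real.arcsin_nonneg.2 (by positivity), Real.arcsin_le_pi_div_two _⟩

lemma angleMap_angleMap (ha : 0 < a) (hb : 0 < b) (ht : t ∈ Set.Icc 0 (Real.pi / 2)) :
    angleMap b a (angleMap a b t) = t := by
  have hpi := Real.pi_pos
  have hc : 0 ≤ Real.cos t := Real.cos_nonneg_of_mem_Icc ⟨by linarith [ht.1], ht.2⟩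
  have hR := angleMap_radicand_pos ha hb t
  have hD := Real.sqrt_pos.2 hR
  have hsq : b ^ 2 * Real.cos (angleMap a b t) ^ 2 + a ^ 2 * Real.sin (angleMap a b t) ^ 2 =
      (a * b / √(a ^ 2 * Real.cos t ^ 2 + b ^ 2 * Real.sin t ^ 2)) ^ 2 := by
    rw [sin_angleMap ha hb, cos_angleMap ha hb hc]
    field_simp
    linear_combination Real.cos_sq_add_sin_sq t
  rw [angleMap, hsq, Real.sqrt_sq (by positivity), sin_angleMap ha hb]
  convert Real.arcsin_sin (x := t) (by linarith [ht.1]) ht.2 using 2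
  field_simp

lemma monotoneOn_angleMap (ha : 0 < a) (hb : 0 < b) :
    MonotoneOn (angleMap a b) (Set.Icc 0 (Real.pi / 2)) := by
  intro s hs t ht hst
  have hpi := Real.pi_pos
  have hs₀ : 0 ≤ Real.sin s := Real.sin_nonneg_of_nonneg_of_le_pi hs.1 (by linarith [hs.2])
  have ht₀ : 0 ≤ Real.cos t := Real.cos_nonneg_of_mem_Icc ⟨by linarith [ht.1], ht.2⟩
  have hsin : Real.sin s ≤ Real.sin t :=
    Real.sin_le_sin_of_le_of_le_pi_div_two (by linarith [hs.1]) ht.2 hst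
  have hcos : Real.cos t ≤ Real.cos s :=
    Real.cos_le_cos_of_nonneg_of_le_pi hs.1 (by linarith [ht.2]) hst
  have hRs := angleMap_radicand_pos ha hb s
  have hRt := angleMap_radicand_pos ha hb t
  refine Real.monotone_arcsin ?_
  rw [div_le_div_iff₀ (Real.sqrt_pos.2 hRs) (Real.sqrt_pos.2 hRt), mul_assoc, mul_assoc]
  refine mul_le_mul_of_nonneg_left ?_ hb.le
  have hmul : Real.sin s * Real.cos t ≤ Real.sin t * Real.cos s :=
    mul_le_mul hsin hcos ht₀ (hs₀.trans hsin)
  have hmul_sq := mul_le_mul_of_nonneg_left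
    (pow_le_pow_left₀ (mul_nonneg hs₀ ht₀) hmul 2) (sq_nonneg a)
  refine le_of_sq_le_sq ?_ (by have := hs₀.trans hsin; positivity)
  rw [mul_pow, mul_pow, Real.sq_sqrt hRs.le, Real.sq_sqrt hRt.le]
  nlinarith

/-- The convex primitive of `angleMap a b` lies above its tangent lines on `[0, π / 2]`. -/
lemma angleMap_mul_sub_le_integral (ha : 0 < a) (hb : 0 < b)
    (hs : s ∈ Set.Icc 0 (Real.pi / 2)) (ht : t ∈ Set.Icc 0 (Real.pi / 2)) :
    angleMap a b s * (t - s) ≤ ∫ x in s..t, angleMap a b x := by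
  have hint : ∀ u v, IntervalIntegrable (angleMap a b) volume u v :=
    (continuous_angleMap ha hb).intervalIntegrable
  rcases le_total s t with h | h
  · have := intervalIntegral.integral_mono_on h
      (intervalIntegrable_const (c := angleMap a b s)) (hint s t) fun x hx =>
        monotoneOn_angleMap ha hb hs ⟨hs.1.trans hx.1, hx.2.trans ht.2⟩ hx.1
    rw [intervalIntegral.integral_const, smul_eq_mul] at this
    linarith
  · have := intervalIntegral.integral_mono_on h (hint t s)
      (intervalIntegrable_const (c := angleMap a b s)) fun x hx =>
        monotoneOn_angleMap ha hb ⟨ht.1.trans hx.1, hx.2.trans hs.2⟩ hs hx.2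
    rw [intervalIntegral.integral_const, smul_eq_mul] at this
    rw [intervalIntegral.integral_symm]
    linarith

/-- The Kantorovich potential on the source side for the monotone map `angleMap a b`. -/
def sourcePotential (a b t : ℝ) : ℝ :=
  t ^ 2 / 2 - ∫ x in (0 : ℝ)..t, angleMap a b x

/-- The Kantorovich potential on the target side for the monotone map `angleMap a b`. -/
def targetPotential (a b s : ℝ) : ℝ :=
  s ^ 2 / 2 - (s * angleMap b a s - ∫ x in (0 : ℝ)..angleMap b a s, angleMap a b x)

lemma continuous_integral_angleMap (ha : 0 < a) (hb : 0 < b) :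
    Continuous fun t => ∫ x in (0 : ℝ)..t, angleMap a b x :=
  intervalIntegral.continuous_primitive (continuous_angleMap ha hb).intervalIntegrable 0

lemma continuous_sourcePotential (ha : 0 < a) (hb : 0 < b) :
    Continuous (sourcePotential a b) := by
  have := continuous_integral_angleMap ha hb
  unfold sourcePotential
  fun_prop

lemma continuous_targetPotential (ha : 0 < a) (hb : 0 < b) :
    Continuous (targetPotential a b) := by
  have h₁ := continuous_angleMap hb ha
  have h₂ := (continuous_integral_angleMap ha hb).comp h₁
  exact ((continuous_id.pow 2).div_const 2).sub ((continuous_id.mul h₁).sub h₂)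

lemma sourcePotential_add_targetPotential_le (ha : 0 < a) (hb : 0 < b)
    (ht : t ∈ Set.Icc 0 (Real.pi / 2)) (hs : s ∈ Set.Icc 0 (Real.pi / 2)) :
    sourcePotential a b t + targetPotential a b s ≤ (t - s) ^ 2 / 2 := by
  have hint : ∀ u v, IntervalIntegrable (angleMap a b) volume u v :=
    (continuous_angleMap ha hb).intervalIntegrable
  have h := angleMap_mul_sub_le_integral ha hb (angleMap_mem_Icc (a := b) ha hs) ht
  rw [angleMap_angleMap hb ha hs, ← intervalIntegral.integral_interval_sub_left
    (hint 0 t) (hint 0 (angleMap b a s))] at h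
  unfold sourcePotential targetPotential
  nlinarith

lemma sourcePotential_add_targetPotential_angleMap (ha : 0 < a) (hb : 0 < b)
    (ht : t ∈ Set.Icc 0 (Real.pi / 2)) :
    sourcePotential a b t + targetPotential a b (angleMap a b t) =
      (t - angleMap a b t) ^ 2 / 2 := by
  unfold sourcePotential targetPotential
  rw [angleMap_angleMap ha hb ht]
  ring

end AngleMap

section Sphere

variable {E : Type*} [NormedAddCommGroup E] [InnerProductSpace ℝ E]

lemma continuous_sphereCost :
    Continuous fun z : sphere (0 : E) 1 × sphere (0 : E) 1 => sphereCost z.1 z.2 := by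
  unfold sphereCost
  have := Real.continuous_arccos
  fun_prop

variable (U : Submodule ℝ E) [U.HasOrthogonalProjection]

/-- The angle between a point of the unit sphere and the subspace `U`. -/
def polarAngle (p : sphere (0 : E) 1) : ℝ :=
  Real.arcsin ‖Uᗮ.starProjection (p : E)‖

lemma continuous_polarAngle : Continuous (polarAngle U) := by
  unfold polarAngle
  have := Real.continuous_arcsin
  fun_prop

lemma polarAngle_mem_Icc (p : sphere (0 : E) 1) :
    polarAngle U p ∈ Set.Icc 0 (Real.pi / 2) :=
  ⟨Real.arcsin_nonneg.2 (norm_nonneg _), Real.arcsin_le_pi_div_two _⟩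

lemma norm_sq_starProjection_add (p : sphere (0 : E) 1) :
    ‖U.starProjection (p : E)‖ ^ 2 + ‖Uᗮ.starProjection (p : E)‖ ^ 2 = 1 := by
  rw [← U.norm_sq_eq_add_norm_sq_starProjection, mem_sphere_zero_iff_norm.mp p.2, one_pow]

lemma sin_polarAngle (p : sphere (0 : E) 1) :
    Real.sin (polarAngle U p) = ‖Uᗮ.starProjection (p : E)‖ := by
  have h := norm_sq_starProjection_add U p
  have h₀ := norm_nonneg (Uᗮ.starProjection (p : E))
  refine Real.sin_arcsin (by linarith) ?_
  nlinarith [sq_nonneg ‖U.starProjection (p : E)‖]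

lemma cos_polarAngle (p : sphere (0 : E) 1) :
    Real.cos (polarAngle U p) = ‖U.starProjection (p : E)‖ := by
  have h := norm_sq_starProjection_add U p
  rw [polarAngle, Real.cos_arcsin, ← eq_sub_of_add_eq h, Real.sqrt_sq (norm_nonneg _)]

lemma inner_eq_inner_starProjection_add (x y : E) :
    ⟪x, y⟫_ℝ = ⟪U.starProjection x, U.starProjection y⟫_ℝ +
      ⟪Uᗮ.starProjection x, Uᗮ.starProjection y⟫_ℝ := by
  have h₁ : ⟪U.starProjection x, Uᗮ.starProjection y⟫_ℝ = 0 :=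
    Submodule.inner_right_of_mem_orthogonal (U.starProjection_apply_mem x)
      (Uᗮ.starProjection_apply_mem y)
  have h₂ : ⟪Uᗮ.starProjection x, U.starProjection y⟫_ℝ = 0 :=
    Submodule.inner_left_of_mem_orthogonal (U.starProjection_apply_mem y)
      (Uᗮ.starProjection_apply_mem x)
  conv_lhs => rw [← U.starProjection_add_starProjection_orthogonal x,
    ← U.starProjection_add_starProjection_orthogonal y]
  rw [inner_add_left, inner_add_right, inner_add_right, h₁, h₂]
  ring

lemma arccos_cos_eq_abs {x : ℝ} (hx : |x| ≤ Real.pi) : Real.arccos (Real.cos x) = |x| := by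
  rw [← Real.cos_abs, Real.arccos_cos (abs_nonneg x) hx]

lemma abs_polarAngle_sub_le_pi (p q : sphere (0 : E) 1) :
    |polarAngle U p - polarAngle U q| ≤ Real.pi := by
  obtain ⟨hp₁, hp₂⟩ := polarAngle_mem_Icc U p
  obtain ⟨hq₁, hq₂⟩ := polarAngle_mem_Icc U q
  rw [abs_le]
  constructor <;> linarith [Real.pi_pos]

lemma sq_polarAngle_sub_le_sphereCost (p q : sphere (0 : E) 1) :
    (polarAngle U p - polarAngle U q) ^ 2 / 2 ≤ sphereCost p q := by
  have hle : ⟪(p : E), (q : E)⟫_ℝ ≤ Real.cos (polarAngle U p - polarAngle U q) := by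
    rw [Real.cos_sub, cos_polarAngle, cos_polarAngle, sin_polarAngle, sin_polarAngle,
      inner_eq_inner_starProjection_add U]
    exact add_le_add (real_inner_le_norm _ _) (real_inner_le_norm _ _)
  have harc := Real.antitone_arccos hle
  rw [arccos_cos_eq_abs (abs_polarAngle_sub_le_pi U p q)] at harc
  rw [sphereCost, ← sq_abs (polarAngle U p - polarAngle U q)]
  gcongr

lemma starProjection_apply_of_eq_smul_add {a b : ℝ} {P : E →ₗ[ℝ] E}
    (hP : ∀ x, P x = a • U.starProjection x + b • Uᗮ.starProjection x) (x : E) :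
    U.starProjection (P x) = a • U.starProjection x :=
  U.eq_starProjection_of_mem_orthogonal' (U.smul_mem a (U.starProjection_apply_mem x))
    (Uᗮ.smul_mem b (Uᗮ.starProjection_apply_mem x)) (hP x)

lemma starProjection_orthogonal_apply_of_eq_smul_add {a b : ℝ} {P : E →ₗ[ℝ] E}
    (hP : ∀ x, P x = a • U.starProjection x + b • Uᗮ.starProjection x) (x : E) :
    Uᗮ.starProjection (P x) = b • Uᗮ.starProjection x :=
  Uᗮ.eq_starProjection_of_mem_orthogonal' (Uᗮ.smul_mem b (Uᗮ.starProjection_apply_mem x))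
    (U.le_orthogonal_orthogonal (U.smul_mem a (U.starProjection_apply_mem x)))
    ((hP x).trans (add_comm _ _))

/-- The projective map induced by an operator acting as `a` on `U` and as `b` on `Uᗮ` changes
the angle to `U` by `angleMap a b`. -/
lemma polarAngle_of_coe_eq {a b : ℝ} (ha : 0 ≤ a) (hb : 0 ≤ b) {P : E →ₗ[ℝ] E}
    (hP : ∀ x, P x = a • U.starProjection x + b • Uᗮ.starProjection x)
    (p q : sphere (0 : E) 1) (hq : (q : E) = ‖P (p : E)‖⁻¹ • P (p : E)) :
    polarAngle U q = angleMap a b (polarAngle U p) := by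
  have hnorm : ‖P (p : E)‖ = √(a ^ 2 * Real.cos (polarAngle U p) ^ 2 +
      b ^ 2 * Real.sin (polarAngle U p) ^ 2) := by
    rw [cos_polarAngle, sin_polarAngle, ← mul_pow, ← mul_pow, ← Real.sqrt_sq (norm_nonneg (P p)),
      U.norm_sq_eq_add_norm_sq_starProjection, starProjection_apply_of_eq_smul_add U hP,
      starProjection_orthogonal_apply_of_eq_smul_add U hP, norm_smul, norm_smul,
      Real.norm_of_nonneg ha, Real.norm_of_nonneg hb]
  rw [polarAngle, angleMap, ← hnorm, hq, map_smul,
    starProjection_orthogonal_apply_of_eq_smul_add U hP, norm_smul, norm_smul, norm_inv, norm_norm,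
    Real.norm_of_nonneg hb, sin_polarAngle, div_eq_inv_mul]

lemma sphereCost_of_coe_eq {a b : ℝ} (ha : 0 ≤ a) (hb : 0 ≤ b) {P : E →ₗ[ℝ] E}
    (hP : ∀ x, P x = a • U.starProjection x + b • Uᗮ.starProjection x)
    (p q : sphere (0 : E) 1) (hq : (q : E) = ‖P (p : E)‖⁻¹ • P (p : E)) :
    sphereCost p q = (polarAngle U p - polarAngle U q) ^ 2 / 2 := by
  have hinner : ⟪(p : E), (q : E)⟫_ℝ = Real.cos (polarAngle U p - polarAngle U q) := by
    rw [Real.cos_sub, cos_polarAngle, cos_polarAngle, sin_polarAngle, sin_polarAngle,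
      inner_eq_inner_starProjection_add U, hq, map_smul, map_smul,
      starProjection_apply_of_eq_smul_add U hP,
      starProjection_orthogonal_apply_of_eq_smul_add U hP]
    simp only [inner_smul_right, norm_smul, real_inner_self_eq_norm_sq, norm_inv, norm_norm,
      Real.norm_of_nonneg ha, Real.norm_of_nonneg hb]
    ring
  rw [sphereCost, hinner, arccos_cos_eq_abs (abs_polarAngle_sub_le_pi U p q), sq_abs]

end Sphere

section Spectral

variable {E : Type*} [NormedAddCommGroup E] [InnerProductSpace ℝ E]

/-- The two candidate eigenvalues of a positive definite operator may be taken positive. -/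
lemma exists_pos_of_forall_hasEigenvalue (P : E →ₗ[ℝ] E)
    (hPpos : ∀ x, x ≠ 0 → 0 < ⟪P x, x⟫_ℝ)
    (hPeig : ∃ a b : ℝ, ∀ μ : ℝ, Module.End.HasEigenvalue P μ → μ = a ∨ μ = b) :
    ∃ a b : ℝ, 0 < a ∧ 0 < b ∧
      ∀ μ : ℝ, Module.End.HasEigenvalue P μ → μ = a ∨ μ = b := by
  obtain ⟨a, b, hab⟩ := hPeig
  have hpos : ∀ μ : ℝ, Module.End.HasEigenvalue P μ → 0 < μ := by
    intro μ hμ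
    obtain ⟨v, hv⟩ := hμ.exists_hasEigenvector
    have h := hPpos v hv.2
    rw [hv.apply_eq_smul, real_inner_smul_left, real_inner_self_eq_norm_sq] at h
    exact pos_of_mul_pos_left h (sq_nonneg _)
  refine ⟨if 0 < a then a else 1, if 0 < b then b else 1, by split_ifs <;> positivity,
    by split_ifs <;> positivity, fun μ hμ => ?_⟩
  have h := hpos μ hμ
  rcases hab μ hμ with rfl | rfl
  · exact Or.inl (if_pos h).symm
  · exact Or.inr (if_pos h).symm

/-- A self-adjoint operator whose only possible eigenvalues are `a` and `b` acts as `a` on the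
`a`-eigenspace and as `b` on its orthogonal complement. -/
lemma apply_eq_smul_starProjection_add [FiniteDimensional ℝ E] {P : E →ₗ[ℝ] E}
    (hP : P.IsSymmetric) {a b : ℝ}
    (hab : ∀ μ : ℝ, Module.End.HasEigenvalue P μ → μ = a ∨ μ = b) (x : E) :
    P x = a • (Module.End.eigenspace P a).starProjection x +
      b • (Module.End.eigenspace P a)ᗮ.starProjection x := by
  set U := Module.End.eigenspace P a
  have hU : P (U.starProjection x) = a • U.starProjection x :=
    Module.End.mem_eigenspace_iff.mp (U.starProjection_apply_mem x)
  have hUorth : P (Uᗮ.starProjection x) = b • Uᗮ.starProjection x := by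
    refine InnerProductSpace.ext_inner_left_basis (𝕜 := ℝ) (hP.eigenvectorBasis rfl).toBasis fun i => ?_
    rw [OrthonormalBasis.coe_toBasis, inner_smul_right, ← hP, hP.apply_eigenvectorBasis,
      inner_smul_left]
    rcases hab _ (hP.hasEigenvalue_eigenvalues rfl i) with h | h
    · have hmem : hP.eigenvectorBasis rfl i ∈ U :=
        Module.End.mem_eigenspace_iff.mpr ((hP.apply_eigenvectorBasis rfl i).trans (by rw [h]))
      rw [Submodule.inner_right_of_mem_orthogonal hmem (Uᗮ.starProjection_apply_mem x),
        mul_zero, mul_zero]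
    · rw [h]
      rfl
  conv_lhs => rw [← U.starProjection_add_starProjection_orthogonal x]
  rw [map_add, hU, hUorth]

end Spectral

lemma integrable_continuous_comp {X Z : Type*} [MeasurableSpace X] [TopologicalSpace Z]
    [CompactSpace Z] [MeasurableSpace Z] [BorelSpace Z] {μ : Measure X} [IsFiniteMeasure μ]
    {g : Z → ℝ} {f : X → Z} (hg : Continuous g) (hf : Measurable f) :
    Integrable (fun x => g (f x)) μ := by
  obtain ⟨C, hC⟩ := isCompact_univ.exists_bound_of_continuousOn hg.continuousOn
  exact Integrable.of_bound (hg.measurable.comp hf).aestronglyMeasurable C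
    (Filter.Eventually.of_forall fun x => hC _ (Set.mem_univ _))

/-- The easy half of Kantorovich duality: a map along which a pair of dual potentials is tight
is optimal among all maps with the same pushforward. -/
theorem integral_cost_le_of_potentials {X Y : Type*}
    [TopologicalSpace X] [CompactSpace X] [SecondCountableTopology X]
    [MeasurableSpace X] [BorelSpace X]
    [TopologicalSpace Y] [CompactSpace Y] [SecondCountableTopology Y]
    [MeasurableSpace Y] [BorelSpace Y]
    {μ : Measure X} [IsFiniteMeasure μ] {c : X → Y → ℝ} {φ : X → ℝ} {ψ : Y → ℝ}
    (hc : Continuous fun z : X × Y => c z.1 z.2) (hφ : Continuous φ) (hψ : Continuous ψ)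
    {T F : X → Y} (hT : Measurable T) (hF : Measurable F) (hFT : μ.map F = μ.map T)
    (hle : ∀ x y, φ x + ψ y ≤ c x y) (heq : ∀ x, c x (T x) = φ x + ψ (T x)) :
    ∫ x, c x (T x) ∂μ ≤ ∫ x, c x (F x) ∂μ := by
  have hφint : Integrable φ μ := integrable_continuous_comp hφ measurable_id
  have hψT := integrable_continuous_comp (μ := μ) hψ hT
  have hψF := integrable_continuous_comp (μ := μ) hψ hF
  have hmap : ∫ x, ψ (F x) ∂μ = ∫ x, ψ (T x) ∂μ := by
    rw [← integral_map hF.aemeasurable hψ.measurable.aestronglyMeasurable, hFT,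
      integral_map hT.aemeasurable hψ.measurable.aestronglyMeasurable]
  calc ∫ x, c x (T x) ∂μ = ∫ x, (φ x + ψ (F x)) ∂μ := by
        simp_rw [heq]
        rw [integral_add hφint hψT, integral_add hφint hψF, hmap]
    _ ≤ ∫ x, c x (F x) ∂μ :=
        integral_mono (hφint.add hψF) (integrable_continuous_comp hc (measurable_id.prodMk hF))
          fun x => hle x (F x)

theorem projective_map_optimal_of_two_eigenvalues (n : ℕ) (hn : 1 ≤ n)
    (P : EuclideanSpace ℝ (Fin (n + 1)) →ₗ[ℝ] EuclideanSpace ℝ (Fin (n + 1)))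
    (hPsym : ∀ x y, ⟪P x, y⟫_ℝ = ⟪x, P y⟫_ℝ)
    (hPpos : ∀ x, x ≠ 0 → 0 < ⟪P x, x⟫_ℝ)
    (hPeig : ∃ a b : ℝ, ∀ μ : ℝ, Module.End.HasEigenvalue P μ → μ = a ∨ μ = b)
    (T : sphere (0 : EuclideanSpace ℝ (Fin (n + 1))) 1 →
      sphere (0 : EuclideanSpace ℝ (Fin (n + 1))) 1)
    (hT : ∀ p : sphere (0 : EuclideanSpace ℝ (Fin (n + 1))) 1,
      (T p : EuclideanSpace ℝ (Fin (n + 1)))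
        = ‖P (p : EuclideanSpace ℝ (Fin (n + 1)))‖⁻¹ • P (p : EuclideanSpace ℝ (Fin (n + 1))))
    (vol : Measure (sphere (0 : EuclideanSpace ℝ (Fin (n + 1))) 1))
    (hvol₀ : vol ≠ 0) (hvolfin : IsFiniteMeasure vol)
    (hvolinv : IsRotationInvariant vol) :
    ∀ F : sphere (0 : EuclideanSpace ℝ (Fin (n + 1))) 1 →
        sphere (0 : EuclideanSpace ℝ (Fin (n + 1))) 1,
      Measurable F → Measure.map F vol = Measure.map T vol →
      ∫ p, sphereCost p (T p) ∂vol ≤ ∫ p, sphereCost p (F p) ∂vol := by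
  obtain ⟨a, b, ha, hb, hab⟩ := exists_pos_of_forall_hasEigenvalue P hPpos hPeig
  set U := Module.End.eigenspace P a
  have hPU : ∀ x, P x = a • U.starProjection x + b • Uᗮ.starProjection x :=
    apply_eq_smul_starProjection_add hPsym hab
  set t := polarAngle U with ht
  have hTcont : Continuous T := by
    refine continuous_induced_rng.2 ?_
    simp only [Function.comp_def, hT]
    have hP : Continuous fun p : sphere (0 : EuclideanSpace ℝ (Fin (n + 1))) 1 =>
        P (p : EuclideanSpace ℝ (Fin (n + 1))) :=
      P.continuous_of_finiteDimensional.comp continuous_subtype_val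
    refine Continuous.smul (Continuous.inv₀ hP.norm fun p h => ?_) hP
    have hp : (p : EuclideanSpace ℝ (Fin (n + 1))) ≠ 0 := ne_zero_of_mem_unit_sphere p
    have := hPpos _ hp
    rw [norm_eq_zero.mp h, inner_zero_left] at this
    exact lt_irrefl _ this
  have htT : ∀ p, t (T p) = angleMap a b (t p) := fun p =>
    polarAngle_of_coe_eq U ha.le hb.le hPU p (T p) (hT p)
  have ht_mem : ∀ p, t p ∈ Set.Icc 0 (Real.pi / 2) := polarAngle_mem_Icc U
  have ht_cont : Continuous t := continuous_polarAngle U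
  intro F hF hFT
  refine integral_cost_le_of_potentials (φ := fun p => sourcePotential a b (t p))
    (ψ := fun q => targetPotential a b (t q)) continuous_sphereCost
    ((continuous_sourcePotential ha hb).comp ht_cont)
    ((continuous_targetPotential ha hb).comp ht_cont) hTcont.measurable hF hFT ?_ ?_
  · intro p q
    exact (sourcePotential_add_targetPotential_le ha hb (ht_mem p) (ht_mem q)).trans
      (sq_polarAngle_sub_le_sphereCost U p q)
  · intro p
    rw [sphereCost_of_coe_eq U ha.le hb.le hPU p (T p) (hT p), ← ht, htT,
      sourcePotential_add_targetPotential_angleMap ha hb (ht_mem p)]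

end
end

section
/- Let n ≥ 2 and let P be a positive definite self-adjoint linear operator on ℝ^{n+1} having at least three distinct eigenvalues. Then the projective map T : Sⁿ → Sⁿ, T(q) = P(q)/‖P(q)‖, is NOT the optimal transportation map between vol and T_#(vol) for the cost c(p,q) = d(p,q)²/2; that is, it is not the case that for every Borel map F : Sⁿ → Sⁿ with F_#(vol) = T_#(vol) one has ∫ c(p,T(p)) dvol(p) ≤ ∫ c(p,F(p)) dvol(p). -/
/- Polar factorization of projective maps of the sphere (Godoy–Salvai, Theorem 2,
necessity): if `P` is a positive definite self-adjoint operator of `ℝ^{n+1}` with at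
least three distinct eigenvalues, then the projective map `T(q) = P(q)/‖P(q)‖` of `Sⁿ`
is NOT the optimal transport map (for the cost `d²/2`) between `vol` and `T₃(vol)`. -/

open MeasureTheory Metric
open scoped InnerProductSpace

noncomputable section

section Rotations

variable {E : Type*} [NormedAddCommGroup E] [InnerProductSpace ℝ E]

lemma continuous_rotSphere (R : E ≃ₗᵢ[ℝ] E) : Continuous (rotSphere R) :=
  Continuous.subtype_mk (R.continuous.comp continuous_subtype_val) _

lemma injective_rotSphere (R : E ≃ₗᵢ[ℝ] E) : Function.Injective (rotSphere R) := by
  intro p q h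
  exact Subtype.ext (R.injective (congrArg Subtype.val h))

@[simp] lemma coe_rotSphere (R : E ≃ₗᵢ[ℝ] E) (p : sphere (0 : E) 1) :
    (rotSphere R p : E) = R p := rfl

@[simp] lemma rotSphere_symm_rotSphere (R : E ≃ₗᵢ[ℝ] E) (p : sphere (0 : E) 1) :
    rotSphere R.symm (rotSphere R p) = p := Subtype.ext (by simp)

@[simp] lemma rotSphere_rotSphere_symm (R : E ≃ₗᵢ[ℝ] E) (p : sphere (0 : E) 1) :
    rotSphere R (rotSphere R.symm p) = p := Subtype.ext (by simp)

lemma exists_rotSphere_eq (p q : sphere (0 : E) 1) : ∃ R : E ≃ₗᵢ[ℝ] E, rotSphere R p = q := by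
  refine ⟨(ℝ ∙ ((p : E) - q))ᗮ.reflection, Subtype.ext ?_⟩
  have hp := mem_sphere_zero_iff_norm.mp p.2
  have hq := mem_sphere_zero_iff_norm.mp q.2
  exact Submodule.reflection_sub (by rw [hp, hq])

/-- The rotation by the angle `θ` in the plane spanned by an orthonormal pair `v`, `w`. -/
lemma exists_planeRotation [FiniteDimensional ℝ E] {v w : E} (hv : ‖v‖ = 1) (hw : ‖w‖ = 1)
    (hvw : ⟪v, w⟫_ℝ = 0) :
    ∃ R : ℝ → E ≃ₗᵢ[ℝ] E, ∀ θ p, R θ p = p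
      + ((Real.cos θ - 1) * ⟪v, p⟫_ℝ - Real.sin θ * ⟪w, p⟫_ℝ) • v
      + (Real.sin θ * ⟪v, p⟫_ℝ + (Real.cos θ - 1) * ⟪w, p⟫_ℝ) • w := by
  have hvv : ⟪v, v⟫_ℝ = 1 := by rw [real_inner_self_eq_norm_sq, hv]; norm_num
  have hww : ⟪w, w⟫_ℝ = 1 := by rw [real_inner_self_eq_norm_sq, hw]; norm_num
  have hwv : ⟪w, v⟫_ℝ = 0 := by rw [real_inner_comm]; exact hvw
  let L : ℝ → E →ₗ[ℝ] E := fun θ =>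
    { toFun := fun p => p
        + ((Real.cos θ - 1) * ⟪v, p⟫_ℝ - Real.sin θ * ⟪w, p⟫_ℝ) • v
        + (Real.sin θ * ⟪v, p⟫_ℝ + (Real.cos θ - 1) * ⟪w, p⟫_ℝ) • w
      map_add' := fun x y => by
        simp only [inner_add_right]
        module
      map_smul' := fun c x => by
        simp only [inner_smul_right, RingHom.id_apply]
        module }
  have hL : ∀ θ p, ‖L θ p‖ = ‖p‖ := by
    intro θ p
    have h : ⟪L θ p, L θ p⟫_ℝ = ⟪p, p⟫_ℝ := by
      simp only [L, LinearMap.coe_mk, AddHom.coe_mk, inner_add_left, inner_add_right,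
        inner_smul_left, inner_smul_right, hvv, hww, hvw, hwv, real_inner_comm v p,
        real_inner_comm w p, conj_trivial]
      linear_combination (⟪v, p⟫_ℝ ^ 2 + ⟪w, p⟫_ℝ ^ 2) * Real.sin_sq_add_cos_sq θ
    rw [real_inner_self_eq_norm_sq, real_inner_self_eq_norm_sq] at h
    exact (sq_eq_sq₀ (norm_nonneg _) (norm_nonneg _)).mp h
  exact ⟨fun θ => LinearIsometry.toLinearIsometryEquiv ⟨L θ, hL θ⟩ rfl, fun θ p => rfl⟩

variable [MeasurableSpace E] [BorelSpace E]

lemma IsRotationInvariant.measurePreserving {vol : Measure (sphere (0 : E) 1)}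
    (h : IsRotationInvariant vol) (R : E ≃ₗᵢ[ℝ] E) : MeasurePreserving (rotSphere R) vol vol :=
  ⟨(continuous_rotSphere R).measurable, h R⟩

variable [FiniteDimensional ℝ E]

lemma measurableEmbedding_rotSphere (R : E ≃ₗᵢ[ℝ] E) : MeasurableEmbedding (rotSphere R) :=
  (continuous_rotSphere R).measurableEmbedding (injective_rotSphere R)

lemma IsRotationInvariant.measure_pos_of_isOpen {vol : Measure (sphere (0 : E) 1)}
    (h : IsRotationInvariant vol) (h₀ : vol ≠ 0) {A : Set (sphere (0 : E) 1)} (hA : IsOpen A)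
    (hne : A.Nonempty) : 0 < vol A := by
  obtain ⟨p, hp⟩ := hne
  rw [pos_iff_ne_zero]
  intro h0
  apply h₀
  rw [← Measure.measure_univ_eq_zero]
  refine measure_null_of_locally_null _ fun q _ => ?_
  obtain ⟨R, hR⟩ := exists_rotSphere_eq q p
  refine ⟨rotSphere R ⁻¹' A, mem_nhdsWithin_of_mem_nhds
    ((hA.preimage (continuous_rotSphere R)).mem_nhds (by simpa [hR] using hp)), ?_⟩
  rw [(h.measurePreserving R).measure_preimage hA.measurableSet.nullMeasurableSet, h0]

lemma IsRotationInvariant.setIntegral_comp {vol : Measure (sphere (0 : E) 1)}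
    (h : IsRotationInvariant vol) (R : E ≃ₗᵢ[ℝ] E) {A : Set (sphere (0 : E) 1)}
    (hA : rotSphere R ⁻¹' A = A) (g : sphere (0 : E) 1 → ℝ) :
    ∫ p in A, g (rotSphere R p) ∂vol = ∫ p in A, g p ∂vol := by
  conv_lhs => rw [← hA]
  exact (h.measurePreserving R).setIntegral_preimage_emb (measurableEmbedding_rotSphere R) g A

lemma IsRotationInvariant.integrableOn_comp {vol : Measure (sphere (0 : E) 1)}
    (h : IsRotationInvariant vol) (R : E ≃ₗᵢ[ℝ] E) {A : Set (sphere (0 : E) 1)}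
    (hA : rotSphere R ⁻¹' A = A) {g : sphere (0 : E) 1 → ℝ} (hg : IntegrableOn g A vol) :
    IntegrableOn (fun p => g (rotSphere R p)) A vol := by
  rw [← hA]
  exact ((h.measurePreserving R).integrableOn_comp_preimage
    (measurableEmbedding_rotSphere R)).mpr hg

end Rotations

section Cost

variable {E : Type*} [NormedAddCommGroup E] [InnerProductSpace ℝ E]

lemma Continuous.sphereCost {X : Type*} [TopologicalSpace X] {f g : X → sphere (0 : E) 1}
    (hf : Continuous f) (hg : Continuous g) : Continuous fun x => sphereCost (f x) (g x) := by
  unfold _root_.sphereCost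
  have h1 : Continuous fun x => (f x : E) := continuous_subtype_val.comp hf
  have h2 : Continuous fun x => (g x : E) := continuous_subtype_val.comp hg
  exact ((Real.continuous_arccos.comp (h1.inner h2)).pow 2).div_const 2

variable [MeasurableSpace E] [BorelSpace E] [FiniteDimensional ℝ E]

/-- If `T` is an optimal map from a rotation invariant measure, then precomposing `T` with an
isometry on an invariant set does not decrease the cost. -/
lemma IsRotationInvariant.setIntegral_sphereCost_le {vol : Measure (sphere (0 : E) 1)}
    [IsFiniteMeasure vol] (h : IsRotationInvariant vol) {T : sphere (0 : E) 1 → sphere (0 : E) 1}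
    (hT : Continuous T)
    (hopt : ∀ F : sphere (0 : E) 1 → sphere (0 : E) 1, Measurable F →
      Measure.map F vol = Measure.map T vol →
      ∫ p, sphereCost p (T p) ∂vol ≤ ∫ p, sphereCost p (F p) ∂vol)
    (R : E ≃ₗᵢ[ℝ] E) {A : Set (sphere (0 : E) 1)} (hA : MeasurableSet A)
    (hRA : rotSphere R ⁻¹' A = A) :
    ∫ p in A, sphereCost p (T p) ∂vol ≤ ∫ p in A, sphereCost (rotSphere R p) (T p) ∂vol := by
  classical
  have hRA' : rotSphere R.symm ⁻¹' A = A := by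
    ext p
    conv_lhs => rw [← hRA]
    simp
  let G : sphere (0 : E) 1 → sphere (0 : E) 1 := A.piecewise (rotSphere R.symm) id
  have hGm : Measurable G :=
    Measurable.piecewise hA (continuous_rotSphere _).measurable measurable_id
  have hG : Measure.map G vol = vol := by
    ext B hB
    have h1 := (h.measurePreserving R.symm).measure_preimage (hA.inter hB).nullMeasurableSet
    rw [Set.preimage_inter, hRA'] at h1
    rw [Measure.map_apply hGm hB, ← measure_inter_add_sdiff (G ⁻¹' B) hA,
      ← measure_inter_add_sdiff B hA, Set.inter_comm B A, ← h1]
    congr 2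
    · ext p
      by_cases hp : p ∈ A <;> simp [G, hp]
    · ext p
      by_cases hp : p ∈ A <;> simp [G, hp]
  have hle := hopt (T ∘ G) (hT.measurable.comp hGm) (by
    rw [← Measure.map_map hT.measurable hGm, hG])
  have hint : ∀ f : sphere (0 : E) 1 → sphere (0 : E) 1, Continuous f →
      Integrable (fun p => sphereCost p (f p)) vol := fun f hf =>
    (continuous_id.sphereCost hf).integrable_of_hasCompactSupport
      (HasCompactSupport.of_compactSpace _)
  have hgm : (fun p => sphereCost p ((T ∘ G) p))
      = A.piecewise (fun p => sphereCost p (T (rotSphere R.symm p)))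
        (fun p => sphereCost p (T p)) := by
    ext p
    by_cases hp : p ∈ A <;> simp [G, hp]
  have hint' : Integrable (fun p => sphereCost p (T (rotSphere R.symm p))) vol :=
    hint _ (hT.comp (continuous_rotSphere _))
  rw [hgm, integral_piecewise hA hint'.integrableOn
    (hint _ hT).integrableOn, ← integral_add_compl hA (hint _ hT)] at hle
  rw [← h.setIntegral_comp R hRA (fun p => sphereCost p (T (rotSphere R.symm p)))] at hle
  simpa using hle

end Cost

section ArccosQuotient

/-- The function `φ / sin φ` of `s = cos φ`; it is minus the derivative of `arccos s ^ 2 / 2`. -/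
def arccosQuot (s : ℝ) : ℝ := Real.arccos s / √(1 - s ^ 2)

lemma measurable_arccosQuot : Measurable arccosQuot :=
  Real.continuous_arccos.measurable.div
    (Real.continuous_sqrt.comp (continuous_const.sub (continuous_pow 2))).measurable

lemma one_sub_sq_pos {s : ℝ} (h : |s| < 1) : 0 < 1 - s ^ 2 := by
  have := (sq_lt_one_iff_abs_lt_one s).mpr h
  linarith

lemma continuousAt_arccosQuot {s : ℝ} (h : |s| < 1) : ContinuousAt arccosQuot s := by
  refine ContinuousAt.div Real.continuous_arccos.continuousAt
    (Real.continuous_sqrt.comp (continuous_const.sub (continuous_pow 2))).continuousAt ?_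
  exact (Real.sqrt_pos.mpr (one_sub_sq_pos h)).ne'

lemma abs_arccosQuot_le {s m : ℝ} (h : |s| ≤ m) (hm : m < 1) :
    |arccosQuot s| ≤ Real.pi / √(1 - m ^ 2) := by
  have hm0 : 0 ≤ m := (abs_nonneg s).trans h
  have h1 : 0 < 1 - m ^ 2 := one_sub_sq_pos (by rwa [abs_of_nonneg hm0])
  have h2 : s ^ 2 ≤ m ^ 2 := sq_le_sq' (abs_le.mp h).1 (abs_le.mp h).2
  unfold arccosQuot
  rw [abs_of_nonneg (div_nonneg (Real.arccos_nonneg s) (Real.sqrt_nonneg _))]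
  exact div_le_div₀ Real.pi_nonneg (Real.arccos_le_pi s) (Real.sqrt_pos.mpr h1)
    (Real.sqrt_le_sqrt (by linarith))

lemma hasDerivAt_arccos_sq_div_two {s : ℝ} (h : |s| < 1) :
    HasDerivAt (fun x => Real.arccos x ^ 2 / 2) (-arccosQuot s) s := by
  obtain ⟨h1, h2⟩ := abs_lt.mp h
  have := ((Real.hasDerivAt_arccos h1.ne' h2.ne).pow 2).div_const 2
  refine this.congr_deriv ?_
  unfold arccosQuot
  field_simp
  norm_num

/-- The function `φ * cot φ` is strictly decreasing on `(0, π)`. -/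
lemma strictAntiOn_mul_cos_div_sin :
    StrictAntiOn (fun φ => φ * Real.cos φ / Real.sin φ) (Set.Ioo 0 Real.pi) := by
  have hd : ∀ φ ∈ Set.Ioo 0 Real.pi, HasDerivAt (fun φ => φ * Real.cos φ / Real.sin φ)
      ((Real.sin φ * Real.cos φ - φ) / Real.sin φ ^ 2) φ := by
    intro φ hφ
    have hs := (Real.sin_pos_of_mem_Ioo hφ).ne'
    refine (((hasDerivAt_id φ).mul (Real.hasDerivAt_cos φ)).div
      (Real.hasDerivAt_sin φ) hs).congr_deriv ?_
    simp only [id, Pi.mul_apply]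
    congr 1
    linear_combination (-φ) * Real.sin_sq_add_cos_sq φ
  refine strictAntiOn_of_deriv_neg (convex_Ioo _ _)
    (fun φ hφ => (hd φ hφ).continuousAt.continuousWithinAt) fun φ hφ => ?_
  rw [interior_Ioo] at hφ
  rw [(hd φ hφ).deriv]
  have hs := Real.sin_pos_of_mem_Ioo hφ
  have h2 := Real.sin_lt (x := 2 * φ) (by linarith [hφ.1])
  rw [Real.sin_two_mul] at h2
  exact div_neg_of_neg_of_pos (by linarith) (by positivity)

lemma mul_arccosQuot_lt {s t : ℝ} (hs : -1 < s) (hst : s < t) (ht : t < 1) :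
    s * arccosQuot s < t * arccosQuot t := by
  have hmem : ∀ x : ℝ, -1 < x → x < 1 → Real.arccos x ∈ Set.Ioo 0 Real.pi := fun x h1 h2 =>
    ⟨Real.arccos_pos.mpr h2, by
      have := Real.strictAntiOn_arccos (Set.left_mem_Icc.mpr (by norm_num)) ⟨h1.le, h2.le⟩ h1
      rwa [Real.arccos_neg_one] at this⟩
  have hval : ∀ x : ℝ, -1 < x → x < 1 → x * arccosQuot x
      = Real.arccos x * Real.cos (Real.arccos x) / Real.sin (Real.arccos x) := fun x h1 h2 => by
    rw [Real.cos_arccos h1.le h2.le, Real.sin_arccos, arccosQuot]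
    ring
  rw [hval s hs (hst.trans ht), hval t (hs.trans hst) ht]
  exact strictAntiOn_mul_cos_div_sin (hmem t (hs.trans hst) ht) (hmem s hs (hst.trans ht))
    (Real.strictAntiOn_arccos ⟨hs.le, (hst.trans ht).le⟩ ⟨(hs.trans hst).le, ht.le⟩ hst)

/-- At a fixed value `q`, the coefficient `arccosQuot (q / ρ) / ρ` is strictly decreasing
in `ρ`. -/
lemma arccosQuot_div_div_lt {q ρ₁ ρ₂ : ℝ} (hq : 0 < q) (h₂ : q < ρ₂) (h : ρ₂ < ρ₁) :
    arccosQuot (q / ρ₁) / ρ₁ < arccosQuot (q / ρ₂) / ρ₂ := by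
  have hρ₂ : 0 < ρ₂ := hq.trans h₂
  have hρ₁ : 0 < ρ₁ := hρ₂.trans h
  have h0 : 0 < q / ρ₁ := by positivity
  have := mul_arccosQuot_lt (s := q / ρ₁) (t := q / ρ₂) (by linarith)
    (div_lt_div_of_pos_left hq hρ₂ h) ((div_lt_one hρ₂).mpr h₂)
  have e : ∀ ρ, q / ρ * arccosQuot (q / ρ) = q * (arccosQuot (q / ρ) / ρ) := fun ρ => by ring
  rw [e, e] at this
  exact lt_of_mul_lt_mul_left this hq.le

lemma mul_arccosQuot_sub_nonpos {q ρ₁ ρ₂ k : ℝ} (hq : 0 < q) (h₁ : q < ρ₁) (h₂ : q < ρ₂)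
    (hk : 0 ≤ k * (ρ₁ ^ 2 - ρ₂ ^ 2)) :
    k * (arccosQuot (q / ρ₁) / ρ₁ - arccosQuot (q / ρ₂) / ρ₂) ≤ 0 := by
  have hρ₂ : 0 < ρ₂ := hq.trans h₂
  have hρ₁ : 0 < ρ₁ := hq.trans h₁
  rcases lt_trichotomy ρ₁ ρ₂ with h | h | h
  · have h3 := arccosQuot_div_div_lt hq h₁ h
    have : k ≤ 0 := by
      by_contra! hk'
      nlinarith [mul_pos hk' (mul_pos (sub_pos.mpr h) (add_pos hρ₁ hρ₂))]
    exact mul_nonpos_of_nonpos_of_nonneg this (by linarith)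
  · simp [h]
  · have h3 := arccosQuot_div_div_lt hq h₂ h
    have : 0 ≤ k := by
      by_contra! hk'
      nlinarith [mul_pos (neg_pos.mpr hk') (mul_pos (sub_pos.mpr h) (add_pos hρ₁ hρ₂))]
    exact mul_nonpos_of_nonneg_of_nonpos this (by linarith)

lemma mul_arccosQuot_sub_neg {q ρ₁ ρ₂ k : ℝ} (hq : 0 < q) (h₁ : q < ρ₁) (h₂ : q < ρ₂)
    (hk : 0 < k * (ρ₁ ^ 2 - ρ₂ ^ 2)) :
    k * (arccosQuot (q / ρ₁) / ρ₁ - arccosQuot (q / ρ₂) / ρ₂) < 0 := by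
  refine lt_of_le_of_ne (mul_arccosQuot_sub_nonpos hq h₁ h₂ hk.le) fun h => ?_
  rcases lt_trichotomy ρ₁ ρ₂ with h' | h' | h'
  · rcases mul_eq_zero.mp h with h | h
    · simp [h] at hk
    · linarith [arccosQuot_div_div_lt hq h₁ h']
  · simp [h'] at hk
  · rcases mul_eq_zero.mp h with h | h
    · simp [h] at hk
    · linarith [arccosQuot_div_div_lt hq h₂ h']

end ArccosQuotient

section TwistedPlane

variable {E : Type*} [NormedAddCommGroup E] [InnerProductSpace ℝ E]

/-- An orthonormal pair diagonalizing the quadratic form of `P` on the plane it spans, but not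
the quadratic form of `P²`. -/
structure IsTwistedPair (P : E →ₗ[ℝ] E) (v w : E) : Prop where
  norm_left : ‖v‖ = 1
  norm_right : ‖w‖ = 1
  inner_eq_zero : ⟪v, w⟫_ℝ = 0
  inner_map_eq_zero : ⟪v, P w⟫_ℝ = 0
  twist_pos : 0 < ⟪P v, P w⟫_ℝ * (⟪w, P w⟫_ℝ - ⟪v, P v⟫_ℝ)

lemma exists_isTwistedPair_of_ne {P : E →ₗ[ℝ] E} (hP : P.IsSymmetric) {V W : E}
    (h₀ : ⟪V, W⟫_ℝ = 0) (h₁ : ⟪V, P W⟫_ℝ = 0) (h₂ : ⟪P V, P W⟫_ℝ ≠ 0)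
    (h₃ : ⟪V, P V⟫_ℝ * ⟪W, W⟫_ℝ ≠ ⟪W, P W⟫_ℝ * ⟪V, V⟫_ℝ) : ∃ v w, IsTwistedPair P v w := by
  have hV : ‖V‖ ≠ 0 := fun h => h₂ (by simp [norm_eq_zero.mp h])
  have hW : ‖W‖ ≠ 0 := fun h => h₂ (by simp [norm_eq_zero.mp h])
  set v := ‖V‖⁻¹ • V with hv
  set w := ‖W‖⁻¹ • W with hw
  have n1 : ‖v‖ = 1 := by rw [hv, norm_smul, norm_inv, norm_norm, inv_mul_cancel₀ hV]
  have n2 : ‖w‖ = 1 := by rw [hw, norm_smul, norm_inv, norm_norm, inv_mul_cancel₀ hW]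
  have h0 : ⟪v, w⟫_ℝ = 0 := by simp [hv, hw, inner_smul_left, inner_smul_right, h₀]
  have h1 : ⟪v, P w⟫_ℝ = 0 := by simp [hv, hw, inner_smul_left, inner_smul_right, h₁]
  have h2 : ⟪P v, P w⟫_ℝ ≠ 0 := by simp [hv, hw, inner_smul_left, inner_smul_right, h₂, hV, hW]
  have h3 : ⟪w, P w⟫_ℝ - ⟪v, P v⟫_ℝ ≠ 0 := by
    intro h
    apply h₃
    rw [real_inner_self_eq_norm_sq, real_inner_self_eq_norm_sq]
    simp only [hv, hw, map_smul, inner_smul_left, inner_smul_right, conj_trivial] at h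
    field_simp at h
    linear_combination -h
  rcases lt_or_gt_of_ne (mul_ne_zero h2 h3) with h | h
  · refine ⟨w, v, n2, n1, by rw [real_inner_comm]; exact h0, ?_, ?_⟩
    · rw [← hP, real_inner_comm]; exact h1
    · rw [real_inner_comm]; linarith
  · exact ⟨v, w, n1, n2, h0, h1, h⟩

lemma exists_isTwistedPair_of_midpoint_ne {P : E →ₗ[ℝ] E} (hP : P.IsSymmetric) {a b c : ℝ}
    (hab : a ≠ b) (hac : a ≠ c) (hbc : b ≠ c) (hmid : 2 * c ≠ a + b)
    (ha : Module.End.HasEigenvalue P a) (hb : Module.End.HasEigenvalue P b)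
    (hc : Module.End.HasEigenvalue P c) : ∃ v w, IsTwistedPair P v w := by
  have hunit : ∀ {μ : ℝ}, Module.End.HasEigenvalue P μ → ∃ e : E, P e = μ • e ∧ ⟪e, e⟫_ℝ = 1 := by
    intro μ h
    obtain ⟨x, hx⟩ := h.exists_hasEigenvector
    have hx0 : ‖x‖ ≠ 0 := norm_ne_zero_iff.mpr hx.2
    refine ⟨‖x‖⁻¹ • x, ?_, ?_⟩
    · rw [map_smul, hx.apply_eq_smul, smul_comm]
    · rw [real_inner_smul_left, real_inner_smul_right, real_inner_self_eq_norm_sq]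
      field_simp
  have horth : ∀ {μ ν : ℝ} {e f : E}, μ ≠ ν → P e = μ • e → P f = ν • f → ⟪e, f⟫_ℝ = 0 := by
    intro μ ν e f hne he hf
    have := hP e f
    rw [he, hf, real_inner_smul_left, real_inner_smul_right, ← sub_eq_zero, ← sub_mul] at this
    exact (mul_eq_zero.mp this).resolve_left (sub_ne_zero.mpr hne)
  obtain ⟨e₁, h₁, n₁⟩ := hunit ha
  obtain ⟨e₂, h₂, n₂⟩ := hunit hb
  obtain ⟨e₃, h₃, n₃⟩ := hunit hc
  have o₁₂ := horth hab h₁ h₂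
  have o₁₃ := horth hac h₁ h₃
  have o₂₃ := horth hbc h₂ h₃
  have o₂₁ := horth hab.symm h₂ h₁
  have o₃₁ := horth hac.symm h₃ h₁
  have o₃₂ := horth hbc.symm h₃ h₂
  let D : ℝ → ℝ := fun t => ((a + b) * t ^ 2 + c) * ((c - b) ^ 2 + (a - c) ^ 2 + (b - a) ^ 2 * t ^ 2)
    - (a * (c - b) ^ 2 + b * (a - c) ^ 2 + c * (b - a) ^ 2 * t ^ 2) * (2 * t ^ 2 + 1)
  have hD0 : D 0 ≠ 0 := by
    have : D 0 = (c - a) * (c - b) * (2 * c - (a + b)) := by simp only [D]; ring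
    rw [this]
    exact mul_ne_zero (mul_ne_zero (sub_ne_zero.mpr hac.symm) (sub_ne_zero.mpr hbc.symm))
      (sub_ne_zero.mpr hmid)
  have hDc : Continuous D := by fun_prop
  obtain ⟨t, ht, ht0⟩ : ∃ t, D t ≠ 0 ∧ t ≠ 0 :=
    (((hDc.continuousAt.eventually_ne hD0).filter_mono nhdsWithin_le_nhds).and
      (self_mem_nhdsWithin (s := {(0 : ℝ)}ᶜ))).exists
  refine exists_isTwistedPair_of_ne hP (V := t • e₁ + t • e₂ + e₃)
    (W := (c - b) • e₁ + (a - c) • e₂ + ((b - a) * t) • e₃) ?_ ?_ ?_ ?_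
  all_goals simp only [map_add, map_smul, h₁, h₂, h₃, inner_add_left, inner_add_right,
    real_inner_smul_left, real_inner_smul_right, n₁, n₂, n₃, o₁₂, o₁₃, o₂₃, o₂₁, o₃₁, o₃₂]
  · ring
  · ring
  · have : t * ((a - b) * (b - c) * (c - a)) ≠ 0 :=
      mul_ne_zero ht0 (mul_ne_zero (mul_ne_zero (sub_ne_zero.mpr hab) (sub_ne_zero.mpr hbc))
        (sub_ne_zero.mpr hac.symm))
    contrapose! this
    linear_combination this
  · contrapose! ht
    simp only [D]
    linear_combination ht

lemma exists_isTwistedPair {P : E →ₗ[ℝ] E} (hP : P.IsSymmetric) {a b c : ℝ}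
    (hab : a ≠ b) (hac : a ≠ c) (hbc : b ≠ c) (ha : Module.End.HasEigenvalue P a)
    (hb : Module.End.HasEigenvalue P b) (hc : Module.End.HasEigenvalue P c) :
    ∃ v w, IsTwistedPair P v w := by
  by_cases hmid : 2 * c = a + b
  · refine exists_isTwistedPair_of_midpoint_ne hP hbc hab.symm hac.symm ?_ hb hc ha
    intro h
    apply hac
    linarith
  · exact exists_isTwistedPair_of_midpoint_ne hP hab hac hbc hmid ha hb hc

/-- The cosine of the angle between `p` and `P p`, for a unit vector `p`. -/
def cosAngle (P : E →ₗ[ℝ] E) (p : E) : ℝ := ⟪p, P p⟫_ℝ / ‖P p‖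

/-- The derivative at angle `0` of minus the cost from the rotations of `p` in the plane of
`v`, `w` to the image of `p` under the projective map of `P`. -/
def rotationSlope (P : E →ₗ[ℝ] E) (v w p : E) : ℝ :=
  arccosQuot (cosAngle P p) * ((⟪v, p⟫_ℝ * ⟪w, P p⟫_ℝ - ⟪w, p⟫_ℝ * ⟪v, P p⟫_ℝ) / ‖P p‖)

variable {P : E →ₗ[ℝ] E} {v w : E}

namespace IsTwistedPair

lemma inner_self_left (h : IsTwistedPair P v w) : ⟪v, v⟫_ℝ = 1 := by
  rw [real_inner_self_eq_norm_sq, h.norm_left]; norm_num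

lemma inner_self_right (h : IsTwistedPair P v w) : ⟪w, w⟫_ℝ = 1 := by
  rw [real_inner_self_eq_norm_sq, h.norm_right]; norm_num

lemma inner_eq_zero' (h : IsTwistedPair P v w) : ⟪w, v⟫_ℝ = 0 := by
  rw [real_inner_comm]; exact h.inner_eq_zero

lemma inner_map_eq_zero' (hP : P.IsSymmetric) (h : IsTwistedPair P v w) : ⟪w, P v⟫_ℝ = 0 := by
  rw [← hP, real_inner_comm]; exact h.inner_map_eq_zero

lemma inner_lt_norm_map (hP : P.IsSymmetric) (h : IsTwistedPair P v w) {x y : ℝ}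
    (hxy : x ^ 2 + y ^ 2 = 1) :
    ⟪x • v + y • w, P (x • v + y • w)⟫_ℝ < ‖P (x • v + y • w)‖ := by
  have hvv := h.inner_self_left
  have hww := h.inner_self_right
  have hvw := h.inner_eq_zero
  have hwv := h.inner_eq_zero'
  have hvPw := h.inner_map_eq_zero
  have hwPv := h.inner_map_eq_zero' hP
  have hn : ‖x • v + y • w‖ = 1 := by
    have : ‖x • v + y • w‖ ^ 2 = 1 := by
      rw [← real_inner_self_eq_norm_sq]
      simp only [inner_add_left, inner_add_right, real_inner_smul_left, real_inner_smul_right,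
        hvv, hww, hvw, hwv]
      linarith
    exact (pow_eq_one_iff_of_nonneg (norm_nonneg _) two_ne_zero).mp this
  have key : ⟪x • v + y • w, P (x • v + y • w)⟫_ℝ
      < ‖x • v + y • w‖ * ‖P (x • v + y • w)‖ := by
    rw [inner_lt_norm_mul_iff_real, hn, one_smul]
    generalize ‖P (x • v + y • w)‖ = μ
    intro he
    rw [map_add, map_smul, map_smul] at he
    have ev := congrArg (fun z => ⟪v, z⟫_ℝ) he
    have ew := congrArg (fun z => ⟪w, z⟫_ℝ) he
    simp only [inner_add_right, real_inner_smul_right, smul_add,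
        hvv, hww, hvw, hwv, hvPw, hwPv] at ev ew
    have ePv := congrArg (fun z => ⟪P v, z⟫_ℝ) he
    have ePw := congrArg (fun z => ⟪P w, z⟫_ℝ) he
    have hPvw : ⟪P v, w⟫_ℝ = 0 := by rw [real_inner_comm]; exact hwPv
    have hPwv : ⟪P w, v⟫_ℝ = 0 := by rw [real_inner_comm]; exact hvPw
    simp only [inner_add_right, real_inner_smul_right, smul_add, hPvw, hPwv,
      real_inner_comm (P v) (P w)] at ePv ePw
    obtain ⟨hτ, hδ⟩ := mul_ne_zero_iff.mp h.twist_pos.ne'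
    have hprod : x * y * (⟪w, P w⟫_ℝ - ⟪v, P v⟫_ℝ) = 0 := by linear_combination y * ev - x * ew
    rcases mul_eq_zero.mp ((mul_eq_zero.mp hprod).resolve_right hδ) with h0 | h0
    · subst h0
      rcases mul_eq_zero.mp (show y * ⟪P v, P w⟫_ℝ = 0 by linarith) with h0 | h0
      · simp [h0] at hxy
      · exact hτ h0
    · subst h0
      rcases mul_eq_zero.mp (show x * ⟪P v, P w⟫_ℝ = 0 by linarith) with h0 | h0
      · simp [h0] at hxy
      · exact hτ h0
  rwa [hn, one_mul] at key

lemma exists_rotationSlope_add_eq (hP : P.IsSymmetric) (hpos : ∀ x, x ≠ 0 → 0 < ⟪P x, x⟫_ℝ)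
    (h : IsTwistedPair P v w) {x y : ℝ} (hxy : x ^ 2 + y ^ 2 = 1) :
    ∃ q ρ₁ ρ₂, 0 < q ∧ q < ρ₁ ∧ q < ρ₂ ∧ ρ₁ ^ 2 - ρ₂ ^ 2 = 4 * (x * y) * ⟪P v, P w⟫_ℝ ∧
      rotationSlope P v w (x • v + y • w) + rotationSlope P v w (x • v + (-y) • w)
        = (x * y * (⟪w, P w⟫_ℝ - ⟪v, P v⟫_ℝ))
          * (arccosQuot (q / ρ₁) / ρ₁ - arccosQuot (q / ρ₂) / ρ₂) := by
  have hvv := h.inner_self_left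
  have hww := h.inner_self_right
  have hvw := h.inner_eq_zero
  have hwv := h.inner_eq_zero'
  have hvPw := h.inner_map_eq_zero
  have hwPv := h.inner_map_eq_zero' hP
  have hq : ∀ z, ⟪x • v + z • w, P (x • v + z • w)⟫_ℝ
      = x ^ 2 * ⟪v, P v⟫_ℝ + z ^ 2 * ⟪w, P w⟫_ℝ := fun z => by
    simp only [map_add, map_smul, inner_add_left, inner_add_right, real_inner_smul_left,
      real_inner_smul_right, hvPw, hwPv]
    ring
  have hρ : ∀ z, ‖P (x • v + z • w)‖ ^ 2
      = x ^ 2 * ⟪P v, P v⟫_ℝ + 2 * x * z * ⟪P v, P w⟫_ℝ + z ^ 2 * ⟪P w, P w⟫_ℝ := fun z => by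
    rw [← real_inner_self_eq_norm_sq]
    simp only [map_add, map_smul, inner_add_left, inner_add_right, real_inner_smul_left,
      real_inner_smul_right, real_inner_comm (P v) (P w)]
    ring
  have hk : ∀ z, ⟪v, x • v + z • w⟫_ℝ * ⟪w, P (x • v + z • w)⟫_ℝ
      - ⟪w, x • v + z • w⟫_ℝ * ⟪v, P (x • v + z • w)⟫_ℝ
      = x * z * (⟪w, P w⟫_ℝ - ⟪v, P v⟫_ℝ) := fun z => by
    simp only [map_add, map_smul, inner_add_right, real_inner_smul_right, hvv, hww, hvw, hwv,
      hvPw, hwPv]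
    ring
  have hxy' : x ^ 2 + (-y) ^ 2 = 1 := by rwa [neg_sq]
  have l₁ := h.inner_lt_norm_map hP hxy
  have l₂ := h.inner_lt_norm_map hP hxy'
  have hqpos : 0 < ⟪x • v + y • w, P (x • v + y • w)⟫_ℝ := by
    rw [real_inner_comm]
    refine hpos _ fun h0 => ?_
    simp [h0] at l₁
  have hqq : ⟪x • v + (-y) • w, P (x • v + (-y) • w)⟫_ℝ
      = ⟪x • v + y • w, P (x • v + y • w)⟫_ℝ := by rw [hq, hq, neg_sq]
  refine ⟨_, _, ‖P (x • v + (-y) • w)‖, hqpos, l₁, hqq ▸ l₂, ?_, ?_⟩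
  · rw [hρ, hρ]; ring
  · rw [rotationSlope, rotationSlope, cosAngle, cosAngle, hk, hk, hqq]
    ring

lemma rotationSlope_add_nonpos (hP : P.IsSymmetric) (hpos : ∀ x, x ≠ 0 → 0 < ⟪P x, x⟫_ℝ)
    (h : IsTwistedPair P v w) {x y : ℝ} (hxy : x ^ 2 + y ^ 2 = 1) :
    rotationSlope P v w (x • v + y • w) + rotationSlope P v w (x • v + (-y) • w) ≤ 0 := by
  obtain ⟨q, ρ₁, ρ₂, hq, h₁, h₂, hρ, he⟩ := h.exists_rotationSlope_add_eq hP hpos hxy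
  rw [he]
  refine mul_arccosQuot_sub_nonpos hq h₁ h₂ ?_
  rw [hρ]
  nlinarith [mul_nonneg (sq_nonneg (x * y)) h.twist_pos.le]

lemma rotationSlope_add_neg (hP : P.IsSymmetric) (hpos : ∀ x, x ≠ 0 → 0 < ⟪P x, x⟫_ℝ)
    (h : IsTwistedPair P v w) {x y : ℝ} (hxy : x ^ 2 + y ^ 2 = 1) (hne : x * y ≠ 0) :
    rotationSlope P v w (x • v + y • w) + rotationSlope P v w (x • v + (-y) • w) < 0 := by
  obtain ⟨q, ρ₁, ρ₂, hq, h₁, h₂, hρ, he⟩ := h.exists_rotationSlope_add_eq hP hpos hxy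
  rw [he]
  refine mul_arccosQuot_sub_neg hq h₁ h₂ ?_
  rw [hρ]
  have hsq : 0 < (x * y) ^ 2 := by positivity
  nlinarith [mul_pos hsq h.twist_pos]

end IsTwistedPair

end TwistedPlane

section Derivative

variable {E : Type*} [NormedAddCommGroup E] [InnerProductSpace ℝ E] [FiniteDimensional ℝ E]
  [MeasurableSpace E] [BorelSpace E]

lemma hasDerivAt_setIntegral_sphereCost {vol : Measure (sphere (0 : E) 1)} [IsFiniteMeasure vol]
    {P : E →ₗ[ℝ] E} {v w : E} (hv : ‖v‖ = 1) (hw : ‖w‖ = 1)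
    {T : sphere (0 : E) 1 → sphere (0 : E) 1} (hTc : Continuous T)
    (hT : ∀ p : sphere (0 : E) 1, (T p : E) = ‖P (p : E)‖⁻¹ • P (p : E))
    {R : ℝ → E ≃ₗᵢ[ℝ] E} (hR : ∀ θ p, R θ p = p
      + ((Real.cos θ - 1) * ⟪v, p⟫_ℝ - Real.sin θ * ⟪w, p⟫_ℝ) • v
      + (Real.sin θ * ⟪v, p⟫_ℝ + (Real.cos θ - 1) * ⟪w, p⟫_ℝ) • w)
    {A : Set (sphere (0 : E) 1)} (hA : MeasurableSet A) {m : ℝ} (hm : m < 1)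
    (hAm : ∀ p ∈ A, |cosAngle P p| ≤ m) :
    IntegrableOn (fun p : sphere (0 : E) 1 => rotationSlope P v w p) A vol ∧
      HasDerivAt (fun θ => ∫ p in A, sphereCost (rotSphere (R θ) p) (T p) ∂vol)
        (-∫ p in A, rotationSlope P v w p ∂vol) 0 := by
  let c : sphere (0 : E) 1 → ℝ := fun p =>
    ⟪v, (p : E)⟫_ℝ * ⟪v, (T p : E)⟫_ℝ + ⟪w, (p : E)⟫_ℝ * ⟪w, (T p : E)⟫_ℝ
  let s : sphere (0 : E) 1 → ℝ := fun p =>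
    ⟪v, (p : E)⟫_ℝ * ⟪w, (T p : E)⟫_ℝ - ⟪w, (p : E)⟫_ℝ * ⟪v, (T p : E)⟫_ℝ
  let S : ℝ → sphere (0 : E) 1 → ℝ := fun θ p =>
    cosAngle P p + (Real.cos θ - 1) * c p + Real.sin θ * s p
  let S' : ℝ → sphere (0 : E) 1 → ℝ := fun θ p => -Real.sin θ * c p + Real.cos θ * s p
  have hTm : Continuous fun p => (T p : E) := continuous_subtype_val.comp hTc
  have hcos : ∀ p : sphere (0 : E) 1, cosAngle P p = ⟪(p : E), (T p : E)⟫_ℝ := fun p => by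
    rw [hT, real_inner_smul_right, cosAngle]
    ring
  have hcosc : Continuous fun p : sphere (0 : E) 1 => cosAngle P p := by
    simp_rw [hcos]
    exact continuous_subtype_val.inner hTm
  have hc : Continuous c := by fun_prop
  have hs : Continuous s := by fun_prop
  have hS : ∀ θ p, sphereCost (rotSphere (R θ) p) (T p) = Real.arccos (S θ p) ^ 2 / 2 := by
    intro θ p
    simp only [sphereCost, coe_rotSphere, hR, inner_add_left, real_inner_smul_left, S, hcos, c, s]
    congr 3
    ring
  have hslope : ∀ p : sphere (0 : E) 1,
      rotationSlope P v w p = arccosQuot (S 0 p) * S' 0 p := by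
    intro p
    simp only [rotationSlope, S, S', s, hT, real_inner_smul_right, Real.cos_zero, Real.sin_zero]
    ring_nf
  have hbd : ∀ u : E, ‖u‖ = 1 → ∀ p : sphere (0 : E) 1, |⟪u, (p : E)⟫_ℝ| ≤ 1 := by
    intro u hu p
    have := abs_real_inner_le_norm u (p : E)
    rwa [hu, mem_sphere_zero_iff_norm.mp p.2, one_mul] at this
  have hmul : ∀ a b : ℝ, |a| ≤ 1 → |b| ≤ 1 → |a * b| ≤ 1 := fun a b ha hb => by
    rw [abs_mul]
    exact mul_le_one₀ ha (abs_nonneg _) hb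
  have hcb : ∀ p, |c p| ≤ 2 := fun p => by
    refine (abs_add_le _ _).trans ?_
    linarith [hmul _ _ (hbd v hv p) (hbd v hv (T p)), hmul _ _ (hbd w hw p) (hbd w hw (T p))]
  have hsb : ∀ p, |s p| ≤ 2 := fun p => by
    refine (abs_sub _ _).trans ?_
    linarith [hmul _ _ (hbd v hv p) (hbd w hw (T p)), hmul _ _ (hbd w hw p) (hbd v hv (T p))]
  have hS'b : ∀ θ p, |S' θ p| ≤ 4 := fun θ p => by
    refine (abs_add_le _ _).trans ?_
    rw [abs_mul, abs_mul, abs_neg]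
    nlinarith [Real.abs_sin_le_one θ, Real.abs_cos_le_one θ, hcb p, hsb p, abs_nonneg (c p),
      abs_nonneg (s p)]
  let N : Set ℝ := {θ | 2 * |Real.cos θ - 1| + 2 * |Real.sin θ| < (1 - m) / 2}
  have hN : N ∈ nhds (0 : ℝ) := by
    have hcont : Continuous fun θ => 2 * |Real.cos θ - 1| + 2 * |Real.sin θ| := by fun_prop
    refine (isOpen_lt hcont continuous_const).mem_nhds ?_
    simp only [Set.mem_ofPred_eq, Real.cos_zero, Real.sin_zero, sub_self, abs_zero]
    linarith
  have hSb : ∀ p ∈ A, ∀ θ ∈ N, |S θ p| ≤ (1 + m) / 2 := by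
    intro p hp θ hθ
    have h1 := abs_add_three (cosAngle P p) ((Real.cos θ - 1) * c p) (Real.sin θ * s p)
    rw [abs_mul, abs_mul] at h1
    have h2 := mul_le_mul_of_nonneg_left (hcb p) (abs_nonneg (Real.cos θ - 1))
    have h3 := mul_le_mul_of_nonneg_left (hsb p) (abs_nonneg (Real.sin θ))
    have h4 := hAm p hp
    simp only [N, Set.mem_ofPred_eq] at hθ
    simp only [S]
    linarith
  have hm' : (1 + m) / 2 < 1 := by linarith
  have hderiv : ∀ p ∈ A, ∀ θ ∈ N, HasDerivAt (fun θ => sphereCost (rotSphere (R θ) p) (T p))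
      (-arccosQuot (S θ p) * S' θ p) θ := by
    intro p hp θ hθ
    simp_rw [hS]
    have hd : HasDerivAt (fun θ => S θ p) (S' θ p) θ := by
      simp only [S, S']
      exact ((((Real.hasDerivAt_cos θ).sub_const 1).mul_const (c p)).const_add _).add
        ((Real.hasDerivAt_sin θ).mul_const (s p))
    exact (hasDerivAt_arccos_sq_div_two ((hSb p hp θ hθ).trans_lt hm')).comp θ hd
  have hmain := hasDerivAt_integral_of_dominated_loc_of_deriv_le (μ := vol.restrict A)
    (F := fun θ p => sphereCost (rotSphere (R θ) p) (T p))
    (F' := fun θ p => -arccosQuot (S θ p) * S' θ p) (x₀ := 0) (s := N)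
    (bound := fun _ => Real.pi / √(1 - ((1 + m) / 2) ^ 2) * 4) hN
    (Filter.Eventually.of_forall fun θ =>
      ((continuous_rotSphere (R θ)).sphereCost hTc).aestronglyMeasurable)
    (((continuous_rotSphere (R 0)).sphereCost hTc).integrable_of_hasCompactSupport
      (HasCompactSupport.of_compactSpace _))
    (by
      have h1 : Measurable (S 0) := by
        have : Continuous (S 0) := by fun_prop
        exact this.measurable
      have h2 : Measurable (S' 0) := by
        have : Continuous (S' 0) := by fun_prop
        exact this.measurable
      exact ((measurable_arccosQuot.comp h1).neg.mul h2).aestronglyMeasurable)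
    ((ae_restrict_iff' hA).mpr (Filter.Eventually.of_forall fun p hp θ hθ => by
      rw [Real.norm_eq_abs, abs_mul, abs_neg]
      exact mul_le_mul (abs_arccosQuot_le (hSb p hp θ hθ) hm') (hS'b θ p) (abs_nonneg _)
        (by positivity)))
    (integrable_const _)
    ((ae_restrict_iff' hA).mpr (Filter.Eventually.of_forall fun p hp θ hθ => hderiv p hp θ hθ))
  have heq : (fun p : sphere (0 : E) 1 => rotationSlope P v w p)
      = fun p => -(-arccosQuot (S 0 p) * S' 0 p) := by
    funext p
    rw [hslope]
    ring
  refine ⟨?_, ?_⟩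
  · rw [heq]
    exact hmain.1.neg
  · rw [heq, integral_neg, neg_neg]
    exact hmain.2

end Derivative

section Tube

variable {E : Type*} [NormedAddCommGroup E] [InnerProductSpace ℝ E]

lemma exists_forall_lt_of_nhds {X : Type*} [TopologicalSpace X] [CompactSpace X] {f : X → ℝ}
    (hf : Continuous f) {M : ℝ} (hle : ∀ x, f x ≤ M) {U : Set X}
    (hU : ∀ x, f x = M → U ∈ nhds x) : ∃ r < M, ∀ x, r ≤ f x → x ∈ U := by
  rcases (interior U)ᶜ.eq_empty_or_nonempty with h | h
  · refine ⟨M - 1, by linarith, fun x _ => interior_subset ?_⟩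
    rw [Set.compl_empty_iff.mp h]
    trivial
  · obtain ⟨x₀, hx₀, hmax⟩ :=
      isOpen_interior.isClosed_compl.isCompact.exists_isMaxOn h hf.continuousOn
    have hlt : f x₀ < M := lt_of_le_of_ne (hle x₀) fun he =>
      hx₀ (mem_interior_iff_mem_nhds.mpr (hU x₀ he))
    refine ⟨(f x₀ + M) / 2, by linarith, fun x hx => ?_⟩
    by_contra hxU
    have : f x ≤ f x₀ := hmax fun hi => hxU (interior_subset hi)
    linarith

lemma norm_sub_sq_eq_of_orthonormal {v w : E} (hv : ⟪v, v⟫_ℝ = 1) (hw : ⟪w, w⟫_ℝ = 1)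
    (hvw : ⟪v, w⟫_ℝ = 0) (p : E) :
    ‖p - (⟪v, p⟫_ℝ • v + ⟪w, p⟫_ℝ • w)‖ ^ 2 = ‖p‖ ^ 2 - (⟪v, p⟫_ℝ ^ 2 + ⟪w, p⟫_ℝ ^ 2) := by
  have hwv : ⟪w, v⟫_ℝ = 0 := by rw [real_inner_comm]; exact hvw
  rw [← real_inner_self_eq_norm_sq, ← real_inner_self_eq_norm_sq]
  simp only [inner_sub_left, inner_sub_right, inner_add_left, inner_add_right,
    real_inner_smul_left, real_inner_smul_right, hv, hw, hvw, hwv, real_inner_comm v p,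
    real_inner_comm w p]
  ring

variable [FiniteDimensional ℝ E] {P : E →ₗ[ℝ] E} {v w : E}

lemma continuousAt_cosAngle {p : E} (hp : P p ≠ 0) : ContinuousAt (cosAngle P) p := by
  have hP : Continuous P := P.continuous_of_finiteDimensional
  exact (continuous_id.inner hP).continuousAt.div hP.norm.continuousAt (norm_ne_zero_iff.mpr hp)

lemma continuousAt_rotationSlope {p : E} (hp : P p ≠ 0) (h : |cosAngle P p| < 1) :
    ContinuousAt (rotationSlope P v w) p := by
  have hP : Continuous P := P.continuous_of_finiteDimensional
  refine ContinuousAt.mul ?_ (ContinuousAt.div ?_ hP.norm.continuousAt (norm_ne_zero_iff.mpr hp))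
  · exact ContinuousAt.comp (continuousAt_arccosQuot h) (continuousAt_cosAngle hp)
  · fun_prop

/-- For a twisted pair, the sum of the rotation slopes at four isometric images of a point is
negative throughout some tube around the great circle in the plane of the pair. -/
lemma IsTwistedPair.exists_tube (hP : P.IsSymmetric) (hpos : ∀ x, x ≠ 0 → 0 < ⟪P x, x⟫_ℝ)
    (h : IsTwistedPair P v w) {R σ : E ≃ₗᵢ[ℝ] E}
    (hσ : ∀ p, σ p = p - (2 * ⟪w, p⟫_ℝ) • w)
    (hR : ∀ p, R p = p
      + ((Real.cos (Real.pi / 4) - 1) * ⟪v, p⟫_ℝ - Real.sin (Real.pi / 4) * ⟪w, p⟫_ℝ) • v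
      + (Real.sin (Real.pi / 4) * ⟪v, p⟫_ℝ + (Real.cos (Real.pi / 4) - 1) * ⟪w, p⟫_ℝ) • w) :
    ∃ r < 1, ∃ m < 1, ∀ p : sphere (0 : E) 1, r ≤ ⟪v, (p : E)⟫_ℝ ^ 2 + ⟪w, (p : E)⟫_ℝ ^ 2 →
      |cosAngle P p| ≤ m ∧
      rotationSlope P v w p + rotationSlope P v w (σ p)
        + (rotationSlope P v w (R p) + rotationSlope P v w (σ (R p))) < 0 := by
  have hvv := h.inner_self_left
  have hww := h.inner_self_right
  have hvw := h.inner_eq_zero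
  have hcircle : ∀ x y : ℝ, x ^ 2 + y ^ 2 = 1 →
      P (x • v + y • w) ≠ 0 ∧ |cosAngle P (x • v + y • w)| < 1 := by
    intro x y hxy
    have hlt := h.inner_lt_norm_map hP hxy
    have hne : P (x • v + y • w) ≠ 0 := fun h0 => by simp [h0] at hlt
    have hx0 : x • v + y • w ≠ 0 := fun h0 => hne (by rw [h0, map_zero])
    have hq : 0 < ⟪x • v + y • w, P (x • v + y • w)⟫_ℝ := by
      rw [real_inner_comm]; exact hpos _ hx0
    have hρ : 0 < ‖P (x • v + y • w)‖ := norm_pos_iff.mpr hne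
    refine ⟨hne, ?_⟩
    rw [cosAngle, abs_of_pos (div_pos hq hρ), div_lt_one hρ]
    exact hlt
  have hσc : ∀ x y : ℝ, σ (x • v + y • w) = x • v + (-y) • w := fun x y => by
    rw [hσ]
    simp only [inner_add_right, real_inner_smul_right, hww, h.inner_eq_zero']
    module
  set t : ℝ := √2 / 2 with ht
  have ht2 : t ^ 2 = 1 / 2 := by
    rw [ht, div_pow, Real.sq_sqrt (by norm_num)]; norm_num
  have hRc : ∀ x y : ℝ, R (x • v + y • w) = (t * (x - y)) • v + (t * (x + y)) • w := fun x y => by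
    rw [hR, Real.cos_pi_div_four, Real.sin_pi_div_four]
    simp only [inner_add_right, real_inner_smul_right, hvv, hww, hvw, h.inner_eq_zero']
    module
  let g : E → ℝ := fun p => rotationSlope P v w p + rotationSlope P v w (σ p)
    + (rotationSlope P v w (R p) + rotationSlope P v w (σ (R p)))
  let N : sphere (0 : E) 1 → ℝ := fun p => ⟪v, (p : E)⟫_ℝ ^ 2 + ⟪w, (p : E)⟫_ℝ ^ 2
  have hN : Continuous N := by fun_prop
  have hN1 : ∀ p, N p ≤ 1 := fun p => by
    have := norm_sub_sq_eq_of_orthonormal hvv hww hvw (p : E)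
    rw [mem_sphere_zero_iff_norm.mp p.2] at this
    have h2 := sq_nonneg ‖(p : E) - (⟪v, (p : E)⟫_ℝ • v + ⟪w, (p : E)⟫_ℝ • w)‖
    simp only [N]
    linarith
  have hNeq : ∀ p, N p = 1 → (p : E) = ⟪v, (p : E)⟫_ℝ • v + ⟪w, (p : E)⟫_ℝ • w := fun p hp => by
    have := norm_sub_sq_eq_of_orthonormal hvv hww hvw (p : E)
    rw [mem_sphere_zero_iff_norm.mp p.2] at this
    simp only [N] at hp
    rw [hp, one_pow, sub_self] at this
    exact sub_eq_zero.mp (norm_eq_zero.mp (pow_eq_zero_iff two_ne_zero |>.mp this))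
  have hnhds : ∀ p, N p = 1 →
      {p : sphere (0 : E) 1 | P p ≠ 0 ∧ |cosAngle P p| < 1 ∧ g p < 0} ∈ nhds p := by
    intro p hp
    have hpe := hNeq p hp
    simp only [N] at hp
    generalize ⟪v, (p : E)⟫_ℝ = x at hp hpe
    generalize ⟪w, (p : E)⟫_ℝ = y at hp hpe
    have hRp : (t * (x - y)) ^ 2 + (t * (x + y)) ^ 2 = 1 := by
      linear_combination (2 * (x ^ 2 + y ^ 2)) * ht2 + hp
    have hneg : ∀ {x y : ℝ}, x ^ 2 + y ^ 2 = 1 → x ^ 2 + (-y) ^ 2 = 1 := fun h => by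
      rwa [neg_sq]
    have hcs : ∀ x y : ℝ, x ^ 2 + y ^ 2 = 1 →
        ContinuousAt (rotationSlope P v w) (x • v + y • w) := fun x y hxy =>
      continuousAt_rotationSlope (hcircle x y hxy).1 (hcircle x y hxy).2
    have hσ' : Continuous σ := σ.continuous
    have hR' : Continuous R := R.continuous
    have hgc : ContinuousAt g p := by
      have c₁ : ContinuousAt (rotationSlope P v w) p := by rw [hpe]; exact hcs _ _ hp
      have c₂ : ContinuousAt (rotationSlope P v w) (σ p) := by
        rw [hpe, hσc]; exact hcs _ _ (hneg hp)
      have c₃ : ContinuousAt (rotationSlope P v w) (R p) := by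
        rw [hpe, hRc]; exact hcs _ _ hRp
      have c₄ : ContinuousAt (rotationSlope P v w) (σ (R p)) := by
        rw [hpe, hRc, hσc]; exact hcs _ _ (hneg hRp)
      exact (c₁.add (c₂.comp_of_eq hσ'.continuousAt rfl)).add
        ((c₃.comp_of_eq hR'.continuousAt rfl).add
          (c₄.comp_of_eq (hσ'.comp hR').continuousAt rfl))
    have hgneg : g p < 0 := by
      simp only [g]
      rw [hpe, hRc, hσc, hσc]
      have l₁ := h.rotationSlope_add_nonpos hP hpos hp
      have l₂ := h.rotationSlope_add_nonpos hP hpos hRp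
      by_cases hxy : x * y = 0
      · have hne : t * (x - y) * (t * (x + y)) ≠ 0 := by
          intro h0
          have h1 : x ^ 2 - y ^ 2 = 0 := by linear_combination 2 * h0 - 2 * (x ^ 2 - y ^ 2) * ht2
          have h2 : (x ^ 2 + y ^ 2) ^ 2 = 0 := by
            linear_combination (x ^ 2 - y ^ 2) * h1 + 4 * (x * y) * hxy
          rw [hp] at h2
          norm_num at h2
        linarith [h.rotationSlope_add_neg hP hpos hRp hne]
      · linarith [h.rotationSlope_add_neg hP hpos hp hxy]
    have hp' := hcircle x y hp
    rw [← hpe] at hp'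
    have hPc : Continuous P := P.continuous_of_finiteDimensional
    have e₁ := hPc.continuousAt.eventually_ne hp'.1
    have e₂ := (continuousAt_cosAngle hp'.1).abs.eventually_lt continuousAt_const hp'.2
    have e₃ := hgc.eventually_lt continuousAt_const hgneg
    exact continuousAt_subtype_val.eventually (e₁.and (e₂.and e₃))
  obtain ⟨r, hr, hrU⟩ := exists_forall_lt_of_nhds hN hN1 hnhds
  have hK : IsCompact {p | r ≤ N p} := (isClosed_le continuous_const hN).isCompact
  have hKne : {p | r ≤ N p}.Nonempty := by
    refine ⟨⟨v, mem_sphere_zero_iff_norm.mpr h.norm_left⟩, ?_⟩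
    simp only [N, Set.mem_ofPred_eq, hvv, h.inner_eq_zero']
    linarith
  obtain ⟨p₀, hp₀, hmax⟩ := hK.exists_isMaxOn hKne
    (f := fun p : sphere (0 : E) 1 => |cosAngle P p|) fun p hp =>
      ((continuousAt_cosAngle (hrU p hp).1).abs.comp
        continuousAt_subtype_val).continuousWithinAt
  exact ⟨r, hr, _, (hrU p₀ hp₀).2.1, fun p hp => ⟨hmax hp, (hrU p hp).2.2⟩⟩

end Tube

theorem projective_map_not_optimal_of_three_eigenvalues (n : ℕ) (hn : 2 ≤ n)
    (P : EuclideanSpace ℝ (Fin (n + 1)) →ₗ[ℝ] EuclideanSpace ℝ (Fin (n + 1)))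
    (hPsym : ∀ x y, ⟪P x, y⟫_ℝ = ⟪x, P y⟫_ℝ)
    (hPpos : ∀ x, x ≠ 0 → 0 < ⟪P x, x⟫_ℝ)
    (hPeig : ∃ a b c : ℝ, a ≠ b ∧ a ≠ c ∧ b ≠ c ∧ Module.End.HasEigenvalue P a ∧
      Module.End.HasEigenvalue P b ∧ Module.End.HasEigenvalue P c)
    (T : sphere (0 : EuclideanSpace ℝ (Fin (n + 1))) 1 →
      sphere (0 : EuclideanSpace ℝ (Fin (n + 1))) 1)
    (hT : ∀ p : sphere (0 : EuclideanSpace ℝ (Fin (n + 1))) 1,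
      (T p : EuclideanSpace ℝ (Fin (n + 1)))
        = ‖P (p : EuclideanSpace ℝ (Fin (n + 1)))‖⁻¹ • P (p : EuclideanSpace ℝ (Fin (n + 1))))
    (vol : Measure (sphere (0 : EuclideanSpace ℝ (Fin (n + 1))) 1))
    (hvol₀ : vol ≠ 0) (hvolfin : IsFiniteMeasure vol)
    (hvolinv : IsRotationInvariant vol) :
    ¬ (∀ F : sphere (0 : EuclideanSpace ℝ (Fin (n + 1))) 1 →
        sphere (0 : EuclideanSpace ℝ (Fin (n + 1))) 1,
      Measurable F → Measure.map F vol = Measure.map T vol →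
      ∫ p, sphereCost p (T p) ∂vol ≤ ∫ p, sphereCost p (F p) ∂vol) := by
  have hP : P.IsSymmetric := hPsym
  have hPc : Continuous P := P.continuous_of_finiteDimensional
  obtain ⟨a, b, c, hab, hac, hbc, ha, hb, hc⟩ := hPeig
  obtain ⟨v, w, h⟩ := exists_isTwistedPair hP hab hac hbc ha hb hc
  have hTc : Continuous T := by
    refine continuous_induced_rng.mpr ?_
    have hne : ∀ p : sphere (0 : EuclideanSpace ℝ (Fin (n + 1))) 1,
        ‖P (p : EuclideanSpace ℝ (Fin (n + 1)))‖ ≠ 0 := fun p h0 => by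
      have := hPpos p (ne_zero_of_mem_unit_sphere p)
      simp [norm_eq_zero.mp h0] at this
    have hPs := hPc.comp (continuous_subtype_val
      (p := fun x => x ∈ sphere (0 : EuclideanSpace ℝ (Fin (n + 1))) 1))
    exact ((hPs.norm.inv₀ hne).smul hPs).congr fun p => (hT p).symm
  intro hopt
  obtain ⟨R, hR⟩ := exists_planeRotation h.norm_left h.norm_right h.inner_eq_zero
  have hvv := h.inner_self_left
  have hww := h.inner_self_right
  have hvw := h.inner_eq_zero
  have hwv := h.inner_eq_zero'
  obtain ⟨σ, hσ⟩ : ∃ σ : EuclideanSpace ℝ (Fin (n + 1)) ≃ₗᵢ[ℝ] EuclideanSpace ℝ (Fin (n + 1)),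
      ∀ p, σ p = p - (2 * ⟪w, p⟫_ℝ) • w := by
    refine ⟨(ℝ ∙ w)ᗮ.reflection, fun p => ?_⟩
    rw [Submodule.reflection_orthogonal_apply, Submodule.reflection_singleton_apply, h.norm_right]
    simp only [RCLike.ofReal_real_eq_id, id, one_pow, div_one]
    module
  obtain ⟨r, hr, m, hm, htube⟩ := h.exists_tube hP hPpos hσ (hR (Real.pi / 4))
  let N : sphere (0 : EuclideanSpace ℝ (Fin (n + 1))) 1 → ℝ := fun p =>
    ⟪v, (p : EuclideanSpace ℝ (Fin (n + 1)))⟫_ℝ ^ 2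
      + ⟪w, (p : EuclideanSpace ℝ (Fin (n + 1)))⟫_ℝ ^ 2
  have hN : Continuous N := by fun_prop
  let A : Set (sphere (0 : EuclideanSpace ℝ (Fin (n + 1))) 1) := {p | r < N p}
  have hAo : IsOpen A := isOpen_lt continuous_const hN
  have hA : MeasurableSet A := hAo.measurableSet
  have hAR : ∀ θ, rotSphere (R θ) ⁻¹' A = A := fun θ => by
    ext p
    have : N (rotSphere (R θ) p) = N p := by
      simp only [N, coe_rotSphere, hR, inner_add_right, real_inner_smul_right, hvv, hww, hvw, hwv]
      linear_combination N p * Real.sin_sq_add_cos_sq θ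
    simp only [A, Set.mem_preimage, Set.mem_ofPred_eq, this]
  have hAσ : rotSphere σ ⁻¹' A = A := by
    ext p
    have : N (rotSphere σ p) = N p := by
      simp only [N, coe_rotSphere, hσ, inner_sub_right, real_inner_smul_right, hww, hvw]
      ring
    simp only [A, Set.mem_preimage, Set.mem_ofPred_eq, this]
  have hApos : 0 < vol A := by
    refine hvolinv.measure_pos_of_isOpen hvol₀ hAo
      ⟨⟨v, mem_sphere_zero_iff_norm.mpr h.norm_left⟩, ?_⟩
    simp only [A, N, Set.mem_ofPred_eq, hvv, hwv]
    linarith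
  obtain ⟨hint, hderiv⟩ := hasDerivAt_setIntegral_sphereCost (vol := vol) h.norm_left h.norm_right
    hTc hT hR hA hm fun p hp => (htube p (le_of_lt hp)).1
  have hmin : IsLocalMin
      (fun θ => ∫ p in A, sphereCost (rotSphere (R θ) p) (T p) ∂vol) 0 := by
    refine Filter.Eventually.of_forall fun θ => ?_
    have hR0 : ∀ p, rotSphere (R 0) p = p := fun p => Subtype.ext (by simp [hR])
    simp only [hR0]
    exact hvolinv.setIntegral_sphereCost_le hTc hopt (R θ) hA (hAR θ)
  have hzero : ∫ p in A, rotationSlope P v w p ∂vol = 0 :=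
    neg_eq_zero.mp (hmin.hasDerivAt_eq_zero hderiv)
  let f : sphere (0 : EuclideanSpace ℝ (Fin (n + 1))) 1 → ℝ := fun p => rotationSlope P v w p
  let ρ := R (Real.pi / 4)
  have iσ := hvolinv.integrableOn_comp σ hAσ (g := f) hint
  have iρ := hvolinv.integrableOn_comp ρ (hAR _) (g := f) hint
  have iρσ := hvolinv.integrableOn_comp ρ (hAR _) iσ
  have eσ := hvolinv.setIntegral_comp σ hAσ f
  have eρ := hvolinv.setIntegral_comp ρ (hAR _) f
  have eρσ := hvolinv.setIntegral_comp ρ (hAR _) fun p => f (rotSphere σ p)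
  have hsum : ∫ p in A, -(f p + f (rotSphere σ p)
      + (f (rotSphere ρ p) + f (rotSphere σ (rotSphere ρ p)))) ∂vol = 0 := by
    have i₁ : IntegrableOn (fun p => f p + f (rotSphere σ p)) A vol := Integrable.add hint iσ
    have i₂ : IntegrableOn (fun p => f (rotSphere ρ p) + f (rotSphere σ (rotSphere ρ p))) A vol :=
      Integrable.add iρ iρσ
    rw [integral_neg, integral_add i₁ i₂, integral_add hint iσ, integral_add iρ iρσ, eρσ, eσ, eρ,
      hzero]
    norm_num
  have hneg : ∀ p ∈ A, 0 < -(f p + f (rotSphere σ p)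
      + (f (rotSphere ρ p) + f (rotSphere σ (rotSphere ρ p)))) := fun p hp =>
    neg_pos.mpr (htube p (le_of_lt hp)).2
  have hsupp : A ⊆ Function.support fun p => -(f p + f (rotSphere σ p)
      + (f (rotSphere ρ p) + f (rotSphere σ (rotSphere ρ p)))) := fun p hp => (hneg p hp).ne'
  have hpos := (setIntegral_pos_iff_support_of_nonneg_ae
    ((ae_restrict_iff' hA).mpr (Filter.Eventually.of_forall fun p hp => (hneg p hp).le))
    ((hint.add iσ).add (iρ.add iρσ)).neg).mpr (by
      rwa [Set.inter_eq_right.mpr hsupp])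
  exact hpos.ne' hsum

end
end

section
/- Let f : ℝ → ℝ be a smooth π-periodic odd function with f'(x) + 1 > 0 for all x, and write ℝ^{n+1} = ℝᵏ ⊕ ℝˡ with k, ℓ ≥ 1. Then the map T : Sⁿ → Sⁿ given by T(cos x · u, sin x · v) = (cos(x + f(x)) · u, sin(x + f(x)) · v), for x ∈ ℝ and unit vectors u ∈ ℝᵏ, v ∈ ℝˡ, is the optimal transportation map between vol and T_#(vol) for the cost c(p,q) = d(p,q)²/2; that is, for every Borel map F : Sⁿ → Sⁿ with F_#(vol) = T_#(vol) one has ∫ c(p,T(p)) dvol(p) ≤ ∫ c(p,F(p)) dvol(p). -/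
/- Godoy–Salvai, Theorem 3: for `f : ℝ → ℝ` smooth, `π`-periodic and odd with `f' + 1 > 0`,
the map `T(cos x · u, sin x · v) = (cos(x+f(x)) · u, sin(x+f(x)) · v)` of the sphere
`Sⁿ ⊆ ℝᵏ ⊕ ℝˡ` is the optimal transport map (for the cost `d²/2`) between `vol` and
`T₃(vol)`. -/

open MeasureTheory Metric
open scoped InnerProductSpace

noncomputable section

/-- `ℝ^{n+1} = ℝᵏ ⊕ ℝˡ` with its Euclidean (ℓ²) structure. -/
abbrev SplitSpace (k l : ℕ) : Type :=
  WithLp 2 (EuclideanSpace ℝ (Fin k) × EuclideanSpace ℝ (Fin l))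

/-- The point `(a, b)` of `ℝᵏ ⊕ ℝˡ`. -/
abbrev splitPt {k l : ℕ} (a : EuclideanSpace ℝ (Fin k)) (b : EuclideanSpace ℝ (Fin l)) :
    SplitSpace k l :=
  (WithLp.equiv 2 (EuclideanSpace ℝ (Fin k) × EuclideanSpace ℝ (Fin l))).symm (a, b)

section Legendre

variable {g : ℝ → ℝ}

/-- The tangent line inequality for the antiderivative of a monotone continuous function. -/
lemma integral_tangent_le (hg : Continuous g) (hm : Monotone g) (s x : ℝ) :
    (∫ t in (0 : ℝ)..s, g t) + g s * (x - s) ≤ ∫ t in (0 : ℝ)..x, g t := by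
  have hint : ∀ a b : ℝ, IntervalIntegrable g volume a b := fun a b => hg.intervalIntegrable a b
  have hadd := intervalIntegral.integral_add_adjacent_intervals (hint 0 s) (hint s x)
  have key : g s * (x - s) ≤ ∫ t in s..x, g t := by
    rcases le_total s x with h | h
    · have := intervalIntegral.integral_mono_on (f := fun _ => g s) h (by simp) (hint s x)
        fun t ht => hm ht.1
      simpa [mul_comm] using this
    · have := intervalIntegral.integral_mono_on (g := fun _ => g s) h (hint x s) (by simp)
        fun t ht => hm ht.2
      rw [intervalIntegral.integral_symm]
      simp only [intervalIntegral.integral_const, smul_eq_mul] at this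
      linarith
  linarith

/-- Dual potentials for the quadratic cost on the line and an increasing homeomorphism. -/
lemma exists_potentials (hg : Continuous g) (hm : StrictMono g) (hs : Function.Surjective g) :
    ∃ φ ψ : ℝ → ℝ, Continuous φ ∧ Continuous ψ ∧ (∀ x y, φ x + ψ y ≤ (x - y) ^ 2 / 2) ∧
      ∀ x, φ x + ψ (g x) = (x - g x) ^ 2 / 2 := by
  let e := hm.orderIsoOfSurjective g hs
  have he : ∀ y, g (e.symm y) = y := e.apply_symm_apply
  have he' : ∀ x, e.symm (g x) = x := e.symm_apply_apply
  have hec : Continuous e.symm := e.symm.continuous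
  have hG : Continuous fun x => ∫ t in (0 : ℝ)..x, g t :=
    intervalIntegral.continuous_primitive (fun a b => hg.intervalIntegrable a b) 0
  refine ⟨fun x => x ^ 2 / 2 - ∫ t in (0 : ℝ)..x, g t,
    fun y => y ^ 2 / 2 - (y * e.symm y - ∫ t in (0 : ℝ)..e.symm y, g t), by fun_prop, ?_, ?_, ?_⟩
  · have := hG.comp hec
    simp only [Function.comp_def] at this
    fun_prop
  · intro x y
    have := integral_tangent_le hg hm.monotone (e.symm y) x
    rw [he] at this
    linear_combination this
  · intro x
    simp only [he']
    ring

end Legendre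

section Reparametrization

variable {f : ℝ → ℝ}

lemma strictMono_id_add (hf : Differentiable ℝ f) (hf' : ∀ x, 0 < deriv f x + 1) :
    StrictMono fun x => x + f x := by
  refine strictMono_of_deriv_pos fun x => ?_
  have := ((hasDerivAt_id x).add (hf x).hasDerivAt).deriv
  have h2 : deriv (fun x => x + f x) x = 1 + deriv f x := this
  rw [h2]
  linarith [hf' x]

lemma surjective_id_add (hf : Continuous f) (hper : Function.Periodic f Real.pi)
    (h0 : f 0 = 0) : Function.Surjective fun x => x + f x := by
  intro y
  have hz : ∀ n : ℤ, f (n * Real.pi) = 0 := fun n => by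
    have := hper.int_mul n 0
    simpa [h0] using this
  have hpi := Real.pi_pos
  refine mem_range_of_exists_le_of_exists_ge (by fun_prop)
    ⟨(⌊y / Real.pi⌋ : ℤ) * Real.pi, ?_⟩ ⟨(⌈y / Real.pi⌉ : ℤ) * Real.pi, ?_⟩
  · simp only [hz, add_zero]
    exact (le_div_iff₀ hpi).1 (Int.floor_le _)
  · simp only [hz, add_zero]
    exact (div_le_iff₀ hpi).1 (Int.le_ceil _)

lemma Function.Periodic.apply_half_period_eq_zero_of_odd {c : ℝ} (hper : Function.Periodic f c)
    (hodd : ∀ x, f (-x) = -f x) : f (c / 2) = 0 := by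
  have h1 := hper (-(c / 2))
  rw [hodd, show -(c / 2) + c = c / 2 by ring] at h1
  linarith

end Reparametrization

section Latitude

variable {k l : ℕ}

/-- The angle `x ∈ [0, π/2]` of the point `(cos x • u, sin x • v)`. -/
def latitude (p : sphere (0 : SplitSpace k l) 1) : ℝ :=
  Real.arcsin ‖(p : SplitSpace k l).snd‖

lemma continuous_latitude : Continuous (latitude (k := k) (l := l)) := by
  unfold latitude
  fun_prop

lemma norm_sq_fst_add_norm_sq_snd (p : sphere (0 : SplitSpace k l) 1) :
    ‖(p : SplitSpace k l).fst‖ ^ 2 + ‖(p : SplitSpace k l).snd‖ ^ 2 = 1 := by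
  rw [← WithLp.prod_norm_sq_eq_of_L2, mem_sphere_zero_iff_norm.mp p.2, one_pow]

lemma latitude_mem_Icc (p : sphere (0 : SplitSpace k l) 1) :
    latitude p ∈ Set.Icc 0 (Real.pi / 2) :=
  ⟨Real.arcsin_nonneg.2 (norm_nonneg _), Real.arcsin_le_pi_div_two _⟩

lemma sin_latitude (p : sphere (0 : SplitSpace k l) 1) :
    Real.sin (latitude p) = ‖(p : SplitSpace k l).snd‖ := by
  have h := norm_sq_fst_add_norm_sq_snd p
  have h0 := norm_nonneg (p : SplitSpace k l).snd
  exact Real.sin_arcsin (by linarith)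
    (by nlinarith [sq_nonneg ‖(p : SplitSpace k l).fst‖])

lemma cos_latitude (p : sphere (0 : SplitSpace k l) 1) :
    Real.cos (latitude p) = ‖(p : SplitSpace k l).fst‖ := by
  rw [latitude, Real.cos_arcsin, ← eq_sub_of_add_eq (norm_sq_fst_add_norm_sq_snd p),
    Real.sqrt_sq (norm_nonneg _)]

lemma exists_norm_eq_one_and_smul {n : ℕ} (hn : 1 ≤ n) (a : EuclideanSpace ℝ (Fin n)) :
    ∃ u : EuclideanSpace ℝ (Fin n), ‖u‖ = 1 ∧ a = ‖a‖ • u := by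
  rcases eq_or_ne a 0 with rfl | ha
  · exact ⟨EuclideanSpace.single ⟨0, hn⟩ 1, by simp, by simp⟩
  · have h := norm_ne_zero_iff.2 ha
    exact ⟨‖a‖⁻¹ • a, by simp [norm_smul, h], by simp [smul_smul, h]⟩

lemma exists_eq_splitPt_latitude (hk : 1 ≤ k) (hl : 1 ≤ l)
    (p : sphere (0 : SplitSpace k l) 1) :
    ∃ (u : EuclideanSpace ℝ (Fin k)) (v : EuclideanSpace ℝ (Fin l)), ‖u‖ = 1 ∧ ‖v‖ = 1 ∧
      (p : SplitSpace k l) =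
        splitPt (Real.cos (latitude p) • u) (Real.sin (latitude p) • v) := by
  obtain ⟨u, hu, hu'⟩ := exists_norm_eq_one_and_smul hk (p : SplitSpace k l).fst
  obtain ⟨v, hv, hv'⟩ := exists_norm_eq_one_and_smul hl (p : SplitSpace k l).snd
  refine ⟨u, v, hu, hv, ?_⟩
  rw [cos_latitude, sin_latitude, ← hu', ← hv']
  rfl

/-- The latitude is distance nonincreasing. -/
lemma sq_latitude_sub_le_sphereCost (p q : sphere (0 : SplitSpace k l) 1) :
    (latitude p - latitude q) ^ 2 / 2 ≤ sphereCost p q := by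
  have hp := latitude_mem_Icc p
  have hq := latitude_mem_Icc q
  have hpi := Real.pi_pos
  have hin : ⟪(p : SplitSpace k l), (q : SplitSpace k l)⟫_ℝ
      ≤ Real.cos |latitude p - latitude q| := by
    rw [Real.cos_abs, Real.cos_sub, cos_latitude, cos_latitude, sin_latitude, sin_latitude,
      WithLp.prod_inner_apply]
    exact add_le_add (real_inner_le_norm _ _) (real_inner_le_norm _ _)
  have h := Real.arccos_le_arccos hin
  rw [Real.arccos_cos (abs_nonneg _)
    (abs_le.2 ⟨by linarith [hp.1, hq.2], by linarith [hp.2, hq.1]⟩)] at h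
  unfold sphereCost
  rw [← sq_abs (latitude p - latitude q)]
  gcongr

lemma latitude_of_eq_splitPt {y : ℝ} (hy : y ∈ Set.Icc 0 (Real.pi / 2))
    {u : EuclideanSpace ℝ (Fin k)} {v : EuclideanSpace ℝ (Fin l)} (hv : ‖v‖ = 1)
    {q : sphere (0 : SplitSpace k l) 1}
    (hq : (q : SplitSpace k l) = splitPt (Real.cos y • u) (Real.sin y • v)) :
    latitude q = y := by
  have hpi := Real.pi_pos
  have hs : 0 ≤ Real.sin y := Real.sin_nonneg_of_nonneg_of_le_pi hy.1 (by linarith [hy.2])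
  rw [latitude, hq]
  change Real.arcsin ‖Real.sin y • v‖ = y
  rw [norm_smul, hv, mul_one, Real.norm_of_nonneg hs,
    Real.arcsin_sin (by linarith [hy.1]) hy.2]

lemma sphereCost_of_eq_splitPt {x y : ℝ} (hxy : |x - y| ≤ Real.pi)
    {u : EuclideanSpace ℝ (Fin k)} {v : EuclideanSpace ℝ (Fin l)} (hu : ‖u‖ = 1) (hv : ‖v‖ = 1)
    {p q : sphere (0 : SplitSpace k l) 1}
    (hp : (p : SplitSpace k l) = splitPt (Real.cos x • u) (Real.sin x • v))
    (hq : (q : SplitSpace k l) = splitPt (Real.cos y • u) (Real.sin y • v)) :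
    sphereCost p q = (x - y) ^ 2 / 2 := by
  have hin : ⟪(p : SplitSpace k l), (q : SplitSpace k l)⟫_ℝ = Real.cos |x - y| := by
    rw [hp, hq, WithLp.prod_inner_apply]
    change ⟪Real.cos x • u, Real.cos y • u⟫_ℝ + ⟪Real.sin x • v, Real.sin y • v⟫_ℝ = _
    simp only [real_inner_smul_left, real_inner_smul_right, real_inner_self_eq_norm_sq, hu, hv,
      Real.cos_abs, Real.cos_sub]
    ring
  rw [sphereCost, hin, Real.arccos_cos (abs_nonneg _) hxy, sq_abs]

end Latitude

section Duality

variable {E : Type*} [NormedAddCommGroup E] [InnerProductSpace ℝ E] [FiniteDimensional ℝ E]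
  [MeasurableSpace E] [BorelSpace E]

lemma integrable_sphereCost {μ : Measure (sphere (0 : E) 1)} [IsFiniteMeasure μ]
    {F : sphere (0 : E) 1 → sphere (0 : E) 1} (hF : Measurable F) :
    Integrable (fun p => sphereCost p (F p)) μ := by
  have hm : Measurable fun p => sphereCost p (F p) := by
    have h1 : Measurable fun p : sphere (0 : E) 1 => (p : E) := measurable_subtype_coe
    have h2 : Measurable fun p : sphere (0 : E) 1 => (F p : E) := measurable_subtype_coe.comp hF
    exact ((Real.measurable_arccos.comp (h1.inner h2)).pow_const 2).div_const 2
  refine Integrable.of_bound hm.aestronglyMeasurable (Real.pi ^ 2 / 2)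
    (Filter.Eventually.of_forall fun p => ?_)
  have h0 := Real.arccos_nonneg ⟪(p : E), (F p : E)⟫_ℝ
  have h1 := Real.arccos_le_pi ⟪(p : E), (F p : E)⟫_ℝ
  rw [sphereCost, Real.norm_of_nonneg (by positivity)]
  gcongr

/-- A transport map admitting continuous dual potentials is optimal. -/
lemma integral_sphereCost_le_of_potentials {μ : Measure (sphere (0 : E) 1)} [IsFiniteMeasure μ]
    {T F : sphere (0 : E) 1 → sphere (0 : E) 1} (hT : AEMeasurable T μ) (hF : Measurable F)
    (hFT : μ.map F = μ.map T) {φ ψ : sphere (0 : E) 1 → ℝ} (hφ : Continuous φ)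
    (hψ : Continuous ψ) (hle : ∀ p q, φ p + ψ q ≤ sphereCost p q)
    (heq : ∀ p, sphereCost p (T p) = φ p + ψ (T p)) :
    ∫ p, sphereCost p (T p) ∂μ ≤ ∫ p, sphereCost p (F p) ∂μ := by
  have : ProperSpace E := FiniteDimensional.proper ℝ E
  have hint : ∀ (ν : Measure (sphere (0 : E) 1)) [IsFiniteMeasure ν]
      {χ : sphere (0 : E) 1 → ℝ}, Continuous χ → Integrable χ ν := fun ν _ χ hχ =>
    hχ.integrable_of_hasCompactSupport (HasCompactSupport.of_compactSpace χ)
  have hψT : Integrable (fun p => ψ (T p)) μ := (hint (μ.map T) hψ).comp_aemeasurable hT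
  have hψF : Integrable (fun p => ψ (F p)) μ := (hint (μ.map F) hψ).comp_measurable hF
  calc ∫ p, sphereCost p (T p) ∂μ = ∫ p, (φ p + ψ (T p)) ∂μ := by simp only [heq]
    _ = ∫ p, (φ p + ψ (F p)) ∂μ := by
      rw [integral_add (hint μ hφ) hψT, integral_add (hint μ hφ) hψF,
        ← integral_map hT hψ.aestronglyMeasurable,
        ← integral_map hF.aemeasurable hψ.aestronglyMeasurable, hFT]
    _ ≤ ∫ p, sphereCost p (F p) ∂μ :=
      integral_mono ((hint μ hφ).add hψF) (integrable_sphereCost hF) fun p => hle p (F p)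

end Duality

theorem meridian_map_optimal (k l : ℕ) (hk : 1 ≤ k) (hl : 1 ≤ l)
    [MeasurableSpace (SplitSpace k l)] [BorelSpace (SplitSpace k l)]
    (f : ℝ → ℝ) (hf : ContDiff ℝ (⊤ : ℕ∞) f) (hper : Function.Periodic f Real.pi)
    (hodd : ∀ x : ℝ, f (-x) = -f x) (hf' : ∀ x : ℝ, 0 < deriv f x + 1)
    (T : sphere (0 : SplitSpace k l) 1 → sphere (0 : SplitSpace k l) 1)
    (hT : ∀ (x : ℝ) (u : EuclideanSpace ℝ (Fin k)) (v : EuclideanSpace ℝ (Fin l)),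
      ‖u‖ = 1 → ‖v‖ = 1 → ∀ p : sphere (0 : SplitSpace k l) 1,
      (p : SplitSpace k l) = splitPt (Real.cos x • u) (Real.sin x • v) →
      (T p : SplitSpace k l) = splitPt (Real.cos (x + f x) • u) (Real.sin (x + f x) • v))
    (vol : Measure (sphere (0 : SplitSpace k l) 1))
    (hvol₀ : vol ≠ 0) (hvolfin : IsFiniteMeasure vol)
    (hvolinv : IsRotationInvariant vol) :
    ∀ F : sphere (0 : SplitSpace k l) 1 → sphere (0 : SplitSpace k l) 1,
      Measurable F → Measure.map F vol = Measure.map T vol →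
      ∫ p, sphereCost p (T p) ∂vol ≤ ∫ p, sphereCost p (F p) ∂vol := by
  intro F hF hFT
  have hTm : AEMeasurable T vol := by
    by_contra h
    rw [Measure.map_of_not_aemeasurable h, Measure.map_eq_zero_iff hF.aemeasurable] at hFT
    exact hvol₀ hFT
  have hf0 : f 0 = 0 := by
    have := hodd 0
    rw [neg_zero] at this
    linarith
  have hmono := strictMono_id_add (hf.differentiable (by simp)) hf'
  obtain ⟨φ, ψ, hφ, hψ, hle, heq⟩ := exists_potentials (g := fun x => x + f x)
    (continuous_id.add hf.continuous) hmono (surjective_id_add hf.continuous hper hf0)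
  refine integral_sphereCost_le_of_potentials hTm hF hFT (hφ.comp continuous_latitude)
    (hψ.comp continuous_latitude)
    (fun p q => (hle _ _).trans (sq_latitude_sub_le_sphereCost p q)) fun p => ?_
  obtain ⟨u, v, hu, hv, hp⟩ := exists_eq_splitPt_latitude hk hl p
  have hq := hT _ u v hu hv p hp
  have hx := latitude_mem_Icc p
  have hy : latitude p + f (latitude p) ∈ Set.Icc 0 (Real.pi / 2) := by
    have h1 := hmono.monotone hx.1
    have h2 := hmono.monotone hx.2
    simp only [hf0, hper.apply_half_period_eq_zero_of_odd hodd, add_zero] at h1 h2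
    exact ⟨h1, h2⟩
  have hxy : |latitude p - (latitude p + f (latitude p))| ≤ Real.pi :=
    abs_le.2 ⟨by linarith [hx.1, hy.2, Real.pi_pos], by linarith [hx.2, hy.1, Real.pi_pos]⟩
  rw [sphereCost_of_eq_splitPt hxy hu hv hp hq, ← heq, Function.comp_apply, Function.comp_apply,
    latitude_of_eq_splitPt hy hv hq]

end
end

section
/- Let n ≥ 1 and let g : ℝ → ℝ be a smooth 2π-periodic odd function with g'(x) + 1 > 0 for all x. Then the map T : Sⁿ → Sⁿ given by T(cos x, sin x · v) = (cos(x + g(x)), sin(x + g(x)) · v), for x ∈ ℝ and unit vectors v ∈ ℝⁿ, is well defined and is the optimal transportation map between vol and T_#(vol) for the cost c(p,q) = d(p,q)²/2; that is, for every Borel map F : Sⁿ → Sⁿ with F_#(vol) = T_#(vol) one has ∫ c(p,T(p)) dvol(p) ≤ ∫ c(p,F(p)) dvol(p). -/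
/- Godoy–Salvai, Theorem 4: for `g : ℝ → ℝ` smooth, `2π`-periodic and odd with
`g' + 1 > 0`, the map `T(cos x, sin x · v) = (cos(x+g(x)), sin(x+g(x)) · v)` of the
sphere `Sⁿ ⊆ ℝ ⊕ ℝⁿ` is well defined and is the optimal transport map (for the cost
`d²/2`) between `vol` and `T₃(vol)`. -/

open MeasureTheory Metric
open scoped InnerProductSpace

noncomputable section

/-- `ℝ^{n+1} = ℝ ⊕ ℝⁿ` with its Euclidean (ℓ²) structure. -/
abbrev AxisSpace (n : ℕ) : Type :=
  WithLp 2 (ℝ × EuclideanSpace ℝ (Fin n))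

/-- The point `(a, b)` of `ℝ ⊕ ℝⁿ`. -/
abbrev axisPt {n : ℕ} (a : ℝ) (b : EuclideanSpace ℝ (Fin n)) : AxisSpace n :=
  (WithLp.equiv 2 (ℝ × EuclideanSpace ℝ (Fin n))).symm (a, b)

/-- The Kantorovich potentials on the line for the quadratic cost: an increasing homeomorphism `f`
is the gradient of a convex function, whose Legendre transform gives the second potential. -/
theorem exists_potentials_s5 {f : ℝ → ℝ} (hf : Continuous f) (hmono : StrictMono f)
    (hsurj : Function.Surjective f) :
    ∃ a b : ℝ → ℝ, Continuous a ∧ Continuous b ∧ (∀ s t, a s + b t ≤ (s - t) ^ 2 / 2) ∧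
      ∀ s, a s + b (f s) = (s - f s) ^ 2 / 2 := by
  let e := hmono.orderIsoOfSurjective f hsurj
  let φ : ℝ → ℝ := fun s => ∫ x in (0 : ℝ)..s, f x
  have hint : ∀ a b, IntervalIntegrable f volume a b := fun a b => hf.intervalIntegrable a b
  have hφ : Continuous φ := intervalIntegral.continuous_primitive hint 0
  have tangent : ∀ u s, f u * (s - u) ≤ φ s - φ u := by
    intro u s
    have hsub : φ s - φ u = ∫ x in u..s, f x :=
      intervalIntegral.integral_interval_sub_left (hint 0 s) (hint 0 u)
    rw [hsub]
    rcases le_total u s with h | h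
    · have := intervalIntegral.integral_mono_on h (intervalIntegrable_const (c := f u)) (hint u s)
        fun x hx => hmono.monotone hx.1
      simp only [intervalIntegral.integral_const, smul_eq_mul] at this
      linarith
    · have := intervalIntegral.integral_mono_on h (hint s u) (intervalIntegrable_const (c := f u))
        fun x hx => hmono.monotone hx.2
      simp only [intervalIntegral.integral_const, smul_eq_mul] at this
      rw [intervalIntegral.integral_symm]
      linarith
  have he : Continuous e.symm := e.symm.continuous
  refine ⟨fun s => s ^ 2 / 2 - φ s, fun t => t ^ 2 / 2 - (t * e.symm t - φ (e.symm t)),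
    by fun_prop, by fun_prop, fun s t => ?_, fun s => ?_⟩
  · have h := tangent (e.symm t) s
    rw [show f (e.symm t) = t from e.apply_symm_apply t] at h
    nlinarith
  · have h : e.symm (f s) = s := e.symm_apply_apply s
    simp only [h]
    ring

/-- The colatitude of a point of the sphere, i.e. its distance to the pole `(1, 0)`. -/
def colatitude {n : ℕ} (p : sphere (0 : AxisSpace n) 1) : ℝ :=
  Real.arccos (p : AxisSpace n).fst

theorem sphere_sq_add_sq {n : ℕ} (p : sphere (0 : AxisSpace n) 1) :
    (p : AxisSpace n).fst ^ 2 + ‖(p : AxisSpace n).snd‖ ^ 2 = 1 := by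
  have h := WithLp.prod_norm_sq_eq_of_L2 (p : AxisSpace n)
  rw [mem_sphere_zero_iff_norm.mp p.2, Real.norm_eq_abs, sq_abs] at h
  linarith

theorem colatitude_mem {n : ℕ} (p : sphere (0 : AxisSpace n) 1) :
    colatitude p ∈ Set.Icc 0 Real.pi :=
  ⟨Real.arccos_nonneg _, Real.arccos_le_pi _⟩

theorem continuous_colatitude {n : ℕ} : Continuous (colatitude (n := n)) :=
  Real.continuous_arccos.comp ((WithLp.continuous_fst 2 _ _).comp continuous_subtype_val)

theorem cos_colatitude {n : ℕ} (p : sphere (0 : AxisSpace n) 1) :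
    Real.cos (colatitude p) = (p : AxisSpace n).fst := by
  have h := sphere_sq_add_sq p
  exact Real.cos_arccos (by nlinarith [sq_nonneg ‖(p : AxisSpace n).snd‖])
    (by nlinarith [sq_nonneg ‖(p : AxisSpace n).snd‖])

theorem sin_colatitude {n : ℕ} (p : sphere (0 : AxisSpace n) 1) :
    Real.sin (colatitude p) = ‖(p : AxisSpace n).snd‖ := by
  rw [colatitude, Real.sin_arccos, sub_eq_of_eq_add' (sphere_sq_add_sq p).symm,
    Real.sqrt_sq (norm_nonneg _)]

theorem sphere_inner_eq {n : ℕ} (p q : sphere (0 : AxisSpace n) 1) :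
    ⟪(p : AxisSpace n), (q : AxisSpace n)⟫_ℝ = (p : AxisSpace n).fst * (q : AxisSpace n).fst
      + ⟪(p : AxisSpace n).snd, (q : AxisSpace n).snd⟫_ℝ := by
  rw [WithLp.prod_inner_apply, mul_comm]
  rfl

theorem arccos_cos_sub {s t : ℝ} (hs : s ∈ Set.Icc 0 Real.pi) (ht : t ∈ Set.Icc 0 Real.pi) :
    Real.arccos (Real.cos (s - t)) = |s - t| := by
  rw [← Real.cos_abs, Real.arccos_cos (abs_nonneg _)]
  rw [abs_le]
  constructor <;> linarith [hs.1, hs.2, ht.1, ht.2]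

theorem sq_colatitude_sub_le_sphereCost {n : ℕ} (p q : sphere (0 : AxisSpace n) 1) :
    (colatitude p - colatitude q) ^ 2 / 2 ≤ sphereCost p q := by
  have h : |colatitude p - colatitude q| ≤ Real.arccos ⟪(p : AxisSpace n), (q : AxisSpace n)⟫_ℝ := by
    rw [← arccos_cos_sub (colatitude_mem p) (colatitude_mem q)]
    apply Real.arccos_le_arccos
    rw [sphere_inner_eq, Real.cos_sub, cos_colatitude, cos_colatitude, sin_colatitude,
      sin_colatitude]
    gcongr
    exact real_inner_le_norm _ _
  rw [sphereCost, ← sq_abs (colatitude p - colatitude q)]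
  gcongr

theorem sin_div_sin_mul {f : ℝ → ℝ} (h0 : f 0 = 0) (hpi : f Real.pi = Real.pi) {y : ℝ}
    (hy : y ∈ Set.Icc 0 Real.pi) :
    Real.sin (f y) / Real.sin y * Real.sin y = Real.sin (f y) := by
  apply div_mul_cancel_of_imp
  intro h
  rcases hy.1.eq_or_lt with rfl | hy0
  · simp [h0]
  rcases hy.2.eq_or_lt with rfl | hy1
  · simp [hpi]
  · exact absurd h (Real.sin_pos_of_pos_of_lt_pi hy0 hy1).ne'

theorem monotone_mem_Icc_pi {f : ℝ → ℝ} (h0 : f 0 = 0) (hpi : f Real.pi = Real.pi)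
    (hmono : Monotone f) {y : ℝ} (hy : y ∈ Set.Icc 0 Real.pi) : f y ∈ Set.Icc 0 Real.pi :=
  ⟨h0.symm.trans_le (hmono hy.1), (hmono hy.2).trans_eq hpi⟩

/-- The map of the sphere that moves every point along its meridian, changing the colatitude
from `y` to `f y`. -/
def meridianMap {n : ℕ} (f : ℝ → ℝ) (h0 : f 0 = 0) (hpi : f Real.pi = Real.pi)
    (p : sphere (0 : AxisSpace n) 1) : sphere (0 : AxisSpace n) 1 :=
  ⟨axisPt (Real.cos (f (colatitude p)))
    ((Real.sin (f (colatitude p)) / Real.sin (colatitude p)) • (p : AxisSpace n).snd), by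
    rw [mem_sphere_zero_iff_norm, ← sq_eq_sq₀ (norm_nonneg _) zero_le_one,
      WithLp.prod_norm_sq_eq_of_L2]
    change ‖Real.cos (f (colatitude p))‖ ^ 2
      + ‖(Real.sin (f (colatitude p)) / Real.sin (colatitude p)) • (p : AxisSpace n).snd‖ ^ 2 = _
    rw [norm_smul, ← sin_colatitude, mul_pow, Real.norm_eq_abs, Real.norm_eq_abs, sq_abs, sq_abs,
      ← mul_pow, sin_div_sin_mul h0 hpi (colatitude_mem p), Real.cos_sq_add_sin_sq, one_pow]⟩

section meridianMap

variable {n : ℕ} {f : ℝ → ℝ} (h0 : f 0 = 0) (hpi : f Real.pi = Real.pi)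

theorem measurable_meridianMap [MeasurableSpace (AxisSpace n)] [BorelSpace (AxisSpace n)]
    (hf : Continuous f) : Measurable (meridianMap (n := n) f h0 hpi) := by
  have hc : Measurable (colatitude (n := n)) := continuous_colatitude.measurable
  have hsnd : Measurable fun p : sphere (0 : AxisSpace n) 1 => (p : AxisSpace n).snd :=
    ((WithLp.continuous_snd 2 _ _).comp continuous_subtype_val).measurable
  have hfc : Measurable fun p : sphere (0 : AxisSpace n) 1 => f (colatitude p) :=
    hf.measurable.comp hc
  refine Measurable.subtype_mk ?_
  exact (WithLp.prod_continuous_toLp 2 ℝ (EuclideanSpace ℝ (Fin n))).measurable.comp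
    ((Real.measurable_cos.comp hfc).prodMk
      (((Real.measurable_sin.comp hfc).div (Real.measurable_sin.comp hc)).smul hsnd))

theorem meridianMap_fst (p : sphere (0 : AxisSpace n) 1) :
    (meridianMap f h0 hpi p : AxisSpace n).fst = Real.cos (f (colatitude p)) :=
  rfl

theorem meridianMap_snd (p : sphere (0 : AxisSpace n) 1) :
    (meridianMap f h0 hpi p : AxisSpace n).snd =
      (Real.sin (f (colatitude p)) / Real.sin (colatitude p)) • (p : AxisSpace n).snd :=
  rfl

theorem colatitude_meridianMap (hmono : Monotone f) (p : sphere (0 : AxisSpace n) 1) :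
    colatitude (meridianMap f h0 hpi p) = f (colatitude p) := by
  have h := monotone_mem_Icc_pi h0 hpi hmono (colatitude_mem p)
  rw [colatitude, meridianMap_fst, Real.arccos_cos h.1 h.2]

theorem sphereCost_meridianMap (hmono : Monotone f) (p : sphere (0 : AxisSpace n) 1) :
    sphereCost p (meridianMap f h0 hpi p) = (colatitude p - f (colatitude p)) ^ 2 / 2 := by
  have h := monotone_mem_Icc_pi h0 hpi hmono (colatitude_mem p)
  have hs := sin_div_sin_mul h0 hpi (colatitude_mem p)
  rw [sphereCost, sphere_inner_eq, meridianMap_fst, meridianMap_snd, real_inner_smul_right,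
    real_inner_self_eq_norm_sq, ← sin_colatitude, sq (Real.sin _), ← mul_assoc, hs,
    ← cos_colatitude p, mul_comm (Real.sin (f _)), ← Real.cos_sub,
    arccos_cos_sub (colatitude_mem p) h, sq_abs]

/-- A map moving points monotonically along meridians is optimal for the quadratic cost, with
respect to any finite measure. -/
theorem integral_sphereCost_meridianMap_le [MeasurableSpace (AxisSpace n)]
    [BorelSpace (AxisSpace n)] (hf : Continuous f) (hmono : StrictMono f)
    (hsurj : Function.Surjective f) (μ : Measure (sphere (0 : AxisSpace n) 1)) [IsFiniteMeasure μ]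
    {F : sphere (0 : AxisSpace n) 1 → sphere (0 : AxisSpace n) 1} (hF : Measurable F)
    (hmap : μ.map F = μ.map (meridianMap f h0 hpi)) :
    ∫ p, sphereCost p (meridianMap f h0 hpi p) ∂μ ≤ ∫ p, sphereCost p (F p) ∂μ := by
  obtain ⟨a, b, ha, hb, hab, heq⟩ := exists_potentials_s5 hf hmono hsurj
  have hT := measurable_meridianMap (n := n) h0 hpi hf
  have integrable_comp : ∀ {G : sphere (0 : AxisSpace n) 1 → sphere (0 : AxisSpace n) 1}
      {u : ℝ → ℝ}, Measurable G → Continuous u →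
      Integrable (fun p => u (colatitude (G p))) μ := by
    intro G u hG hu
    obtain ⟨C, hC⟩ := (isCompact_Icc (a := (0 : ℝ)) (b := Real.pi)).exists_bound_of_continuousOn
      hu.continuousOn
    exact Integrable.of_bound
      ((hu.comp continuous_colatitude).measurable.comp hG).aestronglyMeasurable C
      (.of_forall fun p => hC _ (colatitude_mem _))
  have integral_map_comp : ∀ {G : sphere (0 : AxisSpace n) 1 → sphere (0 : AxisSpace n) 1},
      Measurable G → ∫ q, b (colatitude q) ∂(μ.map G) = ∫ p, b (colatitude (G p)) ∂μ :=
    fun hG => integral_map hG.aemeasurable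
      (hb.comp continuous_colatitude).measurable.aestronglyMeasurable
  have hcost : Integrable (fun p => sphereCost p (F p)) μ := by
    have hmeas : Measurable fun p => sphereCost p (F p) := by
      have hinner : Measurable fun p : sphere (0 : AxisSpace n) 1 => ⟪(p : AxisSpace n), (F p : AxisSpace n)⟫_ℝ :=
        measurable_subtype_coe.inner (measurable_subtype_coe.comp hF)
      exact ((Real.continuous_arccos.measurable.comp hinner).pow_const 2).div_const 2
    refine Integrable.of_bound hmeas.aestronglyMeasurable (Real.pi ^ 2 / 2) (.of_forall fun p => ?_)
    rw [Real.norm_eq_abs, sphereCost, abs_of_nonneg (by positivity)]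
    have h1 := Real.arccos_nonneg ⟪(p : AxisSpace n), (F p : AxisSpace n)⟫_ℝ
    have h2 := Real.arccos_le_pi ⟪(p : AxisSpace n), (F p : AxisSpace n)⟫_ℝ
    gcongr
  have ha' : Integrable (fun p => a (colatitude p)) μ := integrable_comp measurable_id ha
  calc ∫ p, sphereCost p (meridianMap f h0 hpi p) ∂μ
      = ∫ p, (a (colatitude p) + b (colatitude (meridianMap f h0 hpi p))) ∂μ := by
        simp only [sphereCost_meridianMap h0 hpi hmono.monotone,
          colatitude_meridianMap h0 hpi hmono.monotone, heq]
    _ = ∫ p, (a (colatitude p) + b (colatitude (F p))) ∂μ := by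
        rw [integral_add ha' (integrable_comp hT hb),
          integral_add ha' (integrable_comp hF hb),
          ← integral_map_comp hT, ← integral_map_comp hF, hmap]
    _ ≤ ∫ p, sphereCost p (F p) ∂μ :=
        integral_mono (ha'.add (integrable_comp hF hb)) hcost
          fun p => (hab _ _).trans (sq_colatitude_sub_le_sphereCost p (F p))

end meridianMap

/-- A periodic continuous perturbation of the identity of the line is surjective. -/
theorem surjective_id_add_periodic {g : ℝ → ℝ} {c : ℝ} (hc : 0 < c) (hg : Continuous g)
    (hper : Function.Periodic g c) : Function.Surjective fun x => x + g x := by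
  intro t
  obtain ⟨k, hk⟩ := exists_nat_ge (|t - g 0| / c)
  rw [div_le_iff₀ hc, abs_le] at hk
  have h1 : g (k * c) = g 0 := hper.nat_mul_eq k
  have h2 : g (-(k * c)) = g 0 := by simpa using hper.neg_nat_mul k 0
  have hle : -(k * c) ≤ (k * c : ℝ) := by linarith
  obtain ⟨x, -, hx⟩ := intermediate_value_Icc hle (continuous_id.add hg).continuousOn
    (show t ∈ Set.Icc _ _ from ⟨by simp only [id, Pi.add_apply, h2]; linarith,
      by simp only [id, Pi.add_apply, h1]; linarith⟩)
  exact ⟨x, hx⟩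

theorem meridianMap_apply {n : ℕ} {g : ℝ → ℝ} (hper : Function.Periodic g (2 * Real.pi))
    (hodd : ∀ x : ℝ, g (-x) = -g x) (h0 : 0 + g 0 = 0) (hpi : Real.pi + g Real.pi = Real.pi)
    (x : ℝ) (v : EuclideanSpace ℝ (Fin n)) (p : sphere (0 : AxisSpace n) 1)
    (hp : (p : AxisSpace n) = axisPt (Real.cos x) (Real.sin x • v)) :
    (meridianMap (fun x => x + g x) h0 hpi p : AxisSpace n) =
      axisPt (Real.cos (x + g x)) (Real.sin (x + g x) • v) := by
  have hsnd : (p : AxisSpace n).snd = Real.sin x • v := by rw [hp]; rfl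
  have hcos : Real.cos (colatitude p) = Real.cos x := by rw [cos_colatitude, hp]; rfl
  have hsin := sin_div_sin_mul (f := fun x => x + g x) h0 hpi (colatitude_mem p)
  change axisPt _ _ = _
  rw [hsnd, smul_smul]
  obtain ⟨k, hk | hk⟩ := Real.cos_eq_cos_iff.mp hcos
  · have hgx : g x = g (colatitude p) := by
      rw [hk, add_comm, show (2 * k * Real.pi : ℝ) = k * (2 * Real.pi) by ring]
      exact hper.int_mul k _
    have hx : x + g x = colatitude p + g (colatitude p) + k * (2 * Real.pi) := by
      rw [hgx, hk]; ring
    have hsx : Real.sin x = Real.sin (colatitude p) := by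
      rw [hk, add_comm, show (2 * k * Real.pi : ℝ) = k * (2 * Real.pi) by ring,
        Real.sin_add_int_mul_two_pi]
    rw [hx, Real.cos_add_int_mul_two_pi, Real.sin_add_int_mul_two_pi, hsx, hsin]
  · have hgx : g x = -g (colatitude p) := by
      rw [← hodd, hk, sub_eq_neg_add, show (2 * k * Real.pi : ℝ) = k * (2 * Real.pi) by ring]
      exact hper.int_mul k _
    have hx : x + g x = k * (2 * Real.pi) - (colatitude p + g (colatitude p)) := by
      rw [hgx, hk]; ring
    have hsx : Real.sin x = -Real.sin (colatitude p) := by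
      rw [hk, show (2 * k * Real.pi : ℝ) = k * (2 * Real.pi) by ring,
        Real.sin_int_mul_two_pi_sub]
    rw [hx, Real.cos_int_mul_two_pi_sub, Real.sin_int_mul_two_pi_sub, hsx, mul_neg, hsin]

theorem conformal_model_map_well_defined_and_optimal (n : ℕ) (hn : 1 ≤ n)
    [MeasurableSpace (AxisSpace n)] [BorelSpace (AxisSpace n)]
    (g : ℝ → ℝ) (hg : ContDiff ℝ (⊤ : ℕ∞) g) (hper : Function.Periodic g (2 * Real.pi))
    (hodd : ∀ x : ℝ, g (-x) = -g x) (hg' : ∀ x : ℝ, 0 < deriv g x + 1)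
    (vol : Measure (sphere (0 : AxisSpace n) 1))
    (hvol₀ : vol ≠ 0) (hvolfin : IsFiniteMeasure vol)
    (hvolinv : IsRotationInvariant vol) :
    ∃ T : sphere (0 : AxisSpace n) 1 → sphere (0 : AxisSpace n) 1,
      (∀ (x : ℝ) (v : EuclideanSpace ℝ (Fin n)), ‖v‖ = 1 →
        ∀ p : sphere (0 : AxisSpace n) 1,
        (p : AxisSpace n) = axisPt (Real.cos x) (Real.sin x • v) →
        (T p : AxisSpace n) = axisPt (Real.cos (x + g x)) (Real.sin (x + g x) • v)) ∧
      ∀ F : sphere (0 : AxisSpace n) 1 → sphere (0 : AxisSpace n) 1,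
        Measurable F → Measure.map F vol = Measure.map T vol →
        ∫ p, sphereCost p (T p) ∂vol ≤ ∫ p, sphereCost p (F p) ∂vol := by
  have hg0 : g 0 = 0 := by
    have h := hodd 0
    rw [neg_zero] at h
    linarith
  have hgpi : g Real.pi = 0 := by
    have h := hper (-Real.pi)
    rw [show -Real.pi + 2 * Real.pi = Real.pi by ring, hodd] at h
    linarith
  have h0 : 0 + g 0 = 0 := by rw [hg0, add_zero]
  have hpi : Real.pi + g Real.pi = Real.pi := by rw [hgpi, add_zero]
  have hmono : StrictMono fun x => x + g x := by
    refine strictMono_of_deriv_pos fun x => ?_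
    have hd : HasDerivAt (fun x => x + g x) (1 + deriv g x) x :=
      (hasDerivAt_id x).add (hg.differentiable (by simp) x).hasDerivAt
    rw [hd.deriv, add_comm]
    exact hg' x
  refine ⟨meridianMap (fun x => x + g x) h0 hpi,
    fun x v _ p hp => meridianMap_apply hper hodd h0 hpi x v p hp, fun F hF hmap => ?_⟩
  exact integral_sphereCost_meridianMap_le h0 hpi (continuous_id.add hg.continuous) hmono
    (surjective_id_add_periodic Real.two_pi_pos hg.continuous hper) vol hF hmap

end
end

section
/- Let f : ℝ → ℝ be a continuous π-periodic odd function and write ℝ^{n+1} = ℝᵏ ⊕ ℝˡ with k, ℓ ≥ 1. Then the function φ : Sⁿ → ℝ given by φ(cos x · u, sin x · v) = ∫₀ˣ f(s) ds, for x ∈ ℝ and unit vectors u ∈ ℝᵏ, v ∈ ℝˡ, is well defined (it does not depend on the representation of the point), and if f is moreover smooth then at every p = (cos x · u, sin x · v) the gradient of φ (with respect to the round metric on Sⁿ) satisfies grad_p φ = f(x)·(−sin x · u, cos x · v). -/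
/- Godoy–Salvai, proof of Theorem 3: the potential `φ(cos x · u, sin x · v) = ∫₀ˣ f(s) ds`
is well defined on the sphere `Sⁿ ⊆ ℝᵏ ⊕ ℝˡ` for `f` continuous, `π`-periodic and odd,
and if `f` is smooth its gradient (w.r.t. the round metric) at `p = (cos x · u, sin x · v)`
is `f(x)·(−sin x · u, cos x · v)`. The gradient is characterized as the tangent vector `G`
at `p` (i.e. `G ⊥ p`) such that `(φ ∘ γ)'(0) = ⟪G, γ'(0)⟫` for every differentiable
curve `γ` on the sphere through `p`. -/

open Metric
open scoped InnerProductSpace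

noncomputable section

section Primitive

variable {f : ℝ → ℝ}

theorem primitive_neg (hodd : ∀ x, f (-x) = -f x) (x : ℝ) :
    ∫ s in (0 : ℝ)..(-x), f s = ∫ s in (0 : ℝ)..x, f s := by
  have h := intervalIntegral.integral_comp_neg (a := 0) (b := x) f
  simp only [hodd, intervalIntegral.integral_neg, neg_zero] at h
  rw [intervalIntegral.integral_symm, ← h, neg_neg]

theorem primitive_periodic (hf : Continuous f) (hper : Function.Periodic f Real.pi)
    (hodd : ∀ x, f (-x) = -f x) :
    Function.Periodic (fun x => ∫ s in (0 : ℝ)..x, f s) Real.pi := by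
  intro x
  have hint (a b : ℝ) : IntervalIntegrable f MeasureTheory.volume a b := hf.intervalIntegrable a b
  have h := hper.intervalIntegral_add_eq x (-(Real.pi / 2))
  have h1 := intervalIntegral.integral_interval_sub_left (hint 0 (x + Real.pi)) (hint 0 x)
  have h2 := intervalIntegral.integral_interval_sub_left (hint 0 (Real.pi / 2))
    (hint 0 (-(Real.pi / 2)))
  rw [primitive_neg hodd, sub_self] at h2
  rw [show -(Real.pi / 2) + Real.pi = Real.pi / 2 by ring] at h
  simp only
  linarith

theorem eq_add_or_eq_sub_of_cos_two_mul_eq {x y : ℝ} (h : Real.cos (2 * x) = Real.cos (2 * y)) :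
    ∃ n : ℤ, y = x + n * Real.pi ∨ y = -x + n * Real.pi := by
  obtain ⟨n, hn | hn⟩ := Real.cos_eq_cos_iff.1 h
  · exact ⟨n, Or.inl (by linarith)⟩
  · exact ⟨n, Or.inr (by linarith)⟩

theorem primitive_eq_of_cos_two_mul_eq (hf : Continuous f) (hper : Function.Periodic f Real.pi)
    (hodd : ∀ x, f (-x) = -f x) {x y : ℝ} (h : Real.cos (2 * x) = Real.cos (2 * y)) :
    ∫ s in (0 : ℝ)..x, f s = ∫ s in (0 : ℝ)..y, f s := by
  have hF := primitive_periodic hf hper hodd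
  obtain ⟨n, rfl | rfl⟩ := eq_add_or_eq_sub_of_cos_two_mul_eq h
  · exact (hF.int_mul n x).symm
  · exact ((hF.int_mul n (-x)).trans (primitive_neg hodd x)).symm

theorem mul_sin_two_mul_eq_of_cos_two_mul_eq (hper : Function.Periodic f Real.pi)
    (hodd : ∀ x, f (-x) = -f x) {x y : ℝ} (h : Real.cos (2 * x) = Real.cos (2 * y)) :
    f y * Real.sin (2 * x) = f x * Real.sin (2 * y) := by
  obtain ⟨n, rfl | rfl⟩ := eq_add_or_eq_sub_of_cos_two_mul_eq h
  · rw [hper.int_mul n x, show 2 * (x + n * Real.pi) = 2 * x + n * (2 * Real.pi) by ring,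
      Real.sin_add_int_mul_two_pi]
  · rw [hper.int_mul n (-x), hodd, show 2 * (-x + n * Real.pi) = -(2 * x) + n * (2 * Real.pi) by ring,
      Real.sin_add_int_mul_two_pi, Real.sin_neg]
    ring

theorem eq_zero_of_sin_two_mul_eq_zero (hper : Function.Periodic f Real.pi)
    (hodd : ∀ x, f (-x) = -f x) {x : ℝ} (h : Real.sin (2 * x) = 0) : f x = 0 := by
  obtain ⟨n, hn⟩ := Real.sin_eq_zero_iff.1 h
  have h1 := hper.int_mul n (-x)
  rw [show -x + n * Real.pi = x by linarith, hodd] at h1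
  linarith

theorem hasDerivAt_primitive (hf : Continuous f) (x : ℝ) :
    HasDerivAt (fun x => ∫ s in (0 : ℝ)..x, f s) (f x) x :=
  intervalIntegral.integral_hasDerivAt_right (hf.intervalIntegrable _ _)
    (hf.stronglyMeasurableAtFilter _ _) hf.continuousAt

theorem cos_two_mul_arccos_half {x : ℝ} :
    Real.cos (2 * (Real.arccos (Real.cos (2 * x)) / 2)) = Real.cos (2 * x) := by
  rw [mul_div_cancel₀ _ two_ne_zero, Real.cos_arccos (Real.neg_one_le_cos _) (Real.cos_le_one _)]

theorem hasDerivAt_primitive_arccos (hf : Continuous f) (hper : Function.Periodic f Real.pi)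
    (hodd : ∀ x, f (-x) = -f x) {x : ℝ} (h : Real.sin (2 * x) ≠ 0) :
    HasDerivAt (fun c => ∫ s in (0 : ℝ)..(Real.arccos c / 2), f s)
      (-f x / (2 * Real.sin (2 * x))) (Real.cos (2 * x)) := by
  have hsq := Real.sin_sq_add_cos_sq (2 * x)
  have hpos : 0 < Real.sin (2 * x) ^ 2 := by positivity
  have h1 : Real.cos (2 * x) ≠ -1 := by
    intro h1
    rw [h1] at hsq
    linarith
  have h2 : Real.cos (2 * x) ≠ 1 := by
    intro h2
    rw [h2] at hsq
    linarith
  have hc := (hasDerivAt_primitive hf _).comp _ ((Real.hasDerivAt_arccos h1 h2).div_const 2)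
  refine hc.congr_deriv ?_
  have hs := mul_sin_two_mul_eq_of_cos_two_mul_eq hper hodd (cos_two_mul_arccos_half (x := x)).symm
  rw [mul_div_cancel₀ _ two_ne_zero, Real.sin_arccos] at hs
  have hr : √(1 - Real.cos (2 * x) ^ 2) ≠ 0 := by
    rw [show 1 - Real.cos (2 * x) ^ 2 = Real.sin (2 * x) ^ 2 by linarith]
    exact (Real.sqrt_pos.2 hpos).ne'
  field_simp
  linarith

end Primitive

section Sphere

variable {k l : ℕ}

theorem norm_fst_splitPt_sq (x : ℝ) {u : EuclideanSpace ℝ (Fin k)} (v : EuclideanSpace ℝ (Fin l))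
    (hu : ‖u‖ = 1) :
    ‖(splitPt (Real.cos x • u) (Real.sin x • v)).fst‖ ^ 2 = Real.cos x ^ 2 := by
  change ‖Real.cos x • u‖ ^ 2 = _
  simp [norm_smul, hu]

theorem norm_snd_splitPt_sq (x : ℝ) (u : EuclideanSpace ℝ (Fin k)) {v : EuclideanSpace ℝ (Fin l)}
    (hv : ‖v‖ = 1) :
    ‖(splitPt (Real.cos x • u) (Real.sin x • v)).snd‖ ^ 2 = Real.sin x ^ 2 := by
  change ‖Real.sin x • v‖ ^ 2 = _
  simp [norm_smul, hv]

theorem cos_two_mul_eq_norm_sq_sub (x : ℝ) {u : EuclideanSpace ℝ (Fin k)}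
    {v : EuclideanSpace ℝ (Fin l)} (hu : ‖u‖ = 1) (hv : ‖v‖ = 1) :
    ‖(splitPt (Real.cos x • u) (Real.sin x • v)).fst‖ ^ 2
      - ‖(splitPt (Real.cos x • u) (Real.sin x • v)).snd‖ ^ 2 = Real.cos (2 * x) := by
  rw [norm_fst_splitPt_sq x v hu, norm_snd_splitPt_sq x u hv, Real.cos_two_mul']

theorem exists_unit_smul_eq {m : ℕ} (hm : 1 ≤ m) (a : EuclideanSpace ℝ (Fin m)) :
    ∃ u : EuclideanSpace ℝ (Fin m), ‖u‖ = 1 ∧ ‖a‖ • u = a := by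
  rcases eq_or_ne a 0 with rfl | ha
  · exact ⟨EuclideanSpace.single ⟨0, hm⟩ 1, by simp, by simp⟩
  · exact ⟨‖a‖⁻¹ • a, norm_smul_inv_norm ha, smul_inv_smul₀ (norm_ne_zero_iff.2 ha) a⟩

theorem exists_polar (hk : 1 ≤ k) (hl : 1 ≤ l) (p : SplitSpace k l) (hp : ‖p‖ = 1) :
    ∃ y ∈ Set.Icc 0 (Real.pi / 2), Real.cos y = ‖p.fst‖ ∧ Real.sin y = ‖p.snd‖ ∧
      ∃ (u : EuclideanSpace ℝ (Fin k)) (v : EuclideanSpace ℝ (Fin l)), ‖u‖ = 1 ∧ ‖v‖ = 1 ∧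
        splitPt (Real.cos y • u) (Real.sin y • v) = p := by
  obtain ⟨u, hu, hua⟩ := exists_unit_smul_eq hk p.fst
  obtain ⟨v, hv, hvb⟩ := exists_unit_smul_eq hl p.snd
  have hsq := WithLp.prod_norm_sq_eq_of_L2 p
  rw [hp] at hsq
  have ha : ‖p.fst‖ ≤ 1 := (WithLp.norm_fst_le (p := 2) _ p).trans hp.le
  have hc : Real.cos (Real.arccos ‖p.fst‖) = ‖p.fst‖ :=
    Real.cos_arccos (by linarith [norm_nonneg p.fst]) ha
  have hs : Real.sin (Real.arccos ‖p.fst‖) = ‖p.snd‖ := by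
    rw [Real.sin_arccos, show 1 - ‖p.fst‖ ^ 2 = ‖p.snd‖ ^ 2 by linarith,
      Real.sqrt_sq (norm_nonneg _)]
  refine ⟨Real.arccos ‖p.fst‖, ⟨Real.arccos_nonneg _, Real.arccos_le_pi_div_two.2 (norm_nonneg _)⟩,
    hc, hs, u, v, hu, hv, ?_⟩
  rw [hc, hs, hua, hvb]
  rfl

theorem le_pi_div_two_mul_sin {y : ℝ} (hy : y ∈ Set.Icc 0 (Real.pi / 2)) :
    y ≤ Real.pi / 2 * Real.sin y := by
  have h := mul_le_mul_of_nonneg_left (Real.mul_le_sin hy.1 hy.2) Real.pi_div_two_pos.le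
  have h2 : Real.pi / 2 * (2 / Real.pi * y) = y := by field_simp
  linarith

theorem abs_sub_le_of_polar_of_sin_two_mul_eq_zero {E F : Type*} [NormedAddCommGroup E]
    [NormedAddCommGroup F] {p q : WithLp 2 (E × F)} {y z : ℝ}
    (hy : y ∈ Set.Icc 0 (Real.pi / 2)) (hz : z ∈ Set.Icc 0 (Real.pi / 2))
    (hyc : Real.cos y = ‖p.fst‖) (hys : Real.sin y = ‖p.snd‖)
    (hzc : Real.cos z = ‖q.fst‖) (hzs : Real.sin z = ‖q.snd‖) (h : Real.sin (2 * z) = 0) :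
    |y - z| ≤ Real.pi / 2 * ‖p - q‖ := by
  have hpi := Real.pi_div_two_pos
  have h' : Real.sin z = 0 ∨ Real.cos z = 0 := by
    rw [Real.sin_two_mul] at h
    simpa using h
  rcases h' with h' | h'
  · have hz0 : z = 0 := le_antisymm (by simpa [h'] using le_pi_div_two_mul_sin hz) hz.1
    have hq : q.snd = 0 := norm_eq_zero.1 (by rw [← hzs, h'])
    have hn := WithLp.norm_snd_le (p := 2) _ (p - q)
    rw [WithLp.sub_snd, hq, sub_zero, ← hys] at hn
    rw [hz0, sub_zero, abs_of_nonneg hy.1]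
    exact (le_pi_div_two_mul_sin hy).trans (mul_le_mul_of_nonneg_left hn hpi.le)
  · have key {w : ℝ} (hw : w ∈ Set.Icc 0 (Real.pi / 2)) :
        Real.pi / 2 - w ≤ Real.pi / 2 * Real.cos w := by
      have := le_pi_div_two_mul_sin (y := Real.pi / 2 - w) ⟨by linarith [hw.2], by linarith [hw.1]⟩
      rwa [Real.sin_pi_div_two_sub] at this
    have hz0 : z = Real.pi / 2 := by
      have := key hz
      rw [h', mul_zero] at this
      exact le_antisymm hz.2 (by linarith)
    have hq : q.fst = 0 := norm_eq_zero.1 (by rw [← hzc, h'])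
    have hn := WithLp.norm_fst_le (p := 2) _ (p - q)
    rw [WithLp.sub_fst, hq, sub_zero, ← hyc] at hn
    rw [hz0, abs_sub_comm, abs_of_nonneg (by linarith [hy.2])]
    exact (key hy).trans (mul_le_mul_of_nonneg_left hn hpi.le)

end Sphere

section Curve

variable {E F : Type*} [NormedAddCommGroup E] [InnerProductSpace ℝ E]
  [NormedAddCommGroup F] [InnerProductSpace ℝ F]
  {γ : ℝ → WithLp 2 (E × F)} {γ' : WithLp 2 (E × F)} {t : ℝ} {f y : ℝ → ℝ}

theorem inner_deriv_eq_zero_of_norm_eq_one (hγ : ∀ s, ‖γ s‖ = 1) (h : HasDerivAt γ γ' t) :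
    ⟪γ t, γ'⟫_ℝ = 0 := by
  have h1 := h.norm_sq
  simp only [hγ] at h1
  have := h1.unique (hasDerivAt_const t _)
  linarith

/-- The potential has zero derivative along curves through the singular orbits. -/
theorem hasDerivAt_primitive_polar_of_sin_two_mul_eq_zero (hf : Continuous f)
    (hper : Function.Periodic f Real.pi) (hodd : ∀ x, f (-x) = -f x) (h : HasDerivAt γ γ' t)
    (hy : ∀ s, y s ∈ Set.Icc 0 (Real.pi / 2)) (hyc : ∀ s, Real.cos (y s) = ‖(γ s).fst‖)
    (hys : ∀ s, Real.sin (y s) = ‖(γ s).snd‖) (hsin : Real.sin (2 * y t) = 0) :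
    HasDerivAt (fun s => ∫ r in (0 : ℝ)..y s, f r) 0 t := by
  have hO : (fun s => y s - y t) =O[nhds t] fun s => s - t :=
    (Asymptotics.IsBigO.of_bound (Real.pi / 2) (.of_forall fun s =>
      abs_sub_le_of_polar_of_sin_two_mul_eq_zero (hy s) (hy t) (hyc s) (hys s) (hyc t) (hys t)
        hsin)).trans h.isBigO_sub
  have hlim : Filter.Tendsto y (nhds t) (nhds (y t)) := by
    rw [← tendsto_sub_nhds_zero_iff]
    refine hO.trans_tendsto ?_
    rw [tendsto_sub_nhds_zero_iff]
    exact Filter.tendsto_id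
  have hF := (hasDerivAt_primitive hf (y t)).isLittleO
  rw [eq_zero_of_sin_two_mul_eq_zero hper hodd hsin] at hF
  rw [hasDerivAt_iff_isLittleO]
  simpa [Function.comp_def] using (hF.comp_tendsto hlim).trans_isBigO hO

theorem hasDerivAt_primitive_polar_of_sin_two_mul_ne_zero (hf : Continuous f)
    (hper : Function.Periodic f Real.pi) (hodd : ∀ x, f (-x) = -f x) (h : HasDerivAt γ γ' t)
    (hy : ∀ s, Real.cos (2 * y s) = ‖(γ s).fst‖ ^ 2 - ‖(γ s).snd‖ ^ 2) {x : ℝ}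
    (hx : Real.cos (2 * x) = ‖(γ t).fst‖ ^ 2 - ‖(γ t).snd‖ ^ 2) (hsin : Real.sin (2 * x) ≠ 0) :
    HasDerivAt (fun s => ∫ r in (0 : ℝ)..y s, f r)
      (-f x / (2 * Real.sin (2 * x)) * (2 * ⟪(γ t).fst, γ'.fst⟫_ℝ - 2 * ⟪(γ t).snd, γ'.snd⟫_ℝ))
      t := by
  have heq : (fun s => ∫ r in (0 : ℝ)..y s, f r) = fun s =>
      ∫ r in (0 : ℝ)..(Real.arccos (‖(γ s).fst‖ ^ 2 - ‖(γ s).snd‖ ^ 2) / 2), f r := by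
    funext s
    rw [← hy s]
    exact primitive_eq_of_cos_two_mul_eq hf hper hodd cos_two_mul_arccos_half.symm
  have hfst : HasDerivAt (fun s => (γ s).fst) γ'.fst t :=
    (WithLp.fstL 2 ℝ E F).hasFDerivAt.comp_hasDerivAt t h
  have hsnd : HasDerivAt (fun s => (γ s).snd) γ'.snd t :=
    (WithLp.sndL 2 ℝ E F).hasFDerivAt.comp_hasDerivAt t h
  have hF := hasDerivAt_primitive_arccos hf hper hodd hsin
  rw [hx] at hF
  rw [heq]
  exact hF.comp t (hfst.norm_sq.sub hsnd.norm_sq)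

/-- At a point with polar angle `x`, the derivative is the pairing of the velocity with
`f(x)·(−sin x · u, cos x · v)`. -/
theorem hasDerivAt_primitive_polar (hf : Continuous f) (hper : Function.Periodic f Real.pi)
    (hodd : ∀ x, f (-x) = -f x) (hγ : ∀ s, ‖γ s‖ = 1) (h : HasDerivAt γ γ' t)
    (hy : ∀ s, y s ∈ Set.Icc 0 (Real.pi / 2)) (hyc : ∀ s, Real.cos (y s) = ‖(γ s).fst‖)
    (hys : ∀ s, Real.sin (y s) = ‖(γ s).snd‖) {x : ℝ} {u : E} {v : F} (hu : ‖u‖ = 1)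
    (hv : ‖v‖ = 1) (hfst : (γ t).fst = Real.cos x • u) (hsnd : (γ t).snd = Real.sin x • v) :
    HasDerivAt (fun s => ∫ r in (0 : ℝ)..y s, f r)
      (f x * (-Real.sin x * ⟪u, γ'.fst⟫_ℝ + Real.cos x * ⟪v, γ'.snd⟫_ℝ)) t := by
  rcases eq_or_ne (Real.sin (2 * x)) 0 with hs | hs
  · have hsin : Real.sin (2 * y t) = 0 := by
      rw [Real.sin_two_mul] at hs ⊢
      rw [hyc, hys, hfst, hsnd, norm_smul, norm_smul, hu, hv]
      simpa [or_comm] using hs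
    rw [eq_zero_of_sin_two_mul_eq_zero hper hodd hs, zero_mul]
    exact hasDerivAt_primitive_polar_of_sin_two_mul_eq_zero hf hper hodd h hy hyc hys hsin
  · have htan := inner_deriv_eq_zero_of_norm_eq_one hγ h
    have hcos (s : ℝ) : Real.cos (2 * y s) = ‖(γ s).fst‖ ^ 2 - ‖(γ s).snd‖ ^ 2 := by
      rw [Real.cos_two_mul', hyc, hys]
    have hx : Real.cos (2 * x) = ‖(γ t).fst‖ ^ 2 - ‖(γ t).snd‖ ^ 2 := by
      simp [hfst, hsnd, norm_smul, hu, hv, Real.cos_two_mul']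
    refine (hasDerivAt_primitive_polar_of_sin_two_mul_ne_zero hf hper hodd h hcos hx hs).congr_deriv
      ?_
    rw [WithLp.prod_inner_apply] at htan
    change ⟪(γ t).fst, γ'.fst⟫_ℝ + ⟪(γ t).snd, γ'.snd⟫_ℝ = 0 at htan
    rw [hfst, hsnd, real_inner_smul_left, real_inner_smul_left] at htan ⊢
    rw [Real.sin_two_mul] at hs ⊢
    have hsx : Real.sin x ≠ 0 := fun hz => hs (by simp [hz])
    have hcx : Real.cos x ≠ 0 := fun hz => hs (by simp [hz])
    have hsq := Real.sin_sq_add_cos_sq x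
    have ha : ⟪u, γ'.fst⟫_ℝ = -(Real.sin x * ⟪v, γ'.snd⟫_ℝ) / Real.cos x := by
      rw [eq_div_iff hcx]
      linarith
    rw [ha]
    field_simp
    rw [hsq]
    ring

end Curve

theorem potential_well_defined_and_gradient (k l : ℕ) (hk : 1 ≤ k) (hl : 1 ≤ l)
    (f : ℝ → ℝ) (hf : Continuous f) (hper : Function.Periodic f Real.pi)
    (hodd : ∀ x : ℝ, f (-x) = -f x) :
    -- φ is well defined: the value `∫₀ˣ f` does not depend on the representation
    (∀ (x y : ℝ) (u U : EuclideanSpace ℝ (Fin k)) (v V : EuclideanSpace ℝ (Fin l)),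
      ‖u‖ = 1 → ‖U‖ = 1 → ‖v‖ = 1 → ‖V‖ = 1 →
      splitPt (Real.cos x • u) (Real.sin x • v) = splitPt (Real.cos y • U) (Real.sin y • V) →
      ∫ s in (0:ℝ)..x, f s = ∫ s in (0:ℝ)..y, f s) ∧
    -- if `f` is smooth, the gradient of `φ` at `p = (cos x · u, sin x · v)` is
    -- `G = f(x)·(−sin x · u, cos x · v)`
    (ContDiff ℝ (⊤ : ℕ∞) f →
      ∀ φ : SplitSpace k l → ℝ,
      (∀ (x : ℝ) (u : EuclideanSpace ℝ (Fin k)) (v : EuclideanSpace ℝ (Fin l)),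
        ‖u‖ = 1 → ‖v‖ = 1 →
        φ (splitPt (Real.cos x • u) (Real.sin x • v)) = ∫ s in (0:ℝ)..x, f s) →
      ∀ (x : ℝ) (u : EuclideanSpace ℝ (Fin k)) (v : EuclideanSpace ℝ (Fin l)),
        ‖u‖ = 1 → ‖v‖ = 1 →
        ⟪f x • splitPt ((-Real.sin x) • u) (Real.cos x • v),
          splitPt (Real.cos x • u) (Real.sin x • v)⟫_ℝ = 0 ∧
        ∀ γ : ℝ → SplitSpace k l, (∀ t : ℝ, ‖γ t‖ = 1) →
          γ 0 = splitPt (Real.cos x • u) (Real.sin x • v) →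
          DifferentiableAt ℝ γ 0 →
          deriv (fun t => φ (γ t)) 0
            = ⟪f x • splitPt ((-Real.sin x) • u) (Real.cos x • v), deriv γ 0⟫_ℝ) := by
  refine ⟨fun x y u U v V hu hU hv hV h => ?_, fun _ φ hφ x u v hu hv => ⟨?_, ?_⟩⟩
  · apply primitive_eq_of_cos_two_mul_eq hf hper hodd
    rw [← cos_two_mul_eq_norm_sq_sub x hu hv, h, cos_two_mul_eq_norm_sq_sub y hU hV]
  · rw [real_inner_smul_left, WithLp.prod_inner_apply]
    change f x * (⟪(-Real.sin x) • u, Real.cos x • u⟫_ℝ + ⟪Real.cos x • v, Real.sin x • v⟫_ℝ) = 0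
    simp only [real_inner_smul_left, real_inner_smul_right, real_inner_self_eq_norm_sq, hu, hv]
    ring
  · intro γ hγ h0 hd
    choose y hy hyc hys w z hw hz hp using fun s => exists_polar hk hl (γ s) (hγ s)
    have hφy : (fun s => φ (γ s)) = fun s => ∫ r in (0 : ℝ)..y s, f r := by
      funext s
      rw [← hp s, hφ _ _ _ (hw s) (hz s)]
    have h := hasDerivAt_primitive_polar hf hper hodd hγ hd.hasDerivAt hy hyc hys hu hv
      (by rw [h0]; rfl) (by rw [h0]; rfl)
    rw [hφy, h.deriv, real_inner_smul_left, WithLp.prod_inner_apply]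
    change _ = f x * (⟪(-Real.sin x) • u, (deriv γ 0).fst⟫_ℝ + ⟪Real.cos x • v, (deriv γ 0).snd⟫_ℝ)
    rw [real_inner_smul_left, real_inner_smul_left]

end
end

section
/- Let a > 0, n ≥ 1, and let A = a·[[0, e₀ᵀ],[e₀, 0]] be as above. For q = (cos x, sin x · v) ∈ Sⁿ with v ∈ ℝⁿ a unit vector, the geodesic distance on the round sphere from q to exp(A)·q equals ∫₀¹ a|sin x| / (cos x · sinh(at) + cosh(at)) dt; that is, arccos⟨q, exp(A)·q⟩ = ∫₀¹ a|sin x| / (cos x · sinh(at) + cosh(at)) dt. -/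
/- Godoy–Salvai, proof of Theorem 1: for `q = (cos x, sin x · v) ∈ Sⁿ ⊆ ℝ ⊕ ℝⁿ`, the
geodesic distance from `q` to `exp(A)·q = ((sinh a + cos x cosh a)/h, (sin x · v)/h)`,
`h = cos x sinh a + cosh a`, equals `∫₀¹ a|sin x|/(cos x sinh(at) + cosh(at)) dt`. -/

open Metric
open scoped InnerProductSpace

noncomputable section

/-- The conformal factor `c sinh t + cosh t` is positive for `|c| ≤ 1`. -/
lemma mul_sinh_add_cosh_pos {c : ℝ} (hc : |c| ≤ 1) (t : ℝ) :
    0 < c * Real.sinh t + Real.cosh t := by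
  obtain ⟨h₁, h₂⟩ := abs_le.1 hc
  rw [Real.sinh_eq, Real.cosh_eq]
  have hp := Real.exp_pos t
  have hn := Real.exp_pos (-t)
  rcases le_or_gt 0 c with h | h
  · nlinarith [mul_nonneg h hp.le, mul_nonneg (sub_nonneg.2 h₂) hn.le]
  · nlinarith [mul_nonneg (by linarith : 0 ≤ c + 1) hp.le, mul_neg_of_neg_of_pos h hn]

/-- The first coordinate of the image of a point with first coordinate `c` under the
conformal flow at time `t`. -/
def axisFlow (c t : ℝ) : ℝ :=
  (Real.sinh t + c * Real.cosh t) / (c * Real.sinh t + Real.cosh t)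

lemma axisFlow_zero (c : ℝ) : axisFlow c 0 = c := by simp [axisFlow]

lemma one_sub_axisFlow_sq {c : ℝ} (hc : |c| ≤ 1) (t : ℝ) :
    1 - axisFlow c t ^ 2 = (1 - c ^ 2) / (c * Real.sinh t + Real.cosh t) ^ 2 := by
  have h := (mul_sinh_add_cosh_pos hc t).ne'
  rw [axisFlow, div_pow, eq_div_iff (pow_ne_zero 2 h), sub_mul, div_mul_cancel₀ _ (pow_ne_zero 2 h)]
  linear_combination (1 - c ^ 2) * Real.cosh_sq t

lemma sqrt_one_sub_axisFlow_sq {c : ℝ} (hc : |c| ≤ 1) (t : ℝ) :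
    √(1 - axisFlow c t ^ 2) = √(1 - c ^ 2) / (c * Real.sinh t + Real.cosh t) := by
  rw [one_sub_axisFlow_sq hc, Real.sqrt_div' _ (sq_nonneg _),
    Real.sqrt_sq (mul_sinh_add_cosh_pos hc t).le]

lemma le_axisFlow {c t : ℝ} (hc : |c| ≤ 1) (ht : 0 ≤ t) : c ≤ axisFlow c t := by
  rw [axisFlow, le_div_iff₀ (mul_sinh_add_cosh_pos hc t)]
  nlinarith [mul_nonneg (sub_nonneg.2 ((sq_le_one_iff_abs_le_one c).2 hc))
    (Real.sinh_nonneg_iff.2 ht)]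

lemma hasDerivAt_axisFlow {c : ℝ} (hc : |c| ≤ 1) (t : ℝ) :
    HasDerivAt (axisFlow c) ((1 - c ^ 2) / (c * Real.sinh t + Real.cosh t) ^ 2) t := by
  have h := ((Real.hasDerivAt_sinh t).add ((Real.hasDerivAt_cosh t).const_mul c)).div
    (((Real.hasDerivAt_sinh t).const_mul c).add (Real.hasDerivAt_cosh t))
    (mul_sinh_add_cosh_pos hc t).ne'
  refine h.congr_deriv ?_
  simp only [Pi.add_apply]
  congr 1
  linear_combination (1 - c ^ 2) * Real.cosh_sq t

lemma hasDerivAt_neg_arccos_axisFlow {c : ℝ} (hc : |c| < 1) (t : ℝ) :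
    HasDerivAt (fun t => -Real.arccos (axisFlow c t))
      (√(1 - c ^ 2) / (c * Real.sinh t + Real.cosh t)) t := by
  have hpos := mul_sinh_add_cosh_pos hc.le t
  have hs : 0 < 1 - c ^ 2 := sub_pos.2 ((sq_lt_one_iff_abs_lt_one c).2 hc)
  have hw : 0 < 1 - axisFlow c t ^ 2 := by
    rw [one_sub_axisFlow_sq hc.le]
    positivity
  have h := ((Real.hasDerivAt_arccos (x := axisFlow c t) (by rintro h; simp [h] at hw)
    (by rintro h; simp [h] at hw)).comp t (hasDerivAt_axisFlow hc.le t)).neg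
  refine h.congr_deriv ?_
  rw [sqrt_one_sub_axisFlow_sq hc.le]
  have hr := Real.sqrt_pos.2 hs
  have hsq := Real.sq_sqrt hs.le
  field_simp
  linear_combination -hsq

lemma integral_eq_arccos_sub_arccos {c : ℝ} (hc : |c| < 1) (a : ℝ) :
    ∫ t in (0:ℝ)..1, a * √(1 - c ^ 2) / (c * Real.sinh (a * t) + Real.cosh (a * t))
      = Real.arccos c - Real.arccos (axisFlow c a) := by
  rw [intervalIntegral.integral_eq_sub_of_hasDerivAt
    (f := fun t => -Real.arccos (axisFlow c (a * t)))]
  · simp only [mul_one, mul_zero, axisFlow_zero]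
    ring
  · intro t _
    have h := (hasDerivAt_neg_arccos_axisFlow hc (a * t)).comp t
      ((hasDerivAt_id t).const_mul a)
    refine h.congr_deriv ?_
    ring
  · refine Continuous.intervalIntegrable (Continuous.div (by fun_prop) (by fun_prop) ?_) _ _
    exact fun t => (mul_sinh_add_cosh_pos hc.le (a * t)).ne'

lemma arccos_sub_arccos_of_le {x y : ℝ} (hx : -1 ≤ x) (hxy : x ≤ y) (hy : y ≤ 1) :
    Real.arccos x - Real.arccos y = Real.arccos (x * y + √(1 - x ^ 2) * √(1 - y ^ 2)) := by
  have hcos : Real.cos (Real.arccos x - Real.arccos y)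
      = x * y + √(1 - x ^ 2) * √(1 - y ^ 2) := by
    rw [Real.cos_sub, Real.cos_arccos hx (hxy.trans hy), Real.cos_arccos (hx.trans hxy) hy,
      Real.sin_arccos, Real.sin_arccos]
  rw [← hcos, Real.arccos_cos]
  · exact sub_nonneg.2 (Real.arccos_le_arccos hxy)
  · linarith [Real.arccos_le_pi x, Real.arccos_nonneg y]

theorem dist_to_conformal_image (n : ℕ) (hn : 1 ≤ n) (a : ℝ) (ha : 0 < a)
    (x : ℝ) (v : EuclideanSpace ℝ (Fin n)) (hv : ‖v‖ = 1) :
    Real.arccos ⟪axisPt (Real.cos x) (Real.sin x • v),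
        axisPt ((Real.sinh a + Real.cos x * Real.cosh a) /
            (Real.cos x * Real.sinh a + Real.cosh a))
          ((Real.cos x * Real.sinh a + Real.cosh a)⁻¹ • (Real.sin x • v))⟫_ℝ
      = ∫ t in (0:ℝ)..1,
          a * |Real.sin x| / (Real.cos x * Real.sinh (a * t) + Real.cosh (a * t)) := by
  have hsin : √(1 - Real.cos x ^ 2) = |Real.sin x| := (Real.abs_sin_eq_sqrt_one_sub_cos_sq x).symm
  have hc : |Real.cos x| ≤ 1 := Real.abs_cos_le_one x
  have hpos := mul_sinh_add_cosh_pos hc a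
  have hinner : ⟪axisPt (Real.cos x) (Real.sin x • v),
        axisPt ((Real.sinh a + Real.cos x * Real.cosh a) /
            (Real.cos x * Real.sinh a + Real.cosh a))
          ((Real.cos x * Real.sinh a + Real.cosh a)⁻¹ • (Real.sin x • v))⟫_ℝ
      = Real.cos x * axisFlow (Real.cos x) a
        + √(1 - Real.cos x ^ 2) * √(1 - axisFlow (Real.cos x) a ^ 2) := by
    rw [sqrt_one_sub_axisFlow_sq hc, hsin, ← mul_div_assoc, abs_mul_abs_self]
    simp only [axisPt, WithLp.prod_inner_apply, WithLp.equiv_symm_apply, real_inner_smul_right,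
      real_inner_self_eq_norm_sq, norm_smul, hv, mul_one, Real.norm_eq_abs, sq_abs, axisFlow,
      RCLike.inner_apply, conj_trivial]
    ring
  have hw : axisFlow (Real.cos x) a ≤ 1 := by
    refine (abs_le.1 ((sq_le_one_iff_abs_le_one _).1 (sub_nonneg.1 ?_))).2
    rw [one_sub_axisFlow_sq hc, ← Real.sin_sq]
    positivity
  rw [hinner, ← arccos_sub_arccos_of_le (Real.neg_one_le_cos x) (le_axisFlow hc ha.le) hw]
  rcases eq_or_ne (Real.sin x) 0 with h0 | h0
  · have hfix : axisFlow (Real.cos x) a = Real.cos x := by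
      rw [axisFlow, div_eq_iff hpos.ne']
      linear_combination Real.sinh a * (Real.sin_sq_add_cos_sq x).symm
        + Real.sinh a * Real.sin x * h0
    simp [hfix, h0]
  · rw [← integral_eq_arccos_sub_arccos, hsin]
    rw [← sq_lt_one_iff_abs_lt_one, Real.cos_sq']
    have := sq_pos_of_ne_zero h0
    linarith

end
end

section
/- Let a > 0 and define g : ℝ → ℝ by g(x) = −∫₀¹ a sin x / (cos x · sinh(at) + cosh(at)) dt. Then g is smooth, 2π-periodic and odd, and for every x ∈ ℝ, g'(x) = 1/(cos x · sinh a + cosh a) − 1; in particular g'(x) + 1 > 0 for all x. -/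
/- Godoy–Salvai, proof of Theorem 1: the function
`g(x) = −∫₀¹ a sin x/(cos x sinh(at) + cosh(at)) dt` is smooth, `2π`-periodic and odd,
with `g'(x) = 1/(cos x sinh a + cosh a) − 1`; in particular `g' + 1 > 0`. -/

noncomputable def gConf (a : ℝ) : ℝ → ℝ := fun x =>
  -∫ t in (0:ℝ)..1, a * Real.sin x / (Real.cos x * Real.sinh (a * t) + Real.cosh (a * t))

open Real in
/-- The denominator of the half-angle tangent expression for `gConf` is positive. -/
lemma one_add_add_one_sub_mul_cos_pos {r : ℝ} (hr : 0 < r) (x : ℝ) :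
    0 < (1 + r) + (1 - r) * cos x := by
  rcases le_or_gt 0 (cos x) with h | h
  · nlinarith [cos_le_one x, mul_nonneg hr.le (sub_nonneg.2 (cos_le_one x))]
  · nlinarith [neg_one_le_cos x, mul_pos hr (neg_pos.2 h)]

open Real in
lemma cos_mul_sinh_add_cosh_eq (x y : ℝ) :
    cos x * sinh y + cosh y =
      ((1 + exp (-y) ^ 2) + (1 - exp (-y) ^ 2) * cos x) / (2 * exp (-y)) := by
  have h : exp y * exp (-y) = 1 := by rw [← exp_add]; simp
  have := exp_pos (-y)
  rw [sinh_eq, cosh_eq, eq_div_iff (by positivity)]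
  linear_combination (1 + cos x) * h

open Real in
lemma cos_mul_sinh_add_cosh_pos (x y : ℝ) : 0 < cos x * sinh y + cosh y := by
  rw [cos_mul_sinh_add_cosh_eq]
  have := exp_pos (-y)
  exact div_pos (one_add_add_one_sub_mul_cos_pos (by positivity) x) (by positivity)

lemma HasDerivAt.two_mul_arctan_div {u v : ℝ → ℝ} {u' v' x : ℝ}
    (hu : HasDerivAt u u' x) (hv : HasDerivAt v v' x) (h0 : v x ≠ 0) :
    HasDerivAt (fun y => 2 * Real.arctan (u y / v y))
      (2 * (u' * v x - u x * v') / (v x ^ 2 + u x ^ 2)) x := by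
  have h1 : v x ^ 2 + u x ^ 2 ≠ 0 := by positivity
  refine ((hu.div hv h0).arctan.const_mul 2).congr_deriv ?_
  simp only [Pi.div_apply]
  have h2 : 1 + (u x / v x) ^ 2 = (v x ^ 2 + u x ^ 2) / v x ^ 2 := by field_simp
  rw [h2]
  field_simp

open Real in
lemma hasDerivAt_two_mul_arctan_param (a x t : ℝ) :
    HasDerivAt (fun t => 2 * arctan ((exp (-(a * t)) - 1) * sin x /
        ((1 + exp (-(a * t))) + (1 - exp (-(a * t))) * cos x)))
      (-(a * sin x / (cos x * sinh (a * t) + cosh (a * t)))) t := by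
  have hr := exp_pos (-(a * t))
  have he : HasDerivAt (fun t => exp (-(a * t))) (exp (-(a * t)) * (-(a * 1))) t :=
    (((hasDerivAt_id t).const_mul a).neg).exp
  have hD := one_add_add_one_sub_mul_cos_pos hr x
  have hE := one_add_add_one_sub_mul_cos_pos (pow_pos hr 2) x
  refine (((he.sub_const 1).mul_const (sin x)).two_mul_arctan_div
    ((he.const_add 1).add ((he.const_sub 1).mul_const (cos x))) hD.ne').congr_deriv ?_
  rw [cos_mul_sinh_add_cosh_eq]
  simp only [Pi.add_apply]
  generalize exp (-(a * t)) = r at *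
  have hN : ((1 + r) + (1 - r) * cos x) ^ 2 + ((r - 1) * sin x) ^ 2 =
      2 * ((1 + r ^ 2) + (1 - r ^ 2) * cos x) := by
    linear_combination (1 - r) ^ 2 * sin_sq_add_cos_sq x
  rw [hN]
  generalize hq : (1 + r ^ 2) + (1 - r ^ 2) * cos x = q at *
  field_simp
  ring

open Real in
lemma gConf_eq_two_mul_arctan (a : ℝ) :
    gConf a = fun x => 2 * arctan ((exp (-a) - 1) * sin x /
      ((1 + exp (-a)) + (1 - exp (-a)) * cos x)) := by
  funext x
  have hc : Continuous fun t : ℝ => -(a * sin x / (cos x * sinh (a * t) + cosh (a * t))) := by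
    refine (Continuous.div (by fun_prop) ?_ fun t => (cos_mul_sinh_add_cosh_pos x _).ne').neg
    exact (continuous_const.mul (continuous_sinh.comp (by fun_prop))).add
      (continuous_cosh.comp (by fun_prop))
  have h := intervalIntegral.integral_eq_sub_of_hasDerivAt
    (fun t _ => hasDerivAt_two_mul_arctan_param a x t) (hc.intervalIntegrable 0 1)
  rw [intervalIntegral.integral_neg] at h
  simpa [gConf] using h

open Real in
lemma hasDerivAt_gConf (a x : ℝ) :
    HasDerivAt (gConf a) (1 / (cos x * sinh a + cosh a) - 1) x := by
  have hr := exp_pos (-a)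
  have hD := one_add_add_one_sub_mul_cos_pos hr x
  have hE := one_add_add_one_sub_mul_cos_pos (pow_pos hr 2) x
  rw [gConf_eq_two_mul_arctan, cos_mul_sinh_add_cosh_eq]
  refine (((hasDerivAt_sin x).const_mul (exp (-a) - 1)).two_mul_arctan_div
    (((hasDerivAt_cos x).const_mul (1 - exp (-a))).const_add (1 + exp (-a)))
    hD.ne').congr_deriv ?_
  generalize exp (-a) = r at *
  have hN : ((1 + r) + (1 - r) * cos x) ^ 2 + ((r - 1) * sin x) ^ 2 =
      2 * ((1 + r ^ 2) + (1 - r ^ 2) * cos x) := by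
    linear_combination (1 - r) ^ 2 * sin_sq_add_cos_sq x
  rw [hN]
  generalize hq : (1 + r ^ 2) + (1 - r ^ 2) * cos x = q at *
  field_simp
  rw [← hq]
  linear_combination -(1 - r) ^ 2 * sin_sq_add_cos_sq x

open Real in
lemma contDiff_gConf (a : ℝ) {n : ℕ∞} : ContDiff ℝ n (gConf a) := by
  rw [gConf_eq_two_mul_arctan]
  refine contDiff_const.mul (ContDiff.arctan (ContDiff.div ?_ ?_ fun x =>
    (one_add_add_one_sub_mul_cos_pos (exp_pos (-a)) x).ne'))
  · exact contDiff_const.mul contDiff_sin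
  · exact contDiff_const.add (contDiff_const.mul contDiff_cos)

theorem gConf_properties (a : ℝ) (ha : 0 < a) :
    ContDiff ℝ (⊤ : ℕ∞) (gConf a) ∧
    Function.Periodic (gConf a) (2 * Real.pi) ∧
    (∀ x : ℝ, gConf a (-x) = -gConf a x) ∧
    (∀ x : ℝ, deriv (gConf a) x = 1 / (Real.cos x * Real.sinh a + Real.cosh a) - 1) ∧
    (∀ x : ℝ, 0 < deriv (gConf a) x + 1) := by
  refine ⟨contDiff_gConf a, fun x => by simp [gConf], fun x => ?_,
    fun x => (hasDerivAt_gConf a x).deriv, fun x => ?_⟩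
  · simp [gConf, neg_div]
  · rw [(hasDerivAt_gConf a x).deriv, sub_add_cancel]
    exact one_div_pos.2 (cos_mul_sinh_add_cosh_pos x a)
end

section
/- Let n ≥ 2 and let p, q ∈ Sⁿ be distinct non-antipodal points at geodesic distance d = arccos⟨p,q⟩ ∈ (0,π). Let {u₁, …, u_n} be an orthonormal basis of the tangent space T_pSⁿ = p^⊥ with u₁ = (q − ⟨p,q⟩p)/sin d, and let v₁ = (⟨p,q⟩q − p)/sin d and v_j = u_j for j ≥ 2 (so {v₁, …, v_n} is the parallel transport of {u₁, …, u_n} along the minimal geodesic from p to q). Then for all i, j ∈ {1, …, n}, the mixed second derivative −∂²/∂t∂s |_{s=t=0} [ ½ arccos²⟨cos s · p + sin s · u_i , cos t · q + sin t · v_j⟩ ] equals: 1 if i = j = 1; d/sin d if i = j ≥ 2; and 0 if i ≠ j. -/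
/- Godoy–Salvai, Proposition 6: the matrix of the symplectic form `ω` associated to the
cost `c = ½ d²` on `Sⁿ × Sⁿ`. For `p,q ∈ Sⁿ` distinct non-antipodal, `{u₁,…,u_n}` an
orthonormal basis of `T_pSⁿ` with `u₁` the initial velocity of the minimal geodesic from
`p` to `q`, and `{v₁,…,v_n}` its parallel transport to `q`, the mixed derivatives
`−∂²/∂t∂s|₀ ½ arccos²⟨cos s·p + sin s·uᵢ, cos t·q + sin t·vⱼ⟩` equal `1` if `i=j=1`,
`d/sin d` if `i=j≥2`, and `0` if `i≠j`. (Indices here run over `Fin n`, with `0`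
playing the role of `1`.) -/

open Metric
open scoped InnerProductSpace

/-- The derivative of `½ arccos²` on `(-1, 1)`. -/
theorem hasDerivAt_half_arccos_sq {x : ℝ} (h₁ : -1 < x) (h₂ : x < 1) :
    HasDerivAt (fun y => Real.arccos y ^ 2 / 2) (-(Real.arccos x / √(1 - x ^ 2))) x := by
  refine ((Real.hasDerivAt_arccos h₁.ne' h₂.ne).fun_pow 2 |>.div_const 2).congr_deriv ?_
  push_cast
  ring

/-- The derivative of `arccos x / √(1 - x²)` at `cos d`. -/
theorem hasDerivAt_arccos_div_sqrt {d : ℝ} (hd0 : 0 < d) (hdπ : d < Real.pi) :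
    HasDerivAt (fun y => Real.arccos y / √(1 - y ^ 2))
      (d * Real.cos d / Real.sin d ^ 3 - 1 / Real.sin d ^ 2) (Real.cos d) := by
  have hS : 0 < Real.sin d := Real.sin_pos_of_pos_of_lt_pi hd0 hdπ
  have hsq : 1 - Real.cos d ^ 2 = Real.sin d ^ 2 := (Real.sin_sq d).symm
  have hsqrt : √(1 - Real.cos d ^ 2) = Real.sin d := by rw [hsq, Real.sqrt_sq hS.le]
  have hne1 : Real.cos d ≠ -1 := by intro h; rw [h] at hsq; nlinarith
  have hne2 : Real.cos d ≠ 1 := by intro h; rw [h] at hsq; nlinarith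
  have hs : HasDerivAt (fun y : ℝ => 1 - y ^ 2) (-(2 * Real.cos d)) (Real.cos d) := by
    simpa using (hasDerivAt_pow 2 (Real.cos d)).const_sub 1
  have hr := hs.sqrt (by rw [hsq]; positivity)
  refine ((Real.hasDerivAt_arccos hne1 hne2).fun_div hr (by rw [hsqrt]; positivity)).congr_deriv ?_
  rw [hsqrt, Real.arccos_cos hd0.le hdπ.le]
  field_simp
  ring

/-- The mixed second derivative at `0` of `½ arccos²` of the inner product of two trigonometric
curves through `p` and `q`. -/
theorem deriv_deriv_half_arccos_sq_inner {E : Type*} [NormedAddCommGroup E]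
    [InnerProductSpace ℝ E] {p q : E} {d : ℝ} (hd0 : 0 < d) (hdπ : d < Real.pi)
    (hpq : ⟪p, q⟫_ℝ = Real.cos d) (u v : E) :
    deriv (fun t : ℝ => deriv (fun s : ℝ =>
      Real.arccos ⟪Real.cos s • p + Real.sin s • u,
        Real.cos t • q + Real.sin t • v⟫_ℝ ^ 2 / 2) 0) 0 =
      ⟪u, q⟫_ℝ * ⟪p, v⟫_ℝ * (1 / Real.sin d ^ 2 - d * Real.cos d / Real.sin d ^ 3) -
        d / Real.sin d * ⟪u, v⟫_ℝ := by
  have hS : 0 < Real.sin d := Real.sin_pos_of_pos_of_lt_pi hd0 hdπ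
  have hcs := Real.sin_sq_add_cos_sq d
  have hsqrt : √(1 - Real.cos d ^ 2) = Real.sin d := by
    rw [← Real.sin_sq, Real.sqrt_sq hS.le]
  have trig (a b : ℝ) : HasDerivAt (fun t => Real.cos t * a + Real.sin t * b) b 0 := by
    simpa using ((Real.hasDerivAt_cos 0).mul_const a).fun_add ((Real.hasDerivAt_sin 0).mul_const b)
  have hg := trig (Real.cos d) ⟪p, v⟫_ℝ
  have hmem : ∀ᶠ t in nhds (0 : ℝ),
      Real.cos t * Real.cos d + Real.sin t * ⟪p, v⟫_ℝ ∈ Set.Ioo (-1 : ℝ) 1 :=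
    hg.continuousAt.eventually_mem (Ioo_mem_nhds
      (by simp only [Real.cos_zero, Real.sin_zero]; nlinarith)
      (by simp only [Real.cos_zero, Real.sin_zero]; nlinarith))
  have hinner : (fun t : ℝ => deriv (fun s : ℝ =>
      Real.arccos ⟪Real.cos s • p + Real.sin s • u,
        Real.cos t • q + Real.sin t • v⟫_ℝ ^ 2 / 2) 0) =ᶠ[nhds 0] fun t =>
      -(Real.arccos (Real.cos t * Real.cos d + Real.sin t * ⟪p, v⟫_ℝ) /
        √(1 - (Real.cos t * Real.cos d + Real.sin t * ⟪p, v⟫_ℝ) ^ 2)) *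
        (Real.cos t * ⟪u, q⟫_ℝ + Real.sin t * ⟪u, v⟫_ℝ) := by
    filter_upwards [hmem] with t ht
    have hin := trig (Real.cos t * Real.cos d + Real.sin t * ⟪p, v⟫_ℝ)
      (Real.cos t * ⟪u, q⟫_ℝ + Real.sin t * ⟪u, v⟫_ℝ)
    have hF := (hasDerivAt_half_arccos_sq ht.1 ht.2).comp_of_eq 0 hin (by simp)
    rw [← hF.deriv]
    congr 1
    funext s
    simp only [Function.comp_apply, inner_add_left, inner_add_right, real_inner_smul_left,
      real_inner_smul_right, hpq]
    ring_nf
  rw [hinner.deriv_eq]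
  have hF := (hasDerivAt_arccos_div_sqrt hd0 hdπ).comp_of_eq 0 hg (by simp)
  have hprod := hF.fun_neg.fun_mul (trig ⟪u, q⟫_ℝ ⟪u, v⟫_ℝ)
  refine hprod.deriv.trans ?_
  simp only [Function.comp_apply, Real.cos_zero, Real.sin_zero, one_mul, zero_mul, add_zero,
    hsqrt, Real.arccos_cos hd0.le hdπ.le]
  ring

theorem omega_matrix (n : ℕ) (hn : 2 ≤ n)
    (p q : sphere (0 : EuclideanSpace ℝ (Fin (n + 1))) 1)
    (d : ℝ)
    (hd : d = Real.arccos ⟪(p : EuclideanSpace ℝ (Fin (n + 1))),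
      (q : EuclideanSpace ℝ (Fin (n + 1)))⟫_ℝ)
    (hd0 : 0 < d) (hdπ : d < Real.pi)
    (u v : Fin n → EuclideanSpace ℝ (Fin (n + 1)))
    (huorth : ∀ i j : Fin n, ⟪u i, u j⟫_ℝ = if i = j then 1 else 0)
    (hutan : ∀ i : Fin n, ⟪u i, (p : EuclideanSpace ℝ (Fin (n + 1)))⟫_ℝ = 0)
    (hu0 : ∀ i : Fin n, (i : ℕ) = 0 → u i = (Real.sin d)⁻¹ •
      ((q : EuclideanSpace ℝ (Fin (n + 1))) -
        ⟪(p : EuclideanSpace ℝ (Fin (n + 1))), (q : EuclideanSpace ℝ (Fin (n + 1)))⟫_ℝ •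
          (p : EuclideanSpace ℝ (Fin (n + 1)))))
    (hv0 : ∀ i : Fin n, (i : ℕ) = 0 → v i = (Real.sin d)⁻¹ •
      (⟪(p : EuclideanSpace ℝ (Fin (n + 1))), (q : EuclideanSpace ℝ (Fin (n + 1)))⟫_ℝ •
        (q : EuclideanSpace ℝ (Fin (n + 1))) - (p : EuclideanSpace ℝ (Fin (n + 1)))))
    (hvi : ∀ i : Fin n, (i : ℕ) ≠ 0 → v i = u i) :
    ∀ i j : Fin n,
      -(deriv (fun t : ℝ => deriv (fun s : ℝ =>
          Real.arccos ⟪Real.cos s • (p : EuclideanSpace ℝ (Fin (n + 1))) + Real.sin s • u i,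
            Real.cos t • (q : EuclideanSpace ℝ (Fin (n + 1))) + Real.sin t • v j⟫_ℝ ^ 2 / 2) 0) 0)
        = if i = j then (if (i : ℕ) = 0 then 1 else d / Real.sin d) else 0 := by
  intro i j
  have hS : 0 < Real.sin d := Real.sin_pos_of_pos_of_lt_pi hd0 hdπ
  have hp : ⟪(p : EuclideanSpace ℝ (Fin (n + 1))), p⟫_ℝ = 1 := by simp
  have hq : ⟪(q : EuclideanSpace ℝ (Fin (n + 1))), q⟫_ℝ = 1 := by simp
  have hle := abs_le.mp (abs_real_inner_le_norm (p : EuclideanSpace ℝ (Fin (n + 1))) q)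
  have hpq : ⟪(p : EuclideanSpace ℝ (Fin (n + 1))), q⟫_ℝ = Real.cos d := by
    rw [hd, Real.cos_arccos (by simpa using hle.1) (by simpa using hle.2)]
  have hqp : ⟪(q : EuclideanSpace ℝ (Fin (n + 1))), p⟫_ℝ = Real.cos d := by
    rw [real_inner_comm, hpq]
  have hcs := Real.sin_sq_add_cos_sq d
  rw [hpq] at hu0 hv0
  have hpu (k : Fin n) : ⟪(p : EuclideanSpace ℝ (Fin (n + 1))), u k⟫_ℝ = 0 := by
    rw [real_inner_comm, hutan]
  have huq (k : Fin n) (hk : (k : ℕ) ≠ 0) :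
      ⟪u k, (q : EuclideanSpace ℝ (Fin (n + 1)))⟫_ℝ = 0 := by
    have h := huorth k ⟨0, by lia⟩
    rw [if_neg (fun h => hk (congrArg Fin.val h)), hu0 ⟨0, by lia⟩ rfl, real_inner_smul_right,
      inner_sub_right, real_inner_smul_right, hutan, mul_zero, sub_zero] at h
    exact (mul_eq_zero.mp h).resolve_left (inv_ne_zero hS.ne')
  rw [deriv_deriv_half_arccos_sq_inner hd0 hdπ hpq]
  by_cases hj : (j : ℕ) = 0
  · by_cases hi : (i : ℕ) = 0
    · have hij : i = j := Fin.ext (hi.trans hj.symm)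
      have huq0 : ⟪u i, (q : EuclideanSpace ℝ (Fin (n + 1)))⟫_ℝ = Real.sin d := by
        rw [hu0 i hi, real_inner_smul_left, inner_sub_left, real_inner_smul_left, hq, hpq]
        field_simp
        linarith
      have hpv0 : ⟪(p : EuclideanSpace ℝ (Fin (n + 1))), v j⟫_ℝ = -Real.sin d := by
        rw [hv0 j hj, real_inner_smul_right, inner_sub_right, real_inner_smul_right, hp, hpq]
        field_simp
        linarith
      have huv0 : ⟪u i, v j⟫_ℝ = Real.cos d := by
        rw [hv0 j hj, real_inner_smul_right, inner_sub_right, real_inner_smul_right, hutan, huq0]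
        field_simp
        ring
      rw [if_pos hij, if_pos hi, huq0, hpv0, huv0]
      field_simp
      ring
    · have hij : i ≠ j := fun h => hi (h ▸ hj)
      rw [if_neg hij, hv0 j hj, huq i hi]
      simp [real_inner_smul_right, inner_sub_right, huq i hi, hutan]
  · rw [hvi j hj, hpu, huorth]
    by_cases hij : i = j
    · simp [hij, hj]
    · simp [hij]
end

section
/- Let n ≥ 2 and let P = diag(λ₀, λ₁, …, λ_n) be positive definite with λ₀, λ₁, λ₂ pairwise distinct, and let T : Sⁿ → Sⁿ, T(p) = P(p)/‖P(p)‖. Let p ∈ Sⁿ have all coordinates nonzero, write p = (x, y) with x ∈ ℝ³, set q = T(p), d = arccos⟨p,q⟩, and define u₁ = (q − ⟨p,q⟩p)/‖q − ⟨p,q⟩p‖, v₁ = (⟨p,q⟩q − p)/‖⟨p,q⟩q − p‖, and u₂ = v₂ = (P₁(x) × x, 0)/‖P₁(x) × x‖ where P₁ = diag(λ₀, λ₁, λ₂) and × is the cross product in ℝ³. Then ⟨dT_p(u₁), v₂⟩ ≠ (sin d / d) · ⟨dT_p(u₂), v₁⟩; consequently the graph of dT_p is not a Lagrangian subspace of T_pSⁿ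 × T_qSⁿ with respect to the symplectic form ω associated to the cost c = ½d². -/
/- Godoy–Salvai, Proposition 7 (key computation): for `P = diag(λ₀,…,λ_n)` positive
definite with `λ₀, λ₁, λ₂` pairwise distinct and `T(p) = P(p)/‖P(p)‖`, at any `p ∈ Sⁿ`
with all coordinates nonzero one has `⟨dT_p(u₁), v₂⟩ ≠ (sin d/d)·⟨dT_p(u₂), v₁⟩`, where
`q = T(p)`, `d = arccos⟨p,q⟩`, `u₁, v₁` are the unit initial/final velocities of the
minimal geodesic from `p` to `q`, and `u₂ = v₂` is the normalized embedding in the first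
three coordinates of `P₁(x) × x`, `x = (p₀,p₁,p₂)`, `P₁ = diag(λ₀,λ₁,λ₂)`. Hence the
graph of `dT_p` is not Lagrangian for the symplectic form associated to the cost `½d²`. -/

open scoped InnerProductSpace

/-- For a symmetric operator `P`, the differential of `p ↦ P p / ‖P p‖` fails the Lagrangian
condition as soon as some vector is orthogonal to `P p` but not to `P (P p)`. -/
theorem inner_differential_ne {E : Type*} [NormedAddCommGroup E] [InnerProductSpace ℝ E]
    {P : E →ₗ[ℝ] E} (hP : P.IsSymmetric) {p q w : E} (hp : ‖p‖ = 1)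
    (hq : q = ‖P p‖⁻¹ • P p) (hwPp : ⟪w, P p⟫_ℝ = 0)
    (hwPPp : ⟪w, P (P p)⟫_ℝ ≠ 0) {d : ℝ} (hd : d = Real.arccos ⟪p, q⟫_ℝ) {u v u' : E}
    (hu : u = ‖q - ⟪p, q⟫_ℝ • p‖⁻¹ • (q - ⟪p, q⟫_ℝ • p))
    (hv : v = ‖⟪p, q⟫_ℝ • q - p‖⁻¹ • (⟪p, q⟫_ℝ • q - p))
    (hu' : u' = ‖w‖⁻¹ • w) {D : E → E}
    (hD : ∀ z, D z = ‖P p‖⁻¹ • (P z - ⟪P z, q⟫_ℝ • q)) :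
    ⟪D u, u'⟫_ℝ ≠ (Real.sin d / d) * ⟪D u', v⟫_ℝ := by
  have hN : ‖P p‖ ≠ 0 := by
    intro h
    apply hwPPp
    simp [norm_eq_zero.mp h]
  have hw : ‖w‖ ≠ 0 := by
    intro h
    apply hwPPp
    simp [norm_eq_zero.mp h]
  have hq1 : ‖q‖ = 1 := by
    rw [hq, norm_smul, norm_inv, norm_norm, inv_mul_cancel₀ hN]
  have hwq : ⟪w, q⟫_ℝ = 0 := by rw [hq, inner_smul_right, hwPp, mul_zero]
  have hwPq : ⟪w, P q⟫_ℝ ≠ 0 := by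
    rw [hq, map_smul, inner_smul_right]
    exact mul_ne_zero (inv_ne_zero hN) hwPPp
  have hpp : ⟪p, p⟫_ℝ = 1 := by rw [real_inner_self_eq_norm_sq, hp, one_pow]
  have hqq : ⟪q, q⟫_ℝ = 1 := by rw [real_inner_self_eq_norm_sq, hq1, one_pow]
  set c := ⟪p, q⟫_ℝ with hc
  have hqp : ⟪q, p⟫_ℝ = c := real_inner_comm _ _
  have ha : ‖q - c • p‖ ^ 2 = 1 - c ^ 2 := by
    rw [← real_inner_self_eq_norm_sq]
    simp only [inner_sub_left, inner_sub_right, inner_smul_left, inner_smul_right, hpp, hqq,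
      hqp, ← hc, conj_trivial]
    ring
  have hb : ‖c • q - p‖ ^ 2 = 1 - c ^ 2 := by
    rw [← real_inner_self_eq_norm_sq]
    simp only [inner_sub_left, inner_sub_right, inner_smul_left, inner_smul_right, hpp, hqq,
      hqp, ← hc, conj_trivial]
    ring
  have hab : ‖c • q - p‖ = ‖q - c • p‖ :=
    (pow_left_inj₀ (norm_nonneg _) (norm_nonneg _) two_ne_zero).mp (hb.trans ha.symm)
  have ha0 : ‖q - c • p‖ ≠ 0 := by
    intro h
    have h' : q = c • p := sub_eq_zero.mp (norm_eq_zero.mp h)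
    apply hwPq
    rw [h', map_smul, inner_smul_right, hwPp, mul_zero]
  have hc1 : c ^ 2 < 1 := by
    have := pow_pos (lt_of_le_of_ne (norm_nonneg _) ha0.symm) 2
    linarith
  have hc_bounds := abs_lt.mp ((sq_lt_one_iff_abs_lt_one c).mp hc1)
  have hd0 : 0 < d := hd ▸ Real.arccos_pos.mpr hc_bounds.2
  have hcos : Real.cos d = c := by
    rw [hd, Real.cos_arccos hc_bounds.1.le hc_bounds.2.le]
  have hsin : 0 < Real.sin d := by
    rw [hd, Real.sin_arccos]
    exact Real.sqrt_pos.mpr (by linarith)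
  have hleft : ⟪D u, u'⟫_ℝ =
      ‖P p‖⁻¹ * ‖q - c • p‖⁻¹ * ‖w‖⁻¹ * ⟪w, P q⟫_ℝ := by
    rw [real_inner_comm, hD, hu, hu']
    simp only [map_smul, map_sub, inner_sub_right, inner_smul_left, inner_smul_right, hwq, hwPp,
      conj_trivial]
    ring
  have hPwq : ⟪P w, q⟫_ℝ = ⟪w, P q⟫_ℝ := hP w q
  have hPwp : ⟪P w, p⟫_ℝ = 0 := (hP w p).trans hwPp
  have hright : ⟪D u', v⟫_ℝ =
      c * (‖P p‖⁻¹ * ‖q - c • p‖⁻¹ * ‖w‖⁻¹ * ⟪w, P q⟫_ℝ) := by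
    rw [hD, hu', hv, hab]
    simp only [map_smul, inner_sub_left, inner_sub_right, inner_smul_left, inner_smul_right,
      hPwq, hPwp, hqq, hqp, conj_trivial]
    ring
  rw [hleft, hright]
  have hK : ‖P p‖⁻¹ * ‖q - c • p‖⁻¹ * ‖w‖⁻¹ * ⟪w, P q⟫_ℝ ≠ 0 := by positivity
  intro h
  rw [← mul_assoc] at h
  have h1 : Real.sin d / d * c = 1 := (mul_right_cancel₀ hK ((one_mul _).trans h)).symm
  have h2 : Real.sin d * c = d := by
    field_simp at h1
    linarith
  have h3 := Real.sin_lt hd0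
  nlinarith [hc_bounds.2]

/-- Coordinatewise multiplication by `lam` on Euclidean space. -/
noncomputable def diagonalMap {ι : Type*} (lam : ι → ℝ) :
    EuclideanSpace ℝ ι →ₗ[ℝ] EuclideanSpace ℝ ι where
  toFun z := WithLp.toLp 2 fun i => lam i * z i
  map_add' x y := by
    ext i
    simp [mul_add]
  map_smul' a x := by
    ext i
    simp [mul_left_comm]

theorem diagonalMap_apply {ι : Type*} (lam : ι → ℝ) (z : EuclideanSpace ℝ ι) (i : ι) :
    diagonalMap lam z i = lam i * z i := rfl

theorem isSymmetric_diagonalMap {ι : Type*} [Fintype ι] (lam : ι → ℝ) :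
    (diagonalMap lam).IsSymmetric := by
  intro x y
  simp only [PiLp.inner_apply, diagonalMap_apply, RCLike.inner_apply, conj_trivial]
  exact Finset.sum_congr rfl fun i _ => by ring

theorem graph_not_lagrangian (n : ℕ) (hn : 2 ≤ n)
    (lam : Fin (n + 1) → ℝ) (hlam : ∀ i, 0 < lam i)
    (h01 : lam 0 ≠ lam 1) (h02 : lam 0 ≠ lam 2) (h12 : lam 1 ≠ lam 2)
    (P : EuclideanSpace ℝ (Fin (n + 1)) → EuclideanSpace ℝ (Fin (n + 1)))
    (hP : ∀ (z : EuclideanSpace ℝ (Fin (n + 1))) (i : Fin (n + 1)), P z i = lam i * z i)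
    (p : EuclideanSpace ℝ (Fin (n + 1))) (hp : ‖p‖ = 1) (hp0 : ∀ i, p i ≠ 0)
    (q : EuclideanSpace ℝ (Fin (n + 1))) (hq : q = ‖P p‖⁻¹ • P p)
    (d : ℝ) (hd : d = Real.arccos ⟪p, q⟫_ℝ)
    (u₁ : EuclideanSpace ℝ (Fin (n + 1)))
    (hu₁ : u₁ = ‖q - ⟪p, q⟫_ℝ • p‖⁻¹ • (q - ⟪p, q⟫_ℝ • p))
    (v₁ : EuclideanSpace ℝ (Fin (n + 1)))
    (hv₁ : v₁ = ‖⟪p, q⟫_ℝ • q - p‖⁻¹ • (⟪p, q⟫_ℝ • q - p))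
    (w : EuclideanSpace ℝ (Fin (n + 1)))
    (hw : ∀ i : Fin (n + 1), w i =
      if h : (i : ℕ) < 3 then
        crossProduct (fun j : Fin 3 => lam (Fin.castLE (by omega) j) * p (Fin.castLE (by omega) j))
          (fun j : Fin 3 => p (Fin.castLE (by omega) j)) ⟨(i : ℕ), h⟩
      else 0)
    (u₂ : EuclideanSpace ℝ (Fin (n + 1))) (hu₂ : u₂ = ‖w‖⁻¹ • w)
    (dT : EuclideanSpace ℝ (Fin (n + 1)) → EuclideanSpace ℝ (Fin (n + 1)))
    (hdT : ∀ z, dT z = ‖P p‖⁻¹ • (P z - ⟪P z, q⟫_ℝ • q)) :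
    ⟪dT u₁, u₂⟫_ℝ ≠ (Real.sin d / d) * ⟪dT u₂, v₁⟫_ℝ := by
  obtain ⟨m, rfl⟩ : ∃ m, n = m + 2 := ⟨n - 2, by omega⟩
  obtain rfl : P = diagonalMap lam := by
    funext z
    ext i
    rw [hP, diagonalMap_apply]
  have hw0 : w 0 = lam 1 * p 1 * p 2 - lam 2 * p 2 * p 1 := by
    rw [hw, dif_pos (by simp), cross_apply]
    rfl
  have hw1 : w 1 = lam 2 * p 2 * p 0 - lam 0 * p 0 * p 2 := by
    rw [hw, dif_pos (by simp), cross_apply]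
    rfl
  have hw2 : w 2 = lam 0 * p 0 * p 1 - lam 1 * p 1 * p 0 := by
    rw [hw, dif_pos (Fin.val_two.trans_lt (by norm_num)), cross_apply]
    rfl
  have hw3 (i : Fin m) : w i.succ.succ.succ = 0 := by
    rw [hw, dif_neg (by simp)]
  have hinner (z : EuclideanSpace ℝ (Fin (m + 2 + 1))) :
      ⟪w, z⟫_ℝ = w 0 * z 0 + w 1 * z 1 + w 2 * z 2 := by
    simp only [PiLp.inner_apply, RCLike.inner_apply, conj_trivial, Fin.sum_univ_succ, hw3,
      mul_zero, Finset.sum_const_zero, Fin.succ_zero_eq_one, Fin.succ_one_eq_two]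
    ring
  refine inner_differential_ne (isSymmetric_diagonalMap lam) hp hq ?_ ?_ hd hu₁ hv₁ hu₂ hdT
  · rw [hinner, hw0, hw1, hw2]
    simp only [diagonalMap_apply]
    ring
  · have hvandermonde : ⟪w, diagonalMap lam (diagonalMap lam p)⟫_ℝ =
        p 0 * p 1 * p 2 * ((lam 0 - lam 1) * (lam 0 - lam 2) * (lam 1 - lam 2)) := by
      rw [hinner, hw0, hw1, hw2]
      simp only [diagonalMap_apply]
      ring
    rw [hvandermonde]
    exact mul_ne_zero
      (mul_ne_zero (mul_ne_zero (hp0 0) (hp0 1)) (hp0 2))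
      (mul_ne_zero (mul_ne_zero (sub_ne_zero.mpr h01) (sub_ne_zero.mpr h02))
        (sub_ne_zero.mpr h12))
end
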